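/- arXiv:1906.00406 — 2 statements merged into one kernel-verified Lean document; each statement's English description precedes it below -/
import Mathlib

section
/- Let $(A, \mathfrak m)$ be a Noetherian local ring, $M$ a finitely generated $A$-module, $F$ an $\mathfrak m$-primary good filtration and $F_1,\dots,F_s$ good filtrations of ideals of $A$ such that $I = (F_1)_1 \cdots (F_s)_1$ is not contained in $\sqrt{\mathrm{Ann}\,M}$. Set $q = \dim M/(0_M : I^\infty)$. Then the function $B(n_0, n_1,\dots,n_s) = \ell_A\big((F)_{n_0}(F_1)_{n_1}\cdots(F_s)_{n_s} M / (F)_{n_0+1}(F_1)_{n_1}\cdots(F_s)_{n_s} M\big)$ agrees, for all sufficiently large $n_0, n_1, \dots, n_s$, with a polynomial in $n_0,\dots,n_s$ of total degree $q - 1$. -/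
/-- The saturation `0_M : I^∞ = ⋃ₙ (0_M : Iⁿ)` as a submodule of `M`. -/
noncomputable def satSubmodule (A : Type*) [CommRing A] (M : Type*) [AddCommGroup M]
    [Module A M] (I : Ideal A) : Submodule A M :=
  ⨆ n : ℕ, Submodule.torsionBySet A M ((I ^ n : Ideal A) : Set A)

/-- `ModuleLengthIs A N l` : the `A`-module `N` has finite length `l`. -/
def ModuleLengthIs (A : Type*) [Ring A] (N : Type*) [AddCommGroup N] [Module A N]
    (l : ℕ) : Prop :=
  ∃ s : CompositionSeries (Submodule A N), s.head = ⊥ ∧ s.last = ⊤ ∧ s.length = l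

/-- A function on `ι → ℕ` that agrees with a polynomial whenever all arguments are large. -/
def EventuallyPoly {ι : Type*} (H : (ι → ℕ) → ℚ) : Prop :=
  ∃ P : MvPolynomial ι ℚ, ∃ N : ℕ, ∀ n : ι → ℕ, (∀ i, N ≤ n i) →
    H n = MvPolynomial.eval (fun i => (n i : ℚ)) P

namespace EventuallyPoly

variable {ι : Type*}

theorem sub {H H' : (ι → ℕ) → ℚ} (h : EventuallyPoly H) (h' : EventuallyPoly H') :
    EventuallyPoly (fun n => H n - H' n) := by
  obtain ⟨P, N, hP⟩ := h
  obtain ⟨P', N', hP'⟩ := h'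
  refine ⟨P - P', max N N', fun n hn => ?_⟩
  dsimp only
  rw [hP n fun i => (le_max_left _ _).trans (hn i),
    hP' n fun i => (le_max_right _ _).trans (hn i), map_sub]

theorem comp_add {H : (ι → ℕ) → ℚ} (h : EventuallyPoly H) (e : ι → ℕ) :
    EventuallyPoly (fun n => H (n + e)) := by
  obtain ⟨P, N, hP⟩ := h
  refine ⟨MvPolynomial.bind₁ (fun i => MvPolynomial.X i + MvPolynomial.C (e i : ℚ)) P, N,
    fun n hn => ?_⟩
  dsimp only
  rw [hP (n + e) fun i => (hn i).trans (Nat.le_add_right _ _), ← MvPolynomial.coe_aeval_eq_eval,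
    ← MvPolynomial.coe_aeval_eq_eval, RingHom.coe_coe, RingHom.coe_coe, MvPolynomial.aeval_bind₁]
  congr 2
  ext i
  simp

theorem of_eventually_eq {H H' : (ι → ℕ) → ℚ} (h : EventuallyPoly H) (N' : ℕ)
    (hH : ∀ n : ι → ℕ, (∀ i, N' ≤ n i) → H' n = H n) : EventuallyPoly H' := by
  obtain ⟨P, N, hP⟩ := h
  refine ⟨P, max N N', fun n hn => ?_⟩
  rw [hH n fun i => (le_max_right _ _).trans (hn i), hP n fun i => (le_max_left _ _).trans (hn i)]

end EventuallyPoly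

namespace MvPolynomial

theorem exists_sum_range_pow_eq (e : ℕ) :
    ∃ f : Polynomial ℚ, ∀ m : ℕ, ∑ k ∈ Finset.range m, (k : ℚ) ^ e = f.eval (m : ℚ) := by
  refine ⟨Polynomial.C (1 / (e + 1 : ℚ)) * (Polynomial.bernoulli (e + 1) -
    Polynomial.C (_root_.bernoulli (e + 1))), fun m => ?_⟩
  have := Polynomial.sum_range_pow_eq_bernoulli_sub m e
  have h : (e + 1 : ℚ) ≠ 0 := by positivity
  rw [Polynomial.eval_mul, Polynomial.eval_C, Polynomial.eval_sub, Polynomial.eval_C,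
    ← Nat.succ_eq_add_one, ← this]
  field_simp

variable {ι : Type*}

theorem eq_of_eval_natCast_eq {P Q : MvPolynomial ι ℚ} (N : ℕ)
    (h : ∀ n : ι → ℕ, (∀ i, N ≤ n i) →
      eval (fun i => (n i : ℚ)) P = eval (fun i => (n i : ℚ)) Q) : P = Q := by
  refine funext_set (fun _ => (fun k : ℕ => (k : ℚ)) '' Set.Ici N)
    (fun _ => (Set.Ici_infinite N).image Nat.cast_injective.injOn) fun x hx => ?_
  choose n hn hnx using fun i => hx i (Set.mem_univ i)
  obtain rfl : (fun i => (n i : ℚ)) = x := _root_.funext hnx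
  exact h n hn

variable [Fintype ι] [DecidableEq ι]

theorem eval_update_monomial (u : ι →₀ ℕ) (a : ℚ) (x : ι → ℚ) (j : ι) (y : ℚ) :
    eval (Function.update x j y) (monomial u a) =
      eval x (monomial (u.erase j) a) * y ^ u j := by
  rw [eval_monomial, eval_monomial, Finsupp.prod_fintype _ _ (by simp),
    Finsupp.prod_fintype _ _ (by simp), ← Finset.mul_prod_erase _ _ (Finset.mem_univ j),
    ← Finset.mul_prod_erase (a := j) _ (fun i => x i ^ (u.erase j) i) (Finset.mem_univ j)]
  have : ∏ i ∈ Finset.univ.erase j, Function.update x j y i ^ u i =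
      ∏ i ∈ Finset.univ.erase j, x i ^ (u.erase j) i :=
    Finset.prod_congr rfl fun i hi => by
      have := Finset.ne_of_mem_erase hi
      rw [Function.update_of_ne this, Finsupp.erase_ne this]
  rw [this]
  simp
  ring

/-- Summation in one variable preserves polynomials. -/
theorem exists_sum_Ico_update (p : MvPolynomial ι ℚ) (j : ι) (N : ℕ) :
    ∃ Q : MvPolynomial ι ℚ, ∀ n : ι → ℕ, N ≤ n j →
      ∑ k ∈ Finset.Ico N (n j), eval (Function.update (fun i => (n i : ℚ)) j k) p =
        eval (fun i => (n i : ℚ)) Q := by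
  induction p using MvPolynomial.induction_on' with
  | monomial u a =>
    obtain ⟨f, hf⟩ := exists_sum_range_pow_eq (u j)
    refine ⟨monomial (u.erase j) a * (Polynomial.aeval (X j) f - C (f.eval (N : ℚ))),
      fun n hn => ?_⟩
    simp_rw [eval_update_monomial]
    rw [← Finset.mul_sum, Finset.sum_Ico_eq_sub _ hn, hf, hf, map_mul, map_sub, eval_C]
    congr 2
    rw [← coe_aeval_eq_eval, RingHom.coe_coe, ← Polynomial.aeval_algHom_apply]
    simp
  | add p q hf hu =>
    obtain ⟨Q, hQ⟩ := hf
    obtain ⟨Q', hQ'⟩ := hu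
    exact ⟨Q + Q', fun n hn => by simp [Finset.sum_add_distrib, hQ n hn, hQ' n hn]⟩

theorem exists_eval_update_add_one_sub (G : MvPolynomial ι ℚ) (j : ι) :
    ∃ D : MvPolynomial ι ℚ, D.totalDegree ≤ G.totalDegree - 1 ∧
      ∀ x : ι → ℚ, eval x D = eval (Function.update x j (x j + 1)) G - eval x G := by
  have key : ∀ u : ι →₀ ℕ, ∀ a : ℚ, ∃ D : MvPolynomial ι ℚ,
      D.totalDegree ≤ (u.sum fun _ e => e) - 1 ∧ ∀ x : ι → ℚ, eval x D =
        eval (Function.update x j (x j + 1)) (monomial u a) - eval x (monomial u a) := by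
    intro u a
    refine ⟨∑ k ∈ Finset.range (u j), monomial (u.erase j + Finsupp.single j k)
      (a * (u j).choose k), ?_, fun x => ?_⟩
    · refine totalDegree_finsetSum_le fun k hk => (totalDegree_monomial_le _ _).trans ?_
      rw [Finset.mem_range] at hk
      have h1 := Finsupp.sum_fintype u (fun _ e => e) (fun _ => rfl)
      have h2 := Finsupp.sum_fintype (u.erase j + Finsupp.single j k) (fun _ e => e)
        (fun _ => rfl)
      have h3 : ((u.erase j + Finsupp.single j k).sum fun _ => id) =
        ∑ i, (u.erase j + Finsupp.single j k) i := h2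
      rw [h1, h3, ← Finset.add_sum_erase _ _ (Finset.mem_univ j),
        ← Finset.add_sum_erase _ (fun i => u i) (Finset.mem_univ j)]
      have : ∑ i ∈ Finset.univ.erase j, (u.erase j + Finsupp.single j k) i =
          ∑ i ∈ Finset.univ.erase j, u i :=
        Finset.sum_congr rfl fun i hi => by
          have := Finset.ne_of_mem_erase hi
          simp [Finsupp.erase_ne this, Finsupp.single_eq_of_ne this]
      rw [this]
      simp
      omega
    · have h1 : eval x (monomial u a) = eval x (monomial (u.erase j) a) * x j ^ u j := by
        conv_lhs => rw [← Function.update_eq_self j x]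
        rw [eval_update_monomial]
      rw [h1, eval_update_monomial, ← mul_sub, add_pow, Finset.sum_range_succ, map_sum]
      simp only [one_pow, mul_one, Nat.choose_self, Nat.cast_one, add_sub_cancel_right]
      rw [Finset.mul_sum]
      refine Finset.sum_congr rfl fun k _ => ?_
      rw [← monomial_mul, map_mul, eval_monomial (s := Finsupp.single j k),
        Finsupp.prod_single_index (by simp)]
      ring
  choose D hD hDx using key
  refine ⟨∑ u ∈ G.support, D u (G.coeff u), ?_, fun x => ?_⟩
  · exact totalDegree_finsetSum_le fun u hu => (hD _ _).trans
      (Nat.sub_le_sub_right (le_totalDegree hu) 1)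
  · conv_rhs => rw [G.as_sum]
    simp only [map_sum, hDx, Finset.sum_sub_distrib]

theorem totalDegree_le_of_eval_add_single_sub {P G : MvPolynomial ι ℚ} (j : ι) (N : ℕ)
    (h : ∀ n : ι → ℕ, (∀ i, N ≤ n i) → eval (fun i => (n i : ℚ)) P =
      eval (fun i => ((n + Pi.single j 1 : ι → ℕ) i : ℚ)) G - eval (fun i => (n i : ℚ)) G) :
    P.totalDegree ≤ G.totalDegree - 1 := by
  obtain ⟨D, hD, hDx⟩ := exists_eval_update_add_one_sub G j
  obtain rfl : P = D := eq_of_eval_natCast_eq N fun n hn => by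
    rw [h n hn, hDx]
    congr 2
    congr 1
    ext i
    by_cases hi : i = j
    · subst hi; simp
    · simp [hi]
  exact hD

end MvPolynomial

namespace MvPolynomial

variable {ι : Type*} [Fintype ι]

theorem exists_abs_eval_natCast_le (P : MvPolynomial ι ℚ) :
    ∃ C : ℚ, 0 ≤ C ∧ ∀ n : ι → ℕ,
      |eval (fun i => (n i : ℚ)) P| ≤ C * (1 + ∑ i, (n i : ℚ)) ^ P.totalDegree := by
  refine ⟨∑ u ∈ P.support, |P.coeff u|, Finset.sum_nonneg fun _ _ => abs_nonneg _, fun n => ?_⟩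
  rw [eval_eq', Finset.sum_mul]
  refine (Finset.abs_sum_le_sum_abs _ _).trans (Finset.sum_le_sum fun u hu => ?_)
  rw [abs_mul]
  refine mul_le_mul_of_nonneg_left ?_ (abs_nonneg _)
  have h0 : (0 : ℚ) ≤ ∑ i, (n i : ℚ) := Finset.sum_nonneg fun _ _ => Nat.cast_nonneg _
  have h1 : ∀ i, (n i : ℚ) ≤ 1 + ∑ i, (n i : ℚ) := fun i =>
    (Finset.single_le_sum (f := fun i => (n i : ℚ)) (fun _ _ => Nat.cast_nonneg _)
      (Finset.mem_univ i)).trans (by linarith)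
  rw [abs_of_nonneg (Finset.prod_nonneg fun _ _ => by positivity)]
  calc ∏ i, (n i : ℚ) ^ u i ≤ ∏ i, (1 + ∑ i, (n i : ℚ)) ^ u i :=
        Finset.prod_le_prod (fun _ _ => by positivity) fun i _ =>
          pow_le_pow_left₀ (by positivity) (h1 i) _
    _ = (1 + ∑ i, (n i : ℚ)) ^ ∑ i, u i := Finset.prod_pow_eq_pow_sum _ _ _
    _ ≤ _ := by
        refine pow_le_pow_right₀ (by linarith) ?_
        rw [← Finsupp.sum_fintype u (fun _ e => e) (fun _ => rfl)]
        exact le_totalDegree hu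

theorem totalDegree_le_of_abs_eval_natCast_le {Q : MvPolynomial ι ℚ} {q N : ℕ} {C : ℚ}
    (h : ∀ n : ι → ℕ, (∀ i, N ≤ n i) →
      |eval (fun i => (n i : ℚ)) Q| ≤ C * (1 + ∑ i, (n i : ℚ)) ^ q) :
    Q.totalDegree ≤ q := by
  by_contra! hq
  have hd : homogeneousComponent Q.totalDegree Q ≠ 0 := by
    obtain ⟨u, hu, hd⟩ := Finset.exists_mem_eq_sup Q.support
      (support_nonempty.mpr (by rintro rfl; simp at hq)) fun s => s.sum fun _ e => e
    intro h0
    have := congrArg (coeff u) h0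
    rw [coeff_homogeneousComponent, if_pos, coeff_zero] at this
    · exact (mem_support_iff.mp hu) this
    · rw [totalDegree, hd]
      rfl
  obtain ⟨v, hvN, hv⟩ : ∃ v : ι → ℕ, (∀ i, N ≤ v i) ∧
      eval (fun i => (v i : ℚ)) (homogeneousComponent Q.totalDegree Q) ≠ 0 := by
    by_contra! hcon
    exact hd (eq_of_eval_natCast_eq N fun n hn => by rw [hcon n hn, map_zero])
  set d := Q.totalDegree with hdef
  set p : Polynomial ℚ := ∑ k ∈ Finset.range (d + 1),
    Polynomial.monomial k (eval (fun i => (v i : ℚ)) (homogeneousComponent k Q)) with hp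
  have hpe : ∀ t : ℕ, p.eval (t : ℚ) = eval (fun i => ((t * v i : ℕ) : ℚ)) Q := by
    intro t
    conv_rhs => rw [← sum_homogeneousComponent Q]
    rw [hp, Polynomial.eval_finsetSum, map_sum]
    refine Finset.sum_congr rfl fun k _ => ?_
    rw [Polynomial.eval_monomial, eval_eq', eval_eq', Finset.sum_mul]
    refine Finset.sum_congr rfl fun u hu => ?_
    have hk : ∑ i, u i = k := by
      have := (homogeneousComponent_isHomogeneous k Q) (mem_support_iff.mp hu)
      rw [← this, Finsupp.weight_apply, Finsupp.sum_fintype _ _ (by simp)]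
      simp
    simp only [Nat.cast_mul, mul_pow, Finset.prod_mul_distrib, Finset.prod_pow_eq_pow_sum, hk]
    ring
  have hdeg : (Polynomial.X ^ q : Polynomial ℚ).degree < p.degree := by
    rw [Polynomial.degree_X_pow]
    refine lt_of_lt_of_le (WithBot.coe_lt_coe.mpr hq) (Polynomial.le_degree_of_ne_zero (n := d) ?_)
    rw [hp, Polynomial.finsetSum_coeff, Finset.sum_eq_single d]
    · rwa [Polynomial.coeff_monomial_same]
    · intro k _ hk
      exact Polynomial.coeff_monomial_of_ne _ hk.symm
    · simp
  have ht := (Polynomial.abs_div_tendsto_atTop_atTop_of_degree_gt p _ hdeg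
    (pow_ne_zero _ Polynomial.X_ne_zero)).comp (tendsto_natCast_atTop_atTop (R := ℚ))
  obtain ⟨t, hlt, ht1⟩ := ((ht.eventually_gt_atTop (|C| * (1 + ∑ i, (v i : ℚ)) ^ q)).and
    (Filter.eventually_ge_atTop 1)).exists
  have ht1' : (1 : ℚ) ≤ t := by exact_mod_cast ht1
  have hb := h (fun i => t * v i) fun i => (hvN i).trans (Nat.le_mul_of_pos_left _ ht1)
  rw [← hpe] at hb
  simp only [Function.comp, Polynomial.eval_pow, Polynomial.eval_X, abs_div, abs_pow,
    Nat.abs_cast] at hlt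
  rw [lt_div_iff₀ (by positivity), mul_assoc, ← mul_pow] at hlt
  refine absurd (hlt.trans_le hb) (not_lt.mpr ?_)
  have h0 : (0 : ℚ) ≤ ∑ i, (v i : ℚ) := Finset.sum_nonneg fun _ _ => Nat.cast_nonneg _
  simp only [Nat.cast_mul, ← Finset.mul_sum]
  refine mul_le_mul (le_abs_self C) (pow_le_pow_left₀ (by positivity) ?_ _) (by positivity)
    (abs_nonneg _)
  nlinarith

end MvPolynomial

theorem EventuallyPoly.of_forall_add_single_sub {ι : Type*} [Fintype ι] [DecidableEq ι]
    {H : (ι → ℕ) → ℚ} (h : ∀ j, EventuallyPoly (fun n => H (n + Pi.single j 1) - H n)) :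
    EventuallyPoly H := by
  choose P N hP using h
  obtain ⟨N₀, hN₀⟩ : ∃ N₀, ∀ j, N j ≤ N₀ :=
    ⟨Finset.univ.sup N, fun j => Finset.le_sup (Finset.mem_univ j)⟩
  have key : ∀ s : Finset ι, ∃ Q : MvPolynomial ι ℚ, ∀ n : ι → ℕ, (∀ i, N₀ ≤ n i) →
      (∀ i ∉ s, n i = N₀) → H n = MvPolynomial.eval (fun i => (n i : ℚ)) Q := by
    intro s
    induction s using Finset.induction_on with
    | empty =>
      refine ⟨MvPolynomial.C (H fun _ => N₀), fun n _ hn => ?_⟩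
      obtain rfl : n = fun _ => N₀ := funext fun i => hn i (Finset.notMem_empty i)
      simp
    | insert j s hj ih =>
      obtain ⟨Q, hQ⟩ := ih
      obtain ⟨R, hR⟩ := MvPolynomial.exists_sum_Ico_update (P j) j N₀
      refine ⟨MvPolynomial.bind₁ (fun i => if i = j then MvPolynomial.C (N₀ : ℚ)
        else MvPolynomial.X i) Q + R, fun n hn hns => ?_⟩
      have hsum : ∀ m, N₀ ≤ m → H (Function.update n j m) = H (Function.update n j N₀) +
          ∑ k ∈ Finset.Ico N₀ m, MvPolynomial.eval
            (Function.update (fun i => (n i : ℚ)) j k) (P j) := by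
        intro m hm
        induction m, hm using Nat.le_induction with
        | base => simp
        | succ m hm ih =>
          rw [Finset.sum_Ico_succ_top hm, ← add_assoc, ← ih]
          have := hP j (Function.update n j m) fun i => by
            refine (hN₀ j).trans ?_
            by_cases hi : i = j
            · subst hi; simpa using hm
            · simpa [hi] using hn i
          have h1 : Function.update n j m + Pi.single j 1 = Function.update n j (m + 1) := by
            ext i
            by_cases hi : i = j
            · subst hi; simp
            · simp [hi]
          have h2 : (fun i => (Function.update n j m i : ℚ)) =
              Function.update (fun i => (n i : ℚ)) j m := by
            ext i
            by_cases hi : i = j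
            · subst hi; simp
            · simp [hi]
          dsimp only at this
          rw [h1, h2] at this
          linarith
      have h1 := hsum (n j) (hn j)
      rw [Function.update_eq_self, hR n (hn j)] at h1
      rw [h1, map_add, hQ]
      · congr 1
        rw [← MvPolynomial.coe_aeval_eq_eval, ← MvPolynomial.coe_aeval_eq_eval, RingHom.coe_coe,
          RingHom.coe_coe, MvPolynomial.aeval_bind₁]
        congr 2
        ext i
        by_cases hi : i = j
        · subst hi; simp
        · simp [hi]
      · intro i
        by_cases hi : i = j
        · subst hi; simp
        · simpa [hi] using hn i
      · intro i hi
        by_cases hij : i = j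
        · subst hij; simp
        · simpa [hij] using hns i (by simp [hij, hi])
  obtain ⟨Q, hQ⟩ := key Finset.univ
  exact ⟨Q, N₀, fun n hn => hQ n hn fun i hi => absurd (Finset.mem_univ i) hi⟩

namespace Submodule

variable {A M M₂ : Type*} [CommRing A] [AddCommGroup M] [Module A M]
  [AddCommGroup M₂] [Module A M₂]

/-- The length of the quotient `P / (P ⊓ Q)`. -/
noncomputable def relLength (P Q : Submodule A M) : ℕ∞ :=
  Module.length A (P ⧸ Q.submoduleOf P)

theorem relLength_eq_length {P Q : Submodule A M} (g : P →ₗ[A] M₂) (hg : Function.Surjective g)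
    (hk : ∀ x : P, g x = 0 ↔ (x : M) ∈ Q) : relLength P Q = Module.length A M₂ := by
  have : Q.submoduleOf P = LinearMap.ker g := by
    ext x
    exact (hk x).symm
  rw [relLength, this]
  exact (g.quotKerEquivOfSurjective hg).length_eq

theorem relLength_eq_add {P Q R : Submodule A M} (hQR : Q ≤ R) (hRP : R ≤ P) :
    relLength P Q = relLength P R + relLength R Q := by
  have h : Q.submoduleOf R = (Q.submoduleOf P).comap (inclusion hRP) := rfl
  rw [add_comm]
  refine Module.length_eq_add_of_exact
    (mapQ (Q.submoduleOf R) (Q.submoduleOf P) (inclusion hRP) h.le)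
    (factor (comap_mono hQR : Q.submoduleOf P ≤ R.submoduleOf P)) ?_ (factor_surjective _) ?_
  · rw [← LinearMap.ker_eq_bot, ker_mapQ, ← h, ← LinearMap.le_ker_iff_map, ker_mkQ]
  · intro y
    obtain ⟨y, rfl⟩ := mkQ_surjective _ y
    constructor
    · intro hy
      have hy' : (y : M) ∈ R := (Quotient.mk_eq_zero (R.submoduleOf P)).mp hy
      exact ⟨mkQ (Q.submoduleOf R) ⟨y, hy'⟩, rfl⟩
    · rintro ⟨x, hx⟩
      obtain ⟨x, rfl⟩ := mkQ_surjective _ x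
      rw [← hx]
      exact (Quotient.mk_eq_zero _).mpr x.2

theorem relLength_map_sup (f : M →ₗ[A] M₂) (P : Submodule A M) (Q : Submodule A M₂) :
    relLength (P.map f ⊔ Q) Q = relLength P (P ⊓ Q.comap f) := by
  let g : P →ₗ[A] (↥(P.map f ⊔ Q) ⧸ Q.submoduleOf (P.map f ⊔ Q)) :=
    (mkQ _) ∘ₗ (f.restrict (q := P.map f ⊔ Q) fun x hx => mem_sup_left (mem_map_of_mem hx))
  refine (relLength_eq_length g ?_ fun x => ?_).symm
  · intro y
    obtain ⟨⟨y, hy⟩, rfl⟩ := mkQ_surjective _ y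
    obtain ⟨_, ⟨x, hx, rfl⟩, z, hz, rfl⟩ := mem_sup.mp hy
    refine ⟨⟨x, hx⟩, ?_⟩
    refine (Quotient.eq _).mpr ?_
    simpa [submoduleOf] using hz
  · have : g x = 0 ↔ f x ∈ Q := Quotient.mk_eq_zero _
    rw [this]
    simp

theorem relLength_inf (P Q : Submodule A M) : relLength P (P ⊓ Q) = relLength P Q :=
  relLength_eq_length (mkQ _) (mkQ_surjective _) fun x => by
    refine (Quotient.mk_eq_zero _).trans ?_
    simp [submoduleOf]

theorem relLength_eq_zero_iff {P Q : Submodule A M} : relLength P Q = 0 ↔ P ≤ Q := by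
  rw [relLength, Module.length_eq_zero_iff, Quotient.subsingleton_iff, submoduleOf_eq_top]

theorem relLength_eq_zero {P Q : Submodule A M} (h : P ≤ Q) : relLength P Q = 0 :=
  relLength_eq_zero_iff.mpr h

theorem relLength_map {f : M →ₗ[A] M₂} (hf : Function.Injective f) (P Q : Submodule A M) :
    relLength (P.map f) (Q.map f) = relLength P Q := by
  refine (relLength_eq_length (M₂ := ↥(P.map f) ⧸ (Q.map f).submoduleOf (P.map f))
    (mkQ _ ∘ₗ (f.restrict (q := P.map f) fun x hx => mem_map_of_mem hx)) ?_ fun x => ?_).symm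
  · refine (mkQ_surjective _).comp ?_
    rintro ⟨_, x, hx, rfl⟩
    exact ⟨⟨x, hx⟩, rfl⟩
  · have := Quotient.mk_eq_zero ((Q.map f).submoduleOf (P.map f))
      (x := ⟨f x, mem_map_of_mem x.2⟩)
    refine this.trans ?_
    simp only [submoduleOf, mem_comap, subtype_apply, mem_map]
    exact ⟨fun ⟨y, hy, h⟩ => hf h ▸ hy, fun h => ⟨x, h, rfl⟩⟩

theorem relLength_anti {P Q Q' : Submodule A M} (h : Q ≤ Q') :
    relLength P Q' ≤ relLength P Q :=
  Module.length_le_of_surjective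
    (factor (comap_mono h : Q.submoduleOf P ≤ Q'.submoduleOf P)) (factor_surjective _)

theorem relLength_mono {P P' Q : Submodule A M} (h : P ≤ P') :
    relLength P Q ≤ relLength P' Q := by
  have h' : Q.submoduleOf P = (Q.submoduleOf P').comap (inclusion h) := rfl
  refine Module.length_le_of_injective
    (mapQ (Q.submoduleOf P) (Q.submoduleOf P') (inclusion h) h'.le) ?_
  rw [← LinearMap.ker_eq_bot, ker_mapQ, ← h', ← LinearMap.le_ker_iff_map, ker_mkQ]

end Submodule

/-- The family `L` of submodules is stable under each `p ∈ S`, acting as multiplication by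
`p.1` raising the degree by one in direction `p.2`. -/
def IsStableFamily {A M ι : Type*} [CommRing A] [AddCommGroup M] [Module A M] [DecidableEq ι]
    (S : Finset (A × ι)) (L : (ι → ℕ) → Submodule A M) : Prop :=
  ∀ p ∈ S, ∀ n, ∀ v ∈ L n, p.1 • v ∈ L (n + Pi.single p.2 1)

/-- The ascending chain condition for stable families between `Q` and `P`. -/
def StableFamilyACC {A M ι : Type*} [CommRing A] [AddCommGroup M] [Module A M] [DecidableEq ι]
    (S : Finset (A × ι)) (P Q : (ι → ℕ) → Submodule A M) : Prop :=
  ∀ L : ℕ → (ι → ℕ) → Submodule A M, Monotone L → (∀ k, IsStableFamily S (L k)) →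
    (∀ k, Q ≤ L k) → (∀ k, L k ≤ P) → ∃ k₀, ∀ k, k₀ ≤ k → L k = L k₀

section Hilbert

open Submodule

variable {A M ι : Type*} [CommRing A] [AddCommGroup M] [Module A M] [Fintype ι] [DecidableEq ι]

/-- A multigraded subquotient of finite length in each degree, satisfying the ascending chain
condition, has an eventually polynomial Hilbert function. -/
theorem eventuallyPoly_relLength (S : Finset (A × ι)) (P Q : (ι → ℕ) → Submodule A M)
    (hP : IsStableFamily S P) (hQ : IsStableFamily S Q) (hQP : Q ≤ P)
    (hacc : StableFamilyACC S P Q) (hfin : ∀ n, relLength (P n) (Q n) ≠ ⊤) :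
    EventuallyPoly fun n => ((relLength (P n) (Q n)).toNat : ℚ) := by
  classical
  induction hc : S.card using Nat.strong_induction_on generalizing S P Q with
  | _ c ih =>
  subst hc
  refine EventuallyPoly.of_forall_add_single_sub fun i => ?_
  by_cases hi : ∃ p ∈ S, p.2 = i
  · obtain ⟨p, hp, rfl⟩ := hi
    set e : ι → ℕ := Pi.single p.2 1 with he
    let f : M →ₗ[A] M := LinearMap.lsmul A M p.1
    let K : (ι → ℕ) → Submodule A M := fun n => P n ⊓ (Q (n + e)).comap f
    let Q' : (ι → ℕ) → Submodule A M := fun n => Q n ⊔ ⨆ (m) (_ : m + e = n), (P m).map f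
    have hQ'e : ∀ m, Q' (m + e) = (P m).map f ⊔ Q (m + e) := by
      intro m
      simp only [Q', add_left_inj, iSup_iSup_eq_left, sup_comm]
    have hKP : K ≤ P := fun n => inf_le_left
    have hQQ' : Q ≤ Q' := fun n => le_sup_left
    have hQK : Q ≤ K := fun n => le_inf (hQP n) fun v hv => hQ p hp n v hv
    have hfP : ∀ m, (P m).map f ≤ P (m + e) := by
      rintro m _ ⟨v, hv, rfl⟩
      exact hP p hp m v hv
    have hQ'P : Q' ≤ P := fun n => sup_le (hQP n) (iSup₂_le fun m hm => hm ▸ hfP m)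
    have hcard : (S.erase p).card < S.card := Finset.card_erase_lt_of_mem hp
    have hsub : ∀ b ∈ S.erase p, b ∈ S := fun b hb => Finset.mem_of_mem_erase hb
    have hext : ∀ L : (ι → ℕ) → Submodule A M, IsStableFamily (S.erase p) L →
        (∀ n, ∀ v ∈ L n, p.1 • v ∈ L (n + e)) → IsStableFamily S L := by
      intro L hL hLp b hb
      by_cases hbp : b = p
      · subst hbp; exact hLp
      · exact hL b (Finset.mem_erase.mpr ⟨hbp, hb⟩)
    have hK : EventuallyPoly fun n => ((relLength (K n) (Q n)).toNat : ℚ) := by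
      refine ih _ hcard (S.erase p) K Q ?_ (fun b hb => hQ b (hsub b hb)) hQK ?_ ?_ rfl
      · rintro b hb n v ⟨hv, hv'⟩
        refine ⟨hP b (hsub b hb) n v hv, ?_⟩
        have := hQ b (hsub b hb) _ _ hv'
        rw [add_right_comm] at this
        simpa [f, smul_comm p.1 b.1] using this
      · intro L hmono hst hQL hLK
        refine hacc L hmono (fun k => hext _ (hst k) fun n v hv => ?_) hQL
          fun k => (hLK k).trans hKP
        exact hQL k (n + e) (hLK k n hv).2
      · intro n
        exact ne_top_of_le_ne_top (hfin n) (relLength_mono (hKP n))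
    have hC : EventuallyPoly fun n => ((relLength (P n) (Q' n)).toNat : ℚ) := by
      refine ih _ hcard (S.erase p) P Q' (fun b hb => hP b (hsub b hb)) ?_ hQ'P ?_ ?_ rfl
      · intro b hb n v hv
        obtain ⟨y, hy, z, hz, rfl⟩ := mem_sup.mp hv
        rw [smul_add]
        refine add_mem (hQQ' _ (hQ b (hsub b hb) n y hy)) ?_
        have hle : (⨆ (m) (_ : m + e = n), (P m).map f) ≤
            (Q' (n + Pi.single b.2 1)).comap (LinearMap.lsmul A M b.1) := by
          refine iSup₂_le fun m hm => ?_
          rintro _ ⟨w, hw, rfl⟩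
          subst hm
          change b.1 • p.1 • w ∈ Q' (m + e + Pi.single b.2 1)
          rw [add_right_comm, hQ'e, smul_comm]
          exact mem_sup_left (mem_map_of_mem (f := f) (hP b (hsub b hb) m w hw))
        exact hle hz
      · intro L hmono hst hQL hLP
        refine hacc L hmono (fun k => hext _ (hst k) fun n v hv => ?_)
          (fun k => hQQ'.trans (hQL k)) hLP
        refine hQL k _ ?_
        rw [hQ'e]
        exact mem_sup_left (mem_map_of_mem (f := f) (hLP k n hv))
      · intro n
        exact ne_top_of_le_ne_top (hfin n) (relLength_anti (hQQ' n))
    refine ((hC.comp_add e).sub hK).of_eventually_eq 0 fun n _ => ?_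
    have h1 := relLength_eq_add (hQK n) (hKP n)
    have h2 := relLength_eq_add (hQQ' (n + e)) (hQ'P (n + e))
    have h3 : relLength (Q' (n + e)) (Q (n + e)) = relLength (P n) (K n) := by
      rw [hQ'e, relLength_map_sup]
    rw [h3] at h2
    have f1 := hfin n
    have f2 := hfin (n + e)
    rw [h1] at f1 ⊢
    rw [h2] at f2 ⊢
    obtain ⟨f1, f3⟩ := WithTop.add_ne_top.mp f1
    obtain ⟨f2, -⟩ := WithTop.add_ne_top.mp f2
    rw [ENat.toNat_add f1 f3, ENat.toNat_add f2 f1]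
    push_cast
    ring
  · push Not at hi
    have hacc' := hacc (fun k n => if n i ≤ k then P n else Q n) ?_ ?_ ?_ ?_
    · obtain ⟨N, hN⟩ := hacc'
      have hz : ∀ n, N < n i → relLength (P n) (Q n) = 0 := by
        intro n hn
        have := congrFun (hN (n i) hn.le) n
        simp only [le_refl, if_true, if_neg (not_le.mpr hn)] at this
        exact relLength_eq_zero this.le
      refine ⟨0, N + 1, fun n hn => ?_⟩
      dsimp only
      rw [hz n (hn i), hz _ ((hn i).trans (by simp))]
      simp
    · intro k k' hk n
      dsimp only
      split_ifs with h h'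
      · exact le_rfl
      · exact absurd (h.trans hk) h'
      · exact hQP n
      · exact le_rfl
    · intro k p hp n v hv
      have : (n + (Pi.single p.2 1 : ι → ℕ)) i = n i := by
        simp [Pi.single_eq_of_ne (hi p hp).symm]
      dsimp only at hv ⊢
      rw [this]
      split_ifs at hv ⊢ with h
      · exact hP p hp n v hv
      · exact hQ p hp n v hv
    · intro k n
      dsimp only
      split_ifs
      · exact hQP n
      · exact le_rfl
    · intro k n
      dsimp only
      split_ifs
      · exact le_rfl
      · exact hQP n

end Hilbert

namespace IsStableFamily

variable {A M ι : Type*} [CommRing A] [AddCommGroup M] [Module A M] [DecidableEq ι]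

theorem smul_le {S : Finset (A × ι)} {L : (ι → ℕ) → Submodule A M} (h : IsStableFamily S L)
    {J : ι → Ideal A} (hS : ∀ i, J i = Ideal.span {a | (a, i) ∈ S}) (i : ι) (n : ι → ℕ) :
    J i • L n ≤ L (n + Pi.single i 1) := by
  refine Submodule.smul_le.mpr fun r hr v hv => ?_
  rw [hS i] at hr
  induction hr using Submodule.span_induction with
  | mem a ha => exact h (a, i) ha n v hv
  | zero => simp
  | add x y _ _ hx hy => rw [add_smul]; exact add_mem hx hy
  | smul a x _ hx => rw [smul_assoc]; exact Submodule.smul_mem _ _ hx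

end IsStableFamily

theorem StableFamilyACC.mono {A M ι : Type*} [CommRing A] [AddCommGroup M] [Module A M]
    [DecidableEq ι] {S : Finset (A × ι)} {P P' Q Q' : (ι → ℕ) → Submodule A M}
    (h : StableFamilyACC S P Q) (hP : P' ≤ P) (hQ : Q ≤ Q') : StableFamilyACC S P' Q' :=
  fun L hL hs hQL hLP => h L hL hs (fun k => hQ.trans (hQL k)) fun k => (hLP k).trans hP

namespace Ideal

variable {A M ι : Type*} [CommRing A] [AddCommGroup M] [Module A M] [Fintype ι]

/-- The product of powers `∏ i, J i ^ n i`. -/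
def powProd (J : ι → Ideal A) (n : ι → ℕ) : Ideal A := ∏ i, J i ^ n i

variable (J : ι → Ideal A)

@[simp] theorem powProd_zero : powProd J 0 = 1 := by simp [powProd]

theorem powProd_add (m n : ι → ℕ) : powProd J (m + n) = powProd J m * powProd J n := by
  simp [powProd, pow_add, Finset.prod_mul_distrib]

variable [DecidableEq ι]

@[simp] theorem powProd_single (i : ι) (k : ℕ) : powProd J (Pi.single i k) = J i ^ k := by
  rw [powProd, Finset.prod_eq_single i]
  · simp
  · intro j _ hj
    simp [Pi.single_eq_of_ne hj]
  · simp

theorem powProd_smul_le {L : (ι → ℕ) → Submodule A M}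
    (h : ∀ i n, J i • L n ≤ L (n + Pi.single i 1)) (m n : ι → ℕ) :
    powProd J m • L n ≤ L (n + m) := by
  induction hk : ∑ i, m i generalizing m with
  | zero =>
    have : m = 0 := by
      ext i
      exact Finset.sum_eq_zero_iff.mp hk i (Finset.mem_univ i)
    simp [this]
  | succ k ih =>
    obtain ⟨i, -, hi⟩ : ∃ i ∈ Finset.univ, m i ≠ 0 :=
      Finset.exists_ne_zero_of_sum_ne_zero (by omega)
    have hm : m = (m - Pi.single i 1) + Pi.single i 1 := by
      refine (tsub_add_cancel_of_le fun j => ?_).symm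
      by_cases hj : j = i
      · subst hj; simpa using Nat.one_le_iff_ne_zero.mpr hi
      · simp [Pi.single_eq_of_ne hj]
    have hsum : ∑ j, (m - (Pi.single i 1 : ι → ℕ)) j = k := by
      have := congrArg (fun f : ι → ℕ => ∑ j, f j) hm
      simp only [Pi.add_apply, Finset.sum_add_distrib, Finset.sum_pi_single', Finset.mem_univ,
        if_true] at this
      have h1 : ∑ j, (Pi.single i 1 : ι → ℕ) j = 1 := by simp
      omega
    rw [hm, powProd_add, powProd_single, pow_one, mul_comm, mul_smul, ← add_assoc]
    exact (Submodule.smul_mono le_rfl (ih _ hsum)).trans (h i _)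

theorem exists_finset_span_eq [IsNoetherianRing A] :
    ∃ S : Finset (A × ι), ∀ i, J i = span {a | (a, i) ∈ S} := by
  classical
  choose s hs using fun i => (isNoetherianRing_iff_ideal_fg A).mp inferInstance (J i)
  refine ⟨Finset.univ.biUnion fun i => (s i).image fun a => (a, i), fun i => ?_⟩
  rw [← hs i]
  congr 1
  ext a
  simp

end Ideal

section

open Ideal TensorProduct

variable {A : Type*} (M : Type*) {ι : Type*} [CommRing A] [AddCommGroup M] [Module A M] [Fintype ι]

/-- The component of degree `n` of `A[X_p : p ∈ S] ⊗ M`, where the variable `p = (a, i)` has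
degree `e_i`, evaluated in `M` through `X_p ↦ a`. -/
noncomputable def gradedEval (S : Finset (A × ι)) (n : ι → ℕ) :
    MvPolynomial S A ⊗[A] M →ₗ[A] M :=
  TensorProduct.lift (LinearMap.lsmul A M ∘ₗ
    (MvPolynomial.lcoeff A (Finsupp.equivFunOnFinite.symm n)) ∘ₗ
    (MvPolynomial.aeval (fun p : S => MvPolynomial.C p.1.1 * MvPolynomial.X p.1.2) :
      MvPolynomial S A →ₐ[A] MvPolynomial ι A).toLinearMap)

variable {M}

theorem gradedEval_tmul (S : Finset (A × ι)) (n : ι → ℕ) (f : MvPolynomial S A) (v : M) :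
    gradedEval M S n (f ⊗ₜ v) = MvPolynomial.coeff (Finsupp.equivFunOnFinite.symm n)
      (MvPolynomial.aeval (fun p : S => (MvPolynomial.C p.1.1 * MvPolynomial.X p.1.2 :
        MvPolynomial ι A)) f) • v := rfl

variable [DecidableEq ι]

theorem gradedEval_X_smul (S : Finset (A × ι)) (n : ι → ℕ) (p : S) (z : MvPolynomial S A ⊗[A] M) :
    gradedEval M S (n + Pi.single p.1.2 1) ((MvPolynomial.X p : MvPolynomial S A) • z) =
      p.1.1 • gradedEval M S n z := by
  induction z using TensorProduct.induction_on with
  | zero => simp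
  | add x y hx hy => rw [smul_add, map_add, map_add, hx, hy, smul_add]
  | tmul f v =>
    have h : Finsupp.equivFunOnFinite.symm (n + Pi.single p.1.2 1) =
        Finsupp.single p.1.2 1 + Finsupp.equivFunOnFinite.symm n := by
      ext j
      simp [Finsupp.single_apply, Pi.single_apply, add_comm, eq_comm]
    rw [TensorProduct.smul_tmul', gradedEval_tmul, gradedEval_tmul, smul_eq_mul, map_mul,
      MvPolynomial.aeval_X, mul_assoc, MvPolynomial.coeff_C_mul, h, MvPolynomial.coeff_X_mul,
      mul_smul]

theorem gradedEval_X_smul_of_eq_zero (S : Finset (A × ι)) (n : ι → ℕ) (p : S)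
    (hn : n p.1.2 = 0) (z : MvPolynomial S A ⊗[A] M) :
    gradedEval M S n ((MvPolynomial.X p : MvPolynomial S A) • z) = 0 := by
  induction z using TensorProduct.induction_on with
  | zero => simp
  | add x y hx hy => rw [smul_add, map_add, hx, hy, add_zero]
  | tmul f v =>
    rw [TensorProduct.smul_tmul', gradedEval_tmul, smul_eq_mul, map_mul,
      MvPolynomial.aeval_X, mul_assoc, MvPolynomial.coeff_C_mul, MvPolynomial.coeff_X_mul',
      if_neg (by simp [hn]), mul_zero, zero_smul]

/-- The submodule of `A[X_p : p ∈ S] ⊗ M` determined by a stable family. -/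
noncomputable def IsStableFamily.toSubmodule {S : Finset (A × ι)} {L : (ι → ℕ) → Submodule A M}
    (h : IsStableFamily S L) : Submodule (MvPolynomial S A) (MvPolynomial S A ⊗[A] M) where
  carrier := {z | ∀ n, gradedEval M S n z ∈ L n}
  add_mem' hx hy n := by rw [map_add]; exact add_mem (hx n) (hy n)
  zero_mem' n := by simp
  smul_mem' r z hz := by
    induction r using MvPolynomial.induction_on generalizing z with
    | C a =>
      intro n
      have : (MvPolynomial.C a : MvPolynomial S A) • z = a • z := by
        rw [← MvPolynomial.algebraMap_eq, algebraMap_smul]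
      rw [this, map_smul]
      exact Submodule.smul_mem _ _ (hz n)
    | add f g hf hg =>
      intro n
      rw [add_smul, map_add]
      exact add_mem (hf z hz n) (hg z hz n)
    | mul_X f p hf =>
      rw [mul_smul]
      refine hf _ fun n => ?_
      by_cases hn : n p.1.2 = 0
      · rw [gradedEval_X_smul_of_eq_zero S n p hn]
        exact zero_mem _
      · obtain ⟨m, rfl⟩ : ∃ m : ι → ℕ, n = m + Pi.single p.1.2 1 := by
          refine ⟨n - Pi.single p.1.2 1, (tsub_add_cancel_of_le fun j => ?_).symm⟩
          by_cases hj : j = p.1.2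
          · subst hj; simpa using Nat.one_le_iff_ne_zero.mpr hn
          · simp [Pi.single_eq_of_ne hj]
        rw [gradedEval_X_smul]
        exact h p.1 p.2 m _ (hz m)

theorem exists_gradedEval_eq_ite {S : Finset (A × ι)} {J : ι → Ideal A}
    (hS : ∀ i, J i = span {a | (a, i) ∈ S}) (n : ι → ℕ) {v : M}
    (hv : v ∈ powProd J n • (⊤ : Submodule A M)) :
    ∃ z, ∀ m, gradedEval M S m z = if m = n then v else 0 := by
  let T : (ι → ℕ) → Submodule A M := fun n =>
    { carrier := {v | ∃ z, ∀ m, gradedEval M S m z = if m = n then v else 0}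
      add_mem' := by
        rintro x y ⟨z, hz⟩ ⟨w, hw⟩
        refine ⟨z + w, fun m => ?_⟩
        rw [map_add, hz, hw]
        split_ifs <;> simp
      zero_mem' := ⟨0, fun m => by simp⟩
      smul_mem' := by
        rintro a x ⟨z, hz⟩
        refine ⟨a • z, fun m => ?_⟩
        rw [map_smul, hz]
        split_ifs <;> simp }
  have hT : IsStableFamily S T := by
    rintro p hp n v ⟨z, hz⟩
    refine ⟨(MvPolynomial.X ⟨p, hp⟩ : MvPolynomial S A) • z, fun m => ?_⟩
    by_cases hm : m p.2 = 0
    · rw [gradedEval_X_smul_of_eq_zero S m ⟨p, hp⟩ hm, if_neg]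
      rintro rfl
      simp at hm
    · obtain ⟨k, rfl⟩ : ∃ k : ι → ℕ, m = k + Pi.single p.2 1 := by
        refine ⟨m - Pi.single p.2 1, (tsub_add_cancel_of_le fun j => ?_).symm⟩
        by_cases hj : j = p.2
        · subst hj; simpa using Nat.one_le_iff_ne_zero.mpr hm
        · simp [Pi.single_eq_of_ne hj]
      rw [gradedEval_X_smul S k ⟨p, hp⟩, hz]
      simp only [add_left_inj]
      split_ifs <;> simp
  have hT0 : T 0 = ⊤ := by
    refine eq_top_iff.mpr fun v _ => ⟨1 ⊗ₜ v, fun m => ?_⟩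
    have : Finsupp.equivFunOnFinite.symm m = 0 ↔ m = 0 := by
      rw [Equiv.symm_apply_eq]; rfl
    rw [gradedEval_tmul, map_one, MvPolynomial.coeff_one]
    simp only [eq_comm (a := (0 : ι →₀ ℕ)), this]
    split_ifs <;> simp
  have := powProd_smul_le J (fun i n => hT.smul_le hS i n) n 0
  rw [hT0, zero_add] at this
  exact this hv

/-- Stable families of submodules of the multi-Rees module satisfy the ascending chain
condition. -/
theorem stableFamilyACC_powProd [IsNoetherianRing A] [Module.Finite A M] {S : Finset (A × ι)}
    {J : ι → Ideal A} (hS : ∀ i, J i = span {a | (a, i) ∈ S}) :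
    StableFamilyACC S (fun n => powProd J n • (⊤ : Submodule A M)) ⊥ := by
  intro L hL hs _ hLP
  have hmem : ∀ k n v, v ∈ powProd J n • (⊤ : Submodule A M) → ∀ z,
      (∀ m, gradedEval M S m z = if m = n then v else 0) →
      (z ∈ (hs k).toSubmodule ↔ v ∈ L k n) := by
    intro k n v hv z hz
    constructor
    · intro h
      simpa [hz] using h n
    · intro h m
      rw [hz]
      split_ifs with hm
      · exact hm ▸ h
      · exact zero_mem _
  let f : ℕ →o Submodule (MvPolynomial S A) (MvPolynomial S A ⊗[A] M) :=
    ⟨fun k => (hs k).toSubmodule, fun k k' hk z hz n => hL hk n (hz n)⟩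
  obtain ⟨k₀, hk₀⟩ := monotone_stabilizes_iff_noetherian.mpr
    (inferInstance : IsNoetherian (MvPolynomial S A) (MvPolynomial S A ⊗[A] M)) f
  refine ⟨k₀, fun k hk => ?_⟩
  refine le_antisymm (fun n v hv => ?_) (hL hk)
  have hv' := hLP k n hv
  obtain ⟨z, hz⟩ := exists_gradedEval_eq_ite hS n hv'
  have h1 := (hmem k n v hv' z hz).mpr hv
  exact (hmem k₀ n v hv' z hz).mp ((hk₀ k hk).symm ▸ h1 : z ∈ f k₀)

end

namespace Ideal

variable {A M ι : Type*} [CommRing A] [AddCommGroup M] [Module A M] [Fintype ι] [DecidableEq ι]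

theorem powProd_smul_eq (J : ι → Ideal A) (i : ι) (n : ι → ℕ) :
    J i • powProd J n • (⊤ : Submodule A M) = powProd J (n + Pi.single i 1) • ⊤ := by
  rw [powProd_add, powProd_single, pow_one, mul_comm, mul_smul]

theorem powProd_update_one (J : ι → Ideal A) (o : ι) (n : ι → ℕ) :
    powProd (Function.update J o 1) n = ∏ i ∈ Finset.univ.erase o, J i ^ n i := by
  rw [powProd, ← Finset.mul_prod_erase _ _ (Finset.mem_univ o)]
  simp only [Function.update_self, one_pow, one_mul]
  exact Finset.prod_congr rfl fun i hi => by
    rw [Function.update_of_ne (Finset.ne_of_mem_erase hi)]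

theorem powProd_eq_mul (J : ι → Ideal A) (o : ι) (n : ι → ℕ) :
    powProd J n = J o ^ n o * powProd (Function.update J o 1) n := by
  rw [powProd_update_one, powProd,
    Finset.mul_prod_erase _ (fun i => J i ^ n i) (Finset.mem_univ o)]

theorem powProd_update_one_update (J : ι → Ideal A) (o : ι) (n : ι → ℕ) (r : ℕ) :
    powProd (Function.update J o 1) (Function.update n o r) =
      powProd (Function.update J o 1) n := by
  rw [powProd_update_one, powProd_update_one]
  exact Finset.prod_congr rfl fun i hi => by
    rw [Function.update_of_ne (Finset.ne_of_mem_erase hi)]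

variable [IsNoetherianRing A] [Module.Finite A M]

/-- A stable family of submodules of the multi-Rees module is generated in degrees that are
bounded in a given direction. -/
theorem exists_le_iSup_powProd_smul (J : ι → Ideal A) (o : ι) (L : (ι → ℕ) → Submodule A M)
    (hL : ∀ i n, J i • L n ≤ L (n + Pi.single i 1))
    (hLJ : ∀ n, L n ≤ powProd J n • ⊤) :
    ∃ c : ℕ, ∀ n, L n ≤ ⨆ (m : ι → ℕ) (_ : m ≤ n ∧ m o ≤ c), powProd J (n - m) • L m := by
  obtain ⟨S, hS⟩ := exists_finset_span_eq J
  have hle : ∀ m n : ι → ℕ, m ≤ n → powProd J (n - m) • L m ≤ L n := fun m n hmn => by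
    have := powProd_smul_le J hL (n - m) m
    rwa [add_tsub_cancel_of_le hmn] at this
  have key := stableFamilyACC_powProd (M := M) hS
    (fun c n => ⨆ (m : ι → ℕ) (_ : m ≤ n ∧ m o ≤ c), powProd J (n - m) • L m) ?_ ?_
    (fun _ _ => bot_le) (fun c n => iSup₂_le fun m hm => (hle m n hm.1).trans (hLJ n))
  · obtain ⟨c, hc⟩ := key
    refine ⟨c, fun n => ?_⟩
    have h1 : L n ≤ ⨆ (m : ι → ℕ) (_ : m ≤ n ∧ m o ≤ max c (n o)), powProd J (n - m) • L m := by
      refine le_trans ?_ (le_iSup₂ n ⟨le_rfl, le_max_right _ _⟩)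
      simp
    exact h1.trans (congrFun (hc (max c (n o)) (le_max_left _ _)) n).le
  · intro c c' hcc n
    exact iSup₂_le fun m hm => le_iSup₂_of_le m ⟨hm.1, hm.2.trans hcc⟩ le_rfl
  · intro c p hp n v hv
    have hpJ : p.1 ∈ J p.2 := by
      rw [hS]; exact subset_span hp
    have hle : (⨆ (m : ι → ℕ) (_ : m ≤ n ∧ m o ≤ c), powProd J (n - m) • L m) ≤
        Submodule.comap (LinearMap.lsmul A M p.1) (⨆ (m : ι → ℕ)
          (_ : m ≤ n + Pi.single p.2 1 ∧ m o ≤ c), powProd J (n + Pi.single p.2 1 - m) • L m) := by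
      refine iSup₂_le fun m hm => ?_
      refine le_trans ?_ (Submodule.comap_mono (le_iSup₂ m ⟨hm.1.trans le_self_add, hm.2⟩))
      intro w hw
      rw [Submodule.mem_comap, tsub_add_eq_add_tsub hm.1 |>.symm, powProd_add, powProd_single,
        pow_one, mul_comm, mul_smul]
      exact Submodule.smul_mem_smul hpJ hw
    exact hle hv

theorem exists_pow_smul_inf_smul_le (J : ι → Ideal A) (o i : ι) :
    ∃ c : ℕ, ∀ (r : ℕ) (n : ι → ℕ),
      J o ^ r • powProd (Function.update J o 1) n • (⊤ : Submodule A M) ⊓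
        J i • powProd (Function.update J o 1) n • ⊤ ≤
      J o ^ (r - c) • J i • powProd (Function.update J o 1) n • ⊤ := by
  set J' := Function.update J o 1 with hJ'
  have hJJ' : ∀ j, J j ≤ J' j := fun j => by
    by_cases hj : j = o
    · subst hj; simp [hJ']
    · simp [hJ', Function.update_of_ne hj]
  have key := exists_le_iSup_powProd_smul (M := M) J o
    (fun n => powProd J n • ⊤ ⊓ J i • powProd J' n • ⊤) ?_ fun n => inf_le_left
  · obtain ⟨c, hc⟩ := key
    refine ⟨c, fun r n => ?_⟩
    have h := hc (Function.update n o r)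
    rw [powProd_eq_mul J o, ← hJ', powProd_update_one_update, Function.update_self, mul_smul] at h
    refine h.trans (iSup₂_le fun m hm => ?_)
    refine (Submodule.smul_mono le_rfl inf_le_right).trans ?_
    rw [powProd_eq_mul J o, ← hJ', Pi.sub_apply, Function.update_self, mul_smul]
    refine Submodule.smul_mono (Ideal.pow_le_pow_right (by have := hm.2; omega)) ?_
    rw [← mul_smul, mul_comm, mul_smul, ← mul_smul (powProd J' (_ - m)) (powProd J' m),
      ← powProd_add, tsub_add_cancel_of_le hm.1, powProd_update_one_update]
  · intro j n
    refine le_inf ?_ ?_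
    · exact (Submodule.smul_mono le_rfl inf_le_left).trans (powProd_smul_eq J j n).le
    · refine (Submodule.smul_mono (hJJ' j) inf_le_right).trans ?_
      rw [← powProd_smul_eq J' j n, ← mul_smul, mul_comm, mul_smul]

/-- A uniform Artin-Rees lemma for products of powers of ideals. -/
theorem exists_pow_smul_inf_powProd_smul_le (M : Type*) [AddCommGroup M] [Module A M]
    [Module.Finite A M] (J : ι → Ideal A) (o : ι) :
    ∃ c : ℕ, ∀ (r : ℕ) (n : ι → ℕ),
      J o ^ r • (⊤ : Submodule A M) ⊓ powProd (Function.update J o 1) n • ⊤ ≤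
        J o ^ (r - c * ∑ i, n i) • powProd (Function.update J o 1) n • ⊤ := by
  choose c hc using exists_pow_smul_inf_smul_le (M := M) J o
  set J' := Function.update J o 1 with hJ'
  refine ⟨∑ i, c i, fun r n => ?_⟩
  induction hk : ∑ i, n i generalizing n with
  | zero =>
    have : n = 0 := by
      ext i
      exact Finset.sum_eq_zero_iff.mp hk i (Finset.mem_univ i)
    simp [this]
  | succ k ih =>
    obtain ⟨i, -, hi⟩ : ∃ i ∈ Finset.univ, n i ≠ 0 :=
      Finset.exists_ne_zero_of_sum_ne_zero (by omega)
    obtain ⟨m, rfl⟩ : ∃ m : ι → ℕ, n = m + Pi.single i 1 := by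
      refine ⟨n - Pi.single i 1, (tsub_add_cancel_of_le fun j => ?_).symm⟩
      by_cases hj : j = i
      · subst hj; simpa using Nat.one_le_iff_ne_zero.mpr hi
      · simp [Pi.single_eq_of_ne hj]
    have hsum : ∑ j, m j = k := by
      have h1 : ∑ j, (Pi.single i 1 : ι → ℕ) j = 1 := by simp
      simp only [Pi.add_apply, Finset.sum_add_distrib] at hk
      omega
    have ih := ih m hsum
    by_cases hio : i = o
    · subst hio
      have h1 : powProd J' (m + Pi.single i 1) = powProd J' m := by
        rw [powProd_add, powProd_single, hJ']
        simp
      rw [h1]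
      exact ih.trans (Submodule.smul_mono (Ideal.pow_le_pow_right (by gcongr; omega)) le_rfl)
    · have h1 : powProd J' (m + Pi.single i 1) • (⊤ : Submodule A M) =
          J i • powProd J' m • ⊤ := by
        rw [← powProd_smul_eq, hJ', Function.update_of_ne hio]
      rw [h1]
      refine (le_inf (inf_le_inf_left _ Submodule.smul_le_right) inf_le_right).trans ?_
      refine (inf_le_inf_right _ ih).trans ((hc i _ m).trans ?_)
      refine Submodule.smul_mono (Ideal.pow_le_pow_right ?_) le_rfl
      have : c i ≤ ∑ j, c j := Finset.single_le_sum (fun j _ => Nat.zero_le (c j))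
        (Finset.mem_univ i)
      rw [mul_add, mul_one]
      omega

end Ideal

section

open Submodule IsLocalRing

variable {A M : Type*} [CommRing A] [AddCommGroup M] [Module A M]

theorem relLength_top_sup_span_pow_le (K : Ideal A) (x : A) (t : ℕ) :
    relLength (⊤ : Submodule A M) ((K ⊔ Ideal.span {x ^ t}) • ⊤) ≤
      t * relLength (⊤ : Submodule A M) ((K ⊔ Ideal.span {x}) • ⊤) := by
  induction t with
  | zero =>
    refine le_of_eq_of_le (relLength_eq_zero ?_) bot_le
    simp
  | succ t ih =>
    have hle : K ⊔ Ideal.span {x ^ (t + 1)} ≤ K ⊔ Ideal.span {x ^ t} :=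
      sup_le_sup_left (Ideal.span_singleton_le_span_singleton.mpr (pow_dvd_pow x t.le_succ)) _
    rw [relLength_eq_add (smul_mono_left hle) le_top, Nat.cast_add, Nat.cast_one, add_mul, one_mul]
    refine add_le_add ih ?_
    have h : (K ⊔ Ideal.span {x ^ t}) • (⊤ : Submodule A M) =
        map (LinearMap.lsmul A M (x ^ t)) ⊤ ⊔ (K ⊔ Ideal.span {x ^ (t + 1)}) • ⊤ := by
      have hx : map (LinearMap.lsmul A M (x ^ t)) ⊤ = Ideal.span {x ^ t} • ⊤ := by
        rw [ideal_span_singleton_smul]; rfl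
      rw [hx, ← sup_smul]
      congr 1
      refine le_antisymm (sup_le ?_ le_sup_left) (sup_le le_sup_right hle)
      exact le_sup_of_le_right le_sup_left
    rw [h, relLength_map_sup]
    refine relLength_anti (le_inf le_top (smul_le.mpr fun r hr v _ => ?_))
    obtain ⟨a, ha, b, hb, rfl⟩ := mem_sup.mp hr
    obtain ⟨b, rfl⟩ := Ideal.mem_span_singleton'.mp hb
    change x ^ t • (a + b * x) • v ∈ (K ⊔ Ideal.span {x ^ (t + 1)}) • (⊤ : Submodule A M)
    rw [← mul_smul]
    refine smul_mem_smul ?_ trivial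
    rw [mul_add]
    refine add_mem (mem_sup_left (K.mul_mem_left _ ha)) (mem_sup_right ?_)
    exact Ideal.mem_span_singleton'.mpr ⟨b, by ring⟩

theorem relLength_top_span_image_pow_le (s : Finset A) (K : Ideal A) (t : ℕ) :
    relLength (⊤ : Submodule A M) ((K ⊔ Ideal.span ((· ^ t) '' (s : Set A))) • ⊤) ≤
      (t ^ s.card : ℕ) * relLength (⊤ : Submodule A M) ((K ⊔ Ideal.span (s : Set A)) • ⊤) := by
  classical
  induction s using Finset.induction_on generalizing K with
  | empty => simp
  | insert x s hx ih =>
    rw [Finset.coe_insert, Set.image_insert_eq, Ideal.span_insert, Ideal.span_insert,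
      Finset.card_insert_of_notMem hx, sup_comm (Ideal.span {x ^ t}), ← sup_assoc]
    refine (relLength_top_sup_span_pow_le _ x t).trans ?_
    rw [pow_succ', Nat.cast_mul, mul_assoc, sup_right_comm, ← sup_assoc]
    exact mul_le_mul_right (ih _) _

variable [IsNoetherianRing A] [IsLocalRing A] [Module.Finite A M]

theorem length_ne_top_of_pow_maximalIdeal_le {e : ℕ}
    (h : maximalIdeal A ^ e ≤ Module.annihilator A M) : Module.length A M ≠ ⊤ := by
  by_cases hM : Module.annihilator A M = ⊤
  · have := Module.annihilator_eq_top_iff.mp hM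
    simp [Module.length_eq_zero]
  have : IsArtinianRing (A ⧸ Module.annihilator A M) := by
    refine quotient_artinian_of_mem_minimalPrimes_of_isLocalRing _
      ⟨⟨inferInstance, le_maximalIdeal hM⟩, fun p hp _ => ?_⟩
    have := hp.1
    exact Ideal.IsPrime.le_of_pow_le (h.trans hp.2)
  let : Module (A ⧸ Module.annihilator A M) M := Module.quotientAnnihilator
  have : IsScalarTower A (A ⧸ Module.annihilator A M) M :=
    (Module.isTorsionBySet_annihilator A M).isScalarTower
  have : Module.Finite (A ⧸ Module.annihilator A M) M :=
    Module.Finite.of_restrictScalars_finite A _ _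
  rw [Module.length_eq_of_surjective (R := A ⧸ Module.annihilator A M)
    Ideal.Quotient.mk_surjective]
  exact Module.length_ne_top

theorem relLength_ne_top_of_pow_maximalIdeal_le {P Q : Submodule A M} {J : Ideal A} {e : ℕ}
    (h : maximalIdeal A ^ e ≤ J) (hQ : J • P ≤ Q) : relLength P Q ≠ ⊤ := by
  refine length_ne_top_of_pow_maximalIdeal_le (h.trans fun a ha => ?_)
  refine Module.mem_annihilator.mpr fun y => ?_
  obtain ⟨y, rfl⟩ := mkQ_surjective _ y
  exact (Quotient.mk_eq_zero (Q.submoduleOf P)).mpr (hQ (smul_mem_smul ha y.2))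

/-- The Hilbert-Samuel function grows at most like `t ^ dim M`. -/
theorem exists_relLength_top_pow_smul_le (M : Type*) [AddCommGroup M] [Module A M]
    [Module.Finite A M] {J : Ideal A} {e : ℕ}
    (h : maximalIdeal A ^ e ≤ J) {q : ℕ} (hq : ringKrullDim (A ⧸ Module.annihilator A M) ≤ q) :
    ∃ C : ℕ, ∀ t : ℕ, relLength (⊤ : Submodule A M) (J ^ t • ⊤) ≤ (C * (t + 1) ^ q : ℕ) := by
  classical
  set I := Module.annihilator A M with hI
  by_cases hM : I = ⊤
  · have := Module.annihilator_eq_top_iff.mp hM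
    refine ⟨0, fun t => (relLength_eq_zero fun v _ => ?_).trans_le bot_le⟩
    rw [Subsingleton.elim v 0]
    exact zero_mem _
  have : Nontrivial (A ⧸ I) := Ideal.Quotient.nontrivial_iff.mpr hM
  have := IsLocalRing.of_surjective' (Ideal.Quotient.mk I) Ideal.Quotient.mk_surjective
  obtain ⟨s', hs', hcard⟩ :=
    Ideal.exists_finset_card_eq_height_of_isNoetherianRing (maximalIdeal (A ⧸ I))
  have hcard' : s'.card ≤ q := by
    rw [← maximalIdeal_height_eq_ringKrullDim, ← hcard] at hq
    exact_mod_cast hq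
  have := quotient_artinian_of_mem_minimalPrimes_of_isLocalRing _ hs'
  obtain ⟨k, hk⟩ := exists_maximalIdeal_pow_le_of_isArtinianRing_quotient
    (Ideal.span (s' : Set (A ⧸ I)))
  obtain ⟨g, hg⟩ := Ideal.Quotient.mk_surjective (I := I).hasRightInverse
  set s := s'.image g with hs
  have hmap : Ideal.map (Ideal.Quotient.mk I) (Ideal.span (s : Set A)) = Ideal.span s' := by
    rw [Ideal.map_span, hs, Finset.coe_image, ← Set.image_comp]
    congr 1
    convert Set.image_id _
    exact funext hg
  have hsI : maximalIdeal A ^ k ≤ Ideal.span (s : Set A) ⊔ I := by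
    have h1 := Ideal.comap_map_of_surjective (Ideal.Quotient.mk I) Ideal.Quotient.mk_surjective
      (Ideal.span (s : Set A))
    rw [← RingHom.ker_eq_comap_bot, Ideal.mk_ker] at h1
    rw [← h1, hmap, ← Ideal.map_le_iff_le_comap, Ideal.map_pow]
    refine (Ideal.pow_right_mono ?_ k).trans hk
    refine Ideal.map_le_iff_le_comap.mpr (le_of_eq ?_)
    have := Ideal.comap_isMaximal_of_surjective (Ideal.Quotient.mk I) Ideal.Quotient.mk_surjective
      (K := maximalIdeal (A ⧸ I))
    exact (eq_maximalIdeal this).symm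
  have hfin : relLength (⊤ : Submodule A M) (Ideal.span (s : Set A) • ⊤) ≠ ⊤ := by
    refine relLength_ne_top_of_pow_maximalIdeal_le hsI ?_
    rw [sup_smul]
    refine sup_le le_rfl ?_
    rw [hI]
    exact smul_le.mpr fun r hr v _ => by simp [Module.mem_annihilator.mp hr v]
  have hsm : (s : Set A) ⊆ maximalIdeal A := by
    intro x hx
    obtain ⟨y, hy, rfl⟩ := Finset.mem_image.mp hx
    have hy' : y ∈ maximalIdeal (A ⧸ I) := hs'.1.2 (Ideal.subset_span hy)
    rw [SetLike.mem_coe, mem_maximalIdeal, mem_nonunits_iff]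
    rw [mem_maximalIdeal, mem_nonunits_iff] at hy'
    exact fun hu => hy' (hg y ▸ hu.map (Ideal.Quotient.mk I))
  obtain ⟨l, hl⟩ := ENat.ne_top_iff_exists.mp hfin
  refine ⟨(e + 1) ^ q * l, fun t => ?_⟩
  have h1 : Ideal.span ((· ^ (e * t)) '' (s : Set A)) ≤ J ^ t := by
    rw [Ideal.span_le]
    rintro _ ⟨x, hx, rfl⟩
    change x ^ (e * t) ∈ J ^ t
    rw [pow_mul]
    exact Ideal.pow_mem_pow (h (Ideal.pow_mem_pow (hsm hx) e)) t
  have h2 := relLength_top_span_image_pow_le (M := M) s ⊥ (e * t)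
  rw [bot_sup_eq, bot_sup_eq, ← hl] at h2
  refine (relLength_anti (smul_mono_left h1)).trans (h2.trans ?_)
  rw [← Nat.cast_mul, Nat.cast_le]
  have h3 : (e * t) ^ s.card ≤ ((e + 1) * (t + 1)) ^ q := by
    refine (Nat.pow_le_pow_left (Nat.mul_le_mul e.le_succ t.le_succ) _).trans ?_
    exact Nat.pow_le_pow_right (by positivity) (Finset.card_image_le.trans hcard')
  calc (e * t) ^ s.card * l ≤ ((e + 1) * (t + 1)) ^ q * l := Nat.mul_le_mul_right _ h3
    _ = (e + 1) ^ q * l * (t + 1) ^ q := by rw [mul_pow]; ring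

end

theorem LTSeries.head_lt_one {α : Type*} [Preorder α] (l : LTSeries α) (h : l.length ≠ 0) :
    l.head < l 1 :=
  l.strictMono (by rw [Fin.lt_def, Fin.val_zero, Fin.val_one', Nat.mod_eq_of_lt] <;> omega)

theorem ringKrullDim_quotient_le_of_forall_length_le {A : Type*} [CommRing A] {K : Ideal A} {e : ℕ}
    (h : ∀ l : LTSeries (PrimeSpectrum A), K ≤ l.head.asIdeal → l.length ≤ e) :
    ringKrullDim (A ⧸ K) ≤ e := by
  rw [ringKrullDim_quotient, Order.krullDim]
  refine iSup_le fun l => ?_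
  have := h (l.map Subtype.val fun _ _ h => h) l.head.2
  exact_mod_cast this

section

open Submodule IsLocalRing

variable {A : Type*} [CommRing A] [IsNoetherianRing A]

theorem exists_le_comap_smul_pow_le {P : Ideal A} [hP : P.IsPrime] {x : A} (hx : x ∉ P)
    (I : Ideal A) :
    ∃ c : ℕ, ∀ n, comap (LinearMap.lsmul A A x) (P ⊔ I ^ (n + c)) ≤ P ⊔ I ^ n := by
  obtain ⟨c, hc⟩ := I.exists_pow_inf_eq_pow_smul (M := A) (P ⊔ Ideal.span {x})
  refine ⟨c, fun n y hy => ?_⟩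
  obtain ⟨a, ha, z, hz, haz⟩ := mem_sup.mp (mem_comap.mp hy)
  simp only [LinearMap.lsmul_apply, smul_eq_mul] at haz
  have hz' : z ∈ I ^ (n + c) • (⊤ : Ideal A) ⊓ (P ⊔ Ideal.span {x}) := by
    refine ⟨by simpa using hz, ?_⟩
    have : z = -a + x * y := by rw [← haz]; ring
    rw [this]
    exact add_mem (mem_sup_left (neg_mem ha))
      (mem_sup_right (Ideal.mul_mem_right _ _ (Ideal.mem_span_singleton_self x)))
  rw [hc _ (Nat.le_add_left c n), Nat.add_sub_cancel] at hz'
  have hz2 : z ∈ P ⊔ I ^ n * Ideal.span {x} := by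
    have h : z ∈ I ^ n • (P ⊔ Ideal.span {x}) := smul_mono le_rfl inf_le_right hz'
    rw [smul_eq_mul, Ideal.mul_sup] at h
    have hle : I ^ n * P ≤ P := Ideal.mul_le_right
    exact sup_le_sup_right hle _ h
  obtain ⟨b, hb, w, hw, hbw⟩ := mem_sup.mp hz2
  obtain ⟨w, hw', rfl⟩ := Ideal.mem_mul_span_singleton.mp hw
  have h : x * (y - w) ∈ P := by
    have : x * (y - w) = a + b := by rw [mul_sub, ← haz, ← hbw]; ring
    rw [this]
    exact add_mem ha hb
  have hyw := (hP.mem_or_mem h).resolve_left hx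
  have : y = (y - w) + w := by ring
  rw [this]
  exact add_mem (mem_sup_left hyw) (mem_sup_right hw')

variable [IsLocalRing A]

/-- A bound on the growth of the Hilbert-Samuel function of `A ⧸ K` bounds the length of chains of
primes above `K`. -/
theorem length_le_of_relLength_sup_pow_le (e : ℕ) (K : Ideal A) (C : ℕ)
    (hC : ∀ n : ℕ, relLength (⊤ : Submodule A A) (K ⊔ maximalIdeal A ^ n) ≤
      (C * (n + 1) ^ e : ℕ))
    (l : LTSeries (PrimeSpectrum A)) (hl : K ≤ l.head.asIdeal) : l.length ≤ e := by
  induction e generalizing K C l with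
  | zero =>
    have hmono : ∀ n, K ⊔ maximalIdeal A ^ (n + 1) ≤ K ⊔ maximalIdeal A ^ n := fun n =>
      sup_le_sup_left (Ideal.pow_le_pow_right n.le_succ) _
    obtain ⟨n, hn⟩ : ∃ n, relLength (K ⊔ maximalIdeal A ^ n : Submodule A A)
        (K ⊔ maximalIdeal A ^ (n + 1)) = 0 := by
      by_contra! h
      have : ∀ n : ℕ, (n : ℕ∞) ≤ relLength (⊤ : Submodule A A) (K ⊔ maximalIdeal A ^ n) := by
        intro n
        induction n with
        | zero => simp
        | succ n ih =>
          rw [relLength_eq_add (hmono n) le_top, Nat.cast_add]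
          exact add_le_add ih (by simpa using Order.one_le_iff_pos.mpr (pos_iff_ne_zero.mpr (h n)))
      have := (this (C + 1)).trans (hC (C + 1))
      rw [Nat.cast_le, pow_zero] at this
      omega
    have hle : maximalIdeal A ^ n ≤ K := by
      refine le_of_le_smul_of_le_jacobson_bot (I := maximalIdeal A)
        (IsNoetherian.noetherian _) ((jacobson_eq_maximalIdeal _ bot_ne_top).ge) ?_
      have := relLength_eq_zero_iff.mp hn
      rw [smul_eq_mul, ← pow_succ']
      exact le_sup_right.trans this
    by_contra! h
    have h1 := l.head_lt_one h.ne'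
    have h2 : maximalIdeal A ≤ l.head.asIdeal := Ideal.IsPrime.le_of_pow_le (hle.trans hl)
    exact absurd ((le_maximalIdeal (l 1).2.ne_top).trans h2) (not_le_of_gt h1)
  | succ e ih =>
    by_cases h0 : l.length = 0
    · omega
    have h1 := l.head_lt_one h0
    obtain ⟨x, hx1, hx0⟩ := Set.exists_of_ssubset (show (l.head.asIdeal : Set A) ⊂
      (l 1).asIdeal from h1)
    set P := l.head.asIdeal with hP
    obtain ⟨c, hc⟩ := exists_le_comap_smul_pow_le (P := P) hx0 (maximalIdeal A)
    let f : ℕ → ℕ∞ := fun n => relLength (⊤ : Submodule A A) (P ⊔ maximalIdeal A ^ n)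
    let h : ℕ → ℕ∞ := fun n =>
      relLength (⊤ : Submodule A A) (P ⊔ Ideal.span {x} ⊔ maximalIdeal A ^ n)
    have hf : ∀ n, f n ≤ (C * (n + 1) ^ (e + 1) : ℕ) := fun n =>
      (relLength_anti (sup_le_sup_right hl _)).trans (hC n)
    have hmono : Monotone h := fun m n hmn =>
      relLength_anti (sup_le_sup_left (Ideal.pow_le_pow_right hmn) _)
    have hstep : ∀ n, h (n + c) + f n ≤ f (n + c) := by
      intro n
      have hle : P ⊔ maximalIdeal A ^ (n + c) ≤ P ⊔ Ideal.span {x} ⊔ maximalIdeal A ^ (n + c) :=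
        sup_le_sup_right le_sup_left _
      change _ ≤ relLength _ _
      rw [relLength_eq_add hle le_top]
      refine add_le_add_right ?_ _
      have hmap : (P ⊔ Ideal.span {x} ⊔ maximalIdeal A ^ (n + c) : Submodule A A) =
          map (LinearMap.lsmul A A x) ⊤ ⊔ (P ⊔ maximalIdeal A ^ (n + c)) := by
        have : map (LinearMap.lsmul A A x) ⊤ = Ideal.span {x} := by
          ext y
          simp [Ideal.mem_span_singleton', mul_comm]
        rw [this, sup_comm P, sup_assoc]
      rw [hmap, relLength_map_sup, top_inf_eq]
      exact relLength_anti (hc n)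
    have hsum : ∀ k n : ℕ, (k : ℕ∞) * h n ≤ f (n + k * c) := by
      intro k n
      induction k with
      | zero => simp
      | succ k ihk =>
        rw [Nat.cast_add, add_mul, Nat.cast_one, one_mul, add_comm, add_mul, one_mul, ← add_assoc]
        refine le_trans (add_le_add (hmono ?_) ihk) (hstep _)
        omega
    have hbound : ∀ n, h n ≤ (C * (c + 1) ^ (e + 1) * (n + 1) ^ e : ℕ) := by
      intro n
      have hh := (hsum (n + 1) n).trans (hf _)
      have : C * (n + (n + 1) * c + 1) ^ (e + 1) =
          (n + 1) * (C * (c + 1) ^ (e + 1) * (n + 1) ^ e) := by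
        have : n + (n + 1) * c + 1 = (c + 1) * (n + 1) := by ring
        rw [this, mul_pow, pow_succ (n + 1) e]
        ring
      rw [this, Nat.cast_mul] at hh
      exact (ENat.mul_le_mul_left_iff (by simp) (ENat.natCast_ne_top _)).mp hh
    have := ih (P ⊔ Ideal.span {x}) _ hbound (l.tail h0) ?_
    · rw [RelSeries.tail_length] at this
      omega
    · rw [RelSeries.head_tail]
      exact sup_le h1.le ((Ideal.span_singleton_le_iff_mem _).mpr hx1)

/-- The Hilbert-Samuel function grows at least like `t ^ dim M`. -/
theorem ringKrullDim_le_of_relLength_top_pow_smul_le {M : Type*} [AddCommGroup M] [Module A M]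
    [Module.Finite A M] {J : Ideal A} (hJ : J ≤ maximalIdeal A) {e C : ℕ}
    (hC : ∀ t : ℕ, relLength (⊤ : Submodule A M) (J ^ t • ⊤) ≤ (C * (t + 1) ^ e : ℕ)) :
    ringKrullDim (A ⧸ Module.annihilator A M) ≤ e := by
  refine ringKrullDim_quotient_le_of_forall_length_le fun l hl => ?_
  obtain ⟨P, hP, hPl⟩ := Ideal.exists_minimalPrimes_le hl
  obtain ⟨hPp, v, hv⟩ := isAssociatedPrime_iff.mp
    (Module.associatedPrimes.minimalPrimes_annihilator_subset_associatedPrimes A M hP)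
  set φ := LinearMap.toSpanSingleton A M v
  have hφ : ∀ a, φ a = 0 ↔ a ∈ P := fun a => by
    rw [hv, mem_colon_singleton, mem_bot, LinearMap.toSpanSingleton_apply]
  obtain ⟨k, hk⟩ := (maximalIdeal A).exists_pow_inf_eq_pow_smul (LinearMap.range φ)
  refine length_le_of_relLength_sup_pow_le e P (C * (k + 1) ^ e) (fun n => ?_) l hPl
  have h1 : comap φ (maximalIdeal A ^ (n + k) • ⊤) ≤ P ⊔ maximalIdeal A ^ n := by
    intro a ha
    have ha' : φ a ∈ maximalIdeal A ^ (n + k) • ⊤ ⊓ LinearMap.range φ := ⟨ha, a, rfl⟩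
    rw [hk _ (Nat.le_add_left k n), Nat.add_sub_cancel] at ha'
    have ha'' : φ a ∈ maximalIdeal A ^ n • LinearMap.range φ := smul_mono le_rfl inf_le_right ha'
    rw [LinearMap.range_eq_map, ← map_smul''] at ha''
    obtain ⟨w, hw, hwa⟩ := ha''
    have : a = (a - w) + w := by ring
    rw [this]
    refine add_mem (mem_sup_left ((hφ _).mp ?_)) (mem_sup_right (by simpa using hw))
    rw [map_sub, hwa, sub_self]
  calc relLength (⊤ : Submodule A A) (P ⊔ maximalIdeal A ^ n)
      ≤ relLength ⊤ (⊤ ⊓ comap φ (maximalIdeal A ^ (n + k) • ⊤)) :=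
        relLength_anti (inf_le_right.trans h1)
    _ = relLength (map φ ⊤ ⊔ maximalIdeal A ^ (n + k) • ⊤) (maximalIdeal A ^ (n + k) • ⊤) :=
        (relLength_map_sup _ _ _).symm
    _ ≤ relLength ⊤ (maximalIdeal A ^ (n + k) • ⊤) := relLength_mono le_top
    _ ≤ relLength ⊤ (J ^ (n + k) • ⊤) :=
        relLength_anti (smul_mono_left (Ideal.pow_right_mono hJ _))
    _ ≤ (C * (n + k + 1) ^ e : ℕ) := hC _
    _ ≤ (C * (k + 1) ^ e * (n + 1) ^ e : ℕ) := by
        rw [mul_assoc, ← mul_pow, Nat.cast_le]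
        refine Nat.mul_le_mul_left _ (Nat.pow_le_pow_left ?_ _)
        nlinarith [Nat.zero_le (k * n)]

end

section

open Submodule IsLocalRing Ideal

variable {A : Type*} [CommRing A]

theorem relLength_pow_smul_eq_sum {M : Type*} [AddCommGroup M] [Module A M] (J : Ideal A)
    (P : Submodule A M) (t : ℕ) :
    relLength P (J ^ t • P) = ∑ k ∈ Finset.range t, relLength (J ^ k • P) (J • J ^ k • P) := by
  induction t with
  | zero => simpa using relLength_eq_zero le_rfl
  | succ t ih =>
    rw [Finset.sum_range_succ, ← ih, ← smul_assoc J, smul_eq_mul, ← pow_succ']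
    exact relLength_eq_add (smul_mono_left (Ideal.pow_le_pow_right t.le_succ)) smul_le_right

variable {M ι : Type*} [AddCommGroup M] [Module A M] [Fintype ι] [DecidableEq ι] {J : ι → Ideal A}
  {o : ι}

theorem relLength_powProd_update (n : ι → ℕ) (k : ℕ) :
    relLength (J o ^ k • powProd (Function.update J o 1) n • (⊤ : Submodule A M))
      (J o • J o ^ k • powProd (Function.update J o 1) n • ⊤) =
    relLength (powProd J (Function.update n o k) • (⊤ : Submodule A M))
      (J o • powProd J (Function.update n o k) • ⊤) := by
  have : powProd J (Function.update n o k) =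
      J o ^ k * powProd (Function.update J o 1) n := by
    rw [powProd_eq_mul J o, powProd_update_one_update, Function.update_self]
  rw [this, ← smul_eq_mul, smul_assoc]

variable [IsNoetherianRing A] [IsLocalRing A] [Module.Finite A M] {e : ℕ}

theorem eventuallyPoly_relLength_powProd (he : maximalIdeal A ^ e ≤ J o) :
    EventuallyPoly fun n => ((relLength (powProd J n • (⊤ : Submodule A M))
      (J o • powProd J n • ⊤)).toNat : ℚ) := by
  obtain ⟨S, hS⟩ := exists_finset_span_eq J
  have hmem : ∀ p ∈ S, p.1 ∈ J p.2 := fun p hp => by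
    rw [hS]
    exact Ideal.subset_span hp
  refine eventuallyPoly_relLength S (fun n => powProd J n • (⊤ : Submodule A M))
    (fun n => J o • powProd J n • (⊤ : Submodule A M)) (fun p hp n v hv => ?_)
    (fun p hp n v hv => ?_) (fun n => smul_le_right)
    ((stableFamilyACC_powProd hS).mono le_rfl bot_le)
    fun n => relLength_ne_top_of_pow_maximalIdeal_le he le_rfl
  · beta_reduce
    rw [← powProd_smul_eq]
    exact smul_mem_smul (hmem p hp) hv
  · beta_reduce
    rw [← powProd_smul_eq, ← smul_assoc, smul_eq_mul, mul_comm, ← smul_eq_mul, smul_assoc]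
    exact smul_mem_smul (hmem p hp) hv

variable {P : MvPolynomial ι ℚ} {N : ℕ}

theorem totalDegree_le_of_relLength_powProd (he : maximalIdeal A ^ e ≤ J o)
    (hP : ∀ n : ι → ℕ, (∀ i, N ≤ n i) → ((relLength (powProd J n • (⊤ : Submodule A M))
      (J o • powProd J n • ⊤)).toNat : ℚ) = MvPolynomial.eval (fun i => (n i : ℚ)) P) {q : ℕ}
    (hq : ringKrullDim (A ⧸ Module.annihilator A M) ≤ q) : P.totalDegree ≤ q - 1 := by
  obtain ⟨G, hG⟩ := MvPolynomial.exists_sum_Ico_update P o N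
  obtain ⟨c, hc⟩ := exists_pow_smul_inf_powProd_smul_le M J o
  obtain ⟨C, hC⟩ := exists_relLength_top_pow_smul_le M he hq
  set H : (ι → ℕ) → ℕ∞ := fun n => relLength (powProd J n • (⊤ : Submodule A M))
      (J o • powProd J n • ⊤) with hH
  have hHt : ∀ n, H n ≠ ⊤ := fun n => relLength_ne_top_of_pow_maximalIdeal_le he le_rfl
  have hupd : ∀ (n : ι → ℕ) (k : ℕ), (fun i => ((Function.update n o k i : ℕ) : ℚ)) =
      Function.update (fun i => (n i : ℚ)) o k := fun n k => by
    ext i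
    by_cases h : i = o
    · subst h; simp
    · simp [h]
  have hsum : ∀ n : ι → ℕ, (∀ i, N ≤ n i) → MvPolynomial.eval (fun i => (n i : ℚ)) G =
      ((∑ k ∈ Finset.Ico N (n o), (H (Function.update n o k)).toNat : ℕ) : ℚ) := fun n hn => by
    rw [← hG n (hn o), Nat.cast_sum]
    refine Finset.sum_congr rfl fun k hk => ?_
    rw [← hupd, ← hP]
    intro i
    by_cases h : i = o
    · subst h; simpa using (Finset.mem_Ico.mp hk).1
    · simpa [h] using hn i
  have hGle : G.totalDegree ≤ q := by
    refine MvPolynomial.totalDegree_le_of_abs_eval_natCast_le (N := N) (C := C * (1 + c) ^ q)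
      fun n hn => ?_
    rw [hsum n hn, abs_of_nonneg (Nat.cast_nonneg _)]
    set M₁ := powProd (Function.update J o 1) n • (⊤ : Submodule A M) with hM₁
    have key : ((∑ k ∈ Finset.Ico N (n o), (H (Function.update n o k)).toNat : ℕ) : ℕ∞) ≤
        (C * (n o + c * ∑ i, n i + 1) ^ q : ℕ) := by
      calc ((∑ k ∈ Finset.Ico N (n o), (H (Function.update n o k)).toNat : ℕ) : ℕ∞)
          = ∑ k ∈ Finset.Ico N (n o), H (Function.update n o k) := by
            rw [Nat.cast_sum]
            exact Finset.sum_congr rfl fun k _ => ENat.natCast_toNat (hHt _)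
        _ ≤ ∑ k ∈ Finset.range (n o), H (Function.update n o k) :=
            Finset.sum_le_sum_of_subset fun k hk =>
              Finset.mem_range.mpr (Finset.mem_Ico.mp hk).2
        _ = relLength M₁ (J o ^ n o • M₁) := by
            rw [relLength_pow_smul_eq_sum]
            exact Finset.sum_congr rfl fun k _ => (relLength_powProd_update n k).symm
        _ ≤ relLength M₁ (M₁ ⊓ J o ^ (n o + c * ∑ i, n i) • ⊤) := by
            refine relLength_anti ?_
            rw [inf_comm]
            have := hc (n o + c * ∑ i, n i) n
            rwa [Nat.add_sub_cancel] at this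
        _ = relLength M₁ (J o ^ (n o + c * ∑ i, n i) • ⊤) := relLength_inf _ _
        _ ≤ relLength ⊤ (J o ^ (n o + c * ∑ i, n i) • ⊤) := relLength_mono le_top
        _ ≤ _ := hC _
    have hno : n o ≤ ∑ i, n i := Finset.single_le_sum (fun _ _ => Nat.zero_le _) (Finset.mem_univ o)
    have key2 : ∑ k ∈ Finset.Ico N (n o), (H (Function.update n o k)).toNat ≤
        C * (1 + c) ^ q * (1 + ∑ i, n i) ^ q := by
      refine (Nat.cast_le.mp key).trans ?_
      rw [mul_assoc, ← mul_pow]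
      refine Nat.mul_le_mul_left _ (Nat.pow_le_pow_left ?_ _)
      nlinarith
    exact_mod_cast key2
  refine (MvPolynomial.totalDegree_le_of_eval_add_single_sub o N (G := G) fun n hn => ?_).trans
    (Nat.sub_le_sub_right hGle 1)
  have hn' : ∀ i, N ≤ (n + Pi.single o 1 : ι → ℕ) i := fun i => (hn i).trans (by simp)
  rw [hsum _ hn', hsum n hn, ← hP n hn]
  have h1 : ∀ k, Function.update (n + Pi.single o 1 : ι → ℕ) o k = Function.update n o k :=
    fun k => by
      ext i
      by_cases h : i = o
      · subst h; simp
      · simp [h]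
  have h2 : (n + Pi.single o 1 : ι → ℕ) o = n o + 1 := by simp
  simp only [h1, h2]
  rw [Finset.sum_Ico_succ_top (hn o), Function.update_eq_self]
  push_cast
  ring

theorem ringKrullDim_le_of_relLength_powProd (he : maximalIdeal A ^ e ≤ J o)
    (ho : J o ≤ maximalIdeal A)
    (hP : ∀ n : ι → ℕ, (∀ i, N ≤ n i) → ((relLength (powProd J n • (⊤ : Submodule A M))
      (J o • powProd J n • ⊤)).toNat : ℚ) = MvPolynomial.eval (fun i => (n i : ℚ)) P)
    {n : ι → ℕ} (hn : ∀ i, N ≤ n i) :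
    ringKrullDim (A ⧸ Module.annihilator A ↥(powProd J n • (⊤ : Submodule A M))) ≤
      (P.totalDegree + 1 : ℕ) := by
  obtain ⟨C, hC0, hC⟩ := MvPolynomial.exists_abs_eval_natCast_le P
  obtain ⟨D, hD⟩ := exists_nat_ge (C * (1 + ∑ i, n i : ℕ) ^ P.totalDegree)
  set M₁ := powProd J n • (⊤ : Submodule A M) with hM₁
  refine ringKrullDim_le_of_relLength_top_pow_smul_le ho (C := D) fun t => ?_
  rw [← relLength_map M₁.injective_subtype, Submodule.map_smul'', Submodule.map_top, range_subtype,
    relLength_pow_smul_eq_sum]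
  have hterm : ∀ k, relLength (J o ^ k • M₁) (J o • J o ^ k • M₁) ≤
      (D * (k + 1) ^ P.totalDegree : ℕ) := fun k => by
    have hk : J o ^ k • M₁ = powProd J (n + Pi.single o k) • ⊤ := by
      rw [powProd_add, powProd_single, mul_comm, ← smul_eq_mul, smul_assoc]
    rw [hk, ← ENat.natCast_toNat (relLength_ne_top_of_pow_maximalIdeal_le he le_rfl), Nat.cast_le,
      ← Nat.cast_le (α := ℚ), hP _ fun i => (hn i).trans (by simp)]
    refine (le_abs_self _).trans ((hC _).trans ?_)
    have h1 : ∑ i, (((n + Pi.single o k : ι → ℕ) i : ℕ) : ℚ) = ∑ i, (n i : ℚ) + k := by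
      simp [Finset.sum_add_distrib, ← Nat.cast_sum]
    rw [h1]
    calc C * (1 + (∑ i, (n i : ℚ) + k)) ^ P.totalDegree
        ≤ C * ((1 + ∑ i, (n i : ℚ)) * (k + 1)) ^ P.totalDegree := by
          have : 0 ≤ ∑ i, (n i : ℚ) := Finset.sum_nonneg fun _ _ => Nat.cast_nonneg _
          have hk0 : (0 : ℚ) ≤ k := Nat.cast_nonneg k
          gcongr
          nlinarith
      _ = C * (1 + ∑ i, (n i : ℚ)) ^ P.totalDegree * (k + 1) ^ P.totalDegree := by
          rw [mul_pow, mul_assoc]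
      _ ≤ D * (k + 1) ^ P.totalDegree := by
          push_cast at hD
          gcongr
      _ = _ := by push_cast; rfl
  calc ∑ k ∈ Finset.range t, relLength (J o ^ k • M₁) (J o • J o ^ k • M₁)
      ≤ ∑ k ∈ Finset.range t, ((D * (t + 1) ^ P.totalDegree : ℕ) : ℕ∞) :=
        Finset.sum_le_sum fun k hk => (hterm k).trans <| Nat.cast_le.mpr <| by
          have := Finset.mem_range.mp hk
          gcongr
    _ ≤ (D * (t + 1) ^ (P.totalDegree + 1) : ℕ) := by
        rw [Finset.sum_const, Finset.card_range, nsmul_eq_mul, ← Nat.cast_mul, Nat.cast_le,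
          pow_succ]
        nlinarith [Nat.zero_le (D * (t + 1) ^ P.totalDegree)]

end

namespace MvPolynomial

variable {ι : Type*}

theorem eval_bind₁_X_add_C (P : MvPolynomial ι ℚ) (c x : ι → ℚ) :
    eval x (bind₁ (fun i => X i + C (c i)) P) = eval (fun i => x i + c i) P := by
  rw [← coe_aeval_eq_eval, ← coe_aeval_eq_eval, RingHom.coe_coe, RingHom.coe_coe, aeval_bind₁]
  simp

variable [Fintype ι]

theorem totalDegree_bind₁_X_add_C_le (P : MvPolynomial ι ℚ) (c : ι → ℚ) :
    (bind₁ (fun i => X i + C (c i)) P).totalDegree ≤ P.totalDegree := by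
  rw [bind₁, aeval_def, eval₂_eq']
  refine totalDegree_finsetSum_le fun u hu => (totalDegree_mul _ _).trans ?_
  rw [algebraMap_eq, totalDegree_C, zero_add]
  refine (totalDegree_finsetProd _ _).trans ?_
  calc ∑ i, ((X i + C (c i) : MvPolynomial ι ℚ) ^ u i).totalDegree ≤ ∑ i, u i := by
        refine Finset.sum_le_sum fun i _ => (totalDegree_pow _ _).trans ?_
        refine (Nat.mul_le_mul_left _ (m := 1) ?_).trans_eq (mul_one _)
        refine (totalDegree_add _ _).trans ?_
        simp
    _ = u.sum fun _ k => k := by rw [Finsupp.sum_fintype _ _ (by simp)]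
    _ ≤ _ := le_totalDegree hu

/-- Translation of a polynomial. -/
theorem exists_eval_add_eq (P : MvPolynomial ι ℚ) (e : ι → ℕ) :
    ∃ Q : MvPolynomial ι ℚ, Q.totalDegree = P.totalDegree ∧ ∀ n : ι → ℕ,
      eval (fun i => ((n + e) i : ℚ)) Q = eval (fun i => (n i : ℚ)) P := by
  refine ⟨bind₁ (fun i => X i + C (-(e i : ℚ))) P,
    le_antisymm (totalDegree_bind₁_X_add_C_le P fun i => -(e i : ℚ)) ?_, fun n => ?_⟩
  · set Q := bind₁ (fun i => X i + C (-(e i : ℚ))) P with hQ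
    have h : P = bind₁ (fun i => X i + C (e i : ℚ)) Q := funext fun x => by
      rw [eval_bind₁_X_add_C _ fun i => (e i : ℚ), hQ, eval_bind₁_X_add_C _ fun i => -(e i : ℚ)]
      simp
    conv_lhs => rw [h]
    exact totalDegree_bind₁_X_add_C_le Q fun i => (e i : ℚ)
  · rw [eval_bind₁_X_add_C P fun i => -(e i : ℚ)]
    simp

end MvPolynomial

section

open Submodule IsLocalRing Ideal

theorem LTSeries.length_le_ringKrullDim_quotient {A : Type*} [CommRing A] {K : Ideal A}
    (l : LTSeries (PrimeSpectrum A)) (hl : K ≤ l.head.asIdeal) :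
    (l.length : WithBot ℕ∞) ≤ ringKrullDim (A ⧸ K) := by
  rw [ringKrullDim_quotient]
  let l' : LTSeries (PrimeSpectrum.zeroLocus (R := A) K) :=
    { length := l.length
      toFun := fun i => ⟨l i, hl.trans (l.monotone (Fin.zero_le i))⟩
      step := fun i => l.step i }
  exact Order.LTSeries.length_le_krullDim l'

theorem moduleLengthIs_of_length_eq {A N : Type*} [CommRing A] [AddCommGroup N] [Module A N]
    {l : ℕ} (h : Module.length A N = l) : ModuleLengthIs A N l := by
  have hfin : IsFiniteLength A N := Module.length_ne_top_iff.mp (by simp [h])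
  obtain ⟨c, hc0, hc1⟩ := isFiniteLength_iff_exists_compositionSeries.mp hfin
  refine ⟨c, hc0, hc1, ?_⟩
  rw [← Module.length_compositionSeries c hc0 hc1] at h
  exact_mod_cast h

variable {A : Type*} [CommRing A] [IsNoetherianRing A] {M : Type*} [AddCommGroup M] [Module A M]
  [Module.Finite A M]

theorem exists_satSubmodule_eq (I : Ideal A) :
    ∃ k : ℕ, ∀ x : M, x ∈ satSubmodule A M I ↔ ∀ a ∈ I ^ k, a • x = 0 := by
  let f : ℕ →o Submodule A M :=
    ⟨fun n => torsionBySet A M ((I ^ n : Ideal A) : Set A), fun m n h =>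
      torsionBySet_le_torsionBySet_of_subset (Ideal.pow_le_pow_right h)⟩
  obtain ⟨k, hk⟩ := monotone_stabilizes_iff_noetherian.mpr (inferInstance : IsNoetherian A M) f
  have : satSubmodule A M I = f k := by
    refine le_antisymm (iSup_le fun n => ?_) (le_iSup f k)
    rcases le_total k n with h | h
    · exact (hk n h).ge
    · exact f.monotone h
  refine ⟨k, fun x => ?_⟩
  rw [this]
  change x ∈ torsionBySet A M ((I ^ k : Ideal A) : Set A) ↔ _
  rw [mem_torsionBySet_iff]
  simp

theorem mem_satSubmodule_of_forall_smul_mem {I : Ideal A} {x : M}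
    (h : ∀ a ∈ I, a • x ∈ satSubmodule A M I) : x ∈ satSubmodule A M I := by
  obtain ⟨k, hk⟩ := exists_satSubmodule_eq (M := M) I
  have hle : I ^ (k + 1) ≤ (torsionOf A M x : Ideal A) := by
    rw [pow_succ, Ideal.mul_le]
    intro a ha b hb
    rw [mem_torsionOf_iff, mul_smul]
    exact (hk _).mp (h b hb) a ha
  exact le_iSup (fun n => torsionBySet A M ((I ^ n : Ideal A) : Set A)) (k + 1)
    ((mem_torsionBySet_iff _ _).mpr fun a => (mem_torsionOf_iff _ _).mp (hle a.2))

theorem exists_pow_smul_inf_satSubmodule_eq_bot (M : Type*) [AddCommGroup M] [Module A M]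
    [Module.Finite A M] {I L : Ideal A} (hL : L ≤ I) :
    ∃ k : ℕ, L ^ k • (⊤ : Submodule A M) ⊓ satSubmodule A M I = ⊥ := by
  obtain ⟨k, hk⟩ := exists_satSubmodule_eq (M := M) I
  obtain ⟨c, hc⟩ := L.exists_pow_inf_eq_pow_smul (satSubmodule A M I)
  refine ⟨k + c, ?_⟩
  rw [hc _ (Nat.le_add_left c k), Nat.add_sub_cancel, eq_bot_iff, smul_le]
  intro a ha x hx
  exact (mem_bot A).mpr ((hk x).mp hx.2 a (Ideal.pow_right_mono hL k ha))

variable {ι : Type*} [Fintype ι] [DecidableEq ι] [IsLocalRing A]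

theorem ringKrullDim_quotient_satSubmodule_le {I K : Ideal A}
    (hK : ∀ P : Ideal A, P.IsPrime → P ≠ maximalIdeal A → K ≤ P → I ≤ P) {e : ℕ}
    (hd : ringKrullDim (A ⧸ (Module.annihilator A ↥(K • (⊤ : Submodule A M)))) ≤ e) :
    ringKrullDim (A ⧸ Module.annihilator A (M ⧸ satSubmodule A M I)) ≤ e := by
  refine ringKrullDim_quotient_le_of_forall_length_le fun l hl => ?_
  by_cases hl0 : l.length = 0
  · omega
  obtain ⟨P, hP, hPl⟩ := Ideal.exists_minimalPrimes_le hl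
  obtain ⟨hPp, v, hv⟩ := isAssociatedPrime_iff.mp
    (Module.associatedPrimes.minimalPrimes_annihilator_subset_associatedPrimes A _ hP)
  obtain ⟨x, rfl⟩ := mkQ_surjective _ v
  have hxP : ∀ a, a ∈ P ↔ a • x ∈ satSubmodule A M I := fun a => by
    rw [hv, mem_colon_singleton, mem_bot, ← map_smul, mkQ_apply, Quotient.mk_eq_zero]
  have hIP : ¬ I ≤ P := fun h => hPp.ne_top <| (Ideal.eq_top_iff_one _).mpr <| by
    rw [hxP, one_smul]
    exact mem_satSubmodule_of_forall_smul_mem fun a ha => (hxP a).mp (h ha)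
  have hPm : P ≠ maximalIdeal A := by
    rintro rfl
    have h1 : l.head < l 1 := l.head_lt_one hl0
    exact absurd ((le_maximalIdeal (l 1).2.ne_top).trans hPl) (not_le_of_gt h1)
  have hKP : ¬ K ≤ P := fun h => hIP (hK P hPp hPm h)
  obtain ⟨b, hb, hbP⟩ := Set.not_subset.mp hKP
  refine Nat.cast_le (α := WithBot ℕ∞) |>.mp ((l.length_le_ringKrullDim_quotient (K :=
    Module.annihilator A ↥(K • (⊤ : Submodule A M))) (le_trans (fun a ha => ?_) hPl)).trans hd)
  refine (hPp.mem_or_mem (y := b) ?_).resolve_right hbP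
  rw [hxP, mul_smul]
  have := congrArg Subtype.val
    (Module.mem_annihilator.mp ha ⟨b • x, smul_mem_smul hb mem_top⟩)
  rw [show a • b • x = 0 from this]
  exact zero_mem _

theorem exists_polynomial_of_filtrations (G : ι → ℕ → Ideal A) (J : ι → Ideal A) (o : ι) (N₀ : ℕ)
    (hpow : ∀ i n, G i 1 ^ n ≤ G i n) (hJ : ∀ i, J i ≤ G i 1)
    (hJG : ∀ i, ∀ n ≥ N₀, G i (n + 1) = J i * G i n) (ho : (G o 1).radical = maximalIdeal A)
    (q : ℕ) (hq : (q : WithBot ℕ∞) = ringKrullDim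
      (A ⧸ Module.annihilator A (M ⧸ satSubmodule A M (∏ i ∈ Finset.univ.erase o, G i 1)))) :
    ∃ P : MvPolynomial ι ℚ, P.totalDegree = q - 1 ∧ ∃ N : ℕ, ∀ n : ι → ℕ, (∀ i, N ≤ n i) →
      ∃ l : ℕ, relLength ((∏ i, G i (n i)) • (⊤ : Submodule A M))
          ((∏ i, G i ((n + Pi.single o 1 : ι → ℕ) i)) • ⊤) = l ∧
        (l : ℚ) = MvPolynomial.eval (fun i => (n i : ℚ)) P := by
  set I := ∏ i ∈ Finset.univ.erase o, G i 1 with hI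
  have hGJ : ∀ i, G i 1 ^ (N₀ + 1) ≤ J i := fun i =>
    (hpow i _).trans ((hJG i N₀ le_rfl).trans_le Ideal.mul_le_left)
  obtain ⟨e, he⟩ : ∃ e, maximalIdeal A ^ e ≤ J o := by
    obtain ⟨e, he⟩ := (G o 1).exists_radical_pow_le_of_fg (IsNoetherian.noetherian _)
    refine ⟨e * (N₀ + 1), ?_⟩
    rw [pow_mul, ← ho]
    exact (Ideal.pow_right_mono he _).trans (hGJ o)
  have hom : J o ≤ maximalIdeal A := (hJ o).trans (ho ▸ Ideal.le_radical)
  have hadd : ∀ i, ∀ n ≥ N₀, ∀ a, G i (a + n) = J i ^ a * G i n := fun i n hn a => by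
    induction a with
    | zero => simp
    | succ a ih =>
      rw [add_right_comm, hJG i _ (by omega), ih, pow_succ', mul_assoc]
  set L := ∏ i ∈ Finset.univ.erase o, J i with hL
  obtain ⟨k, hk⟩ := exists_pow_smul_inf_satSubmodule_eq_bot M
    (Finset.prod_le_prod' fun i _ => hJ i : L ≤ I)
  set N := k + N₀ with hN
  set K := ∏ i, G i N with hK
  set X := K • (⊤ : Submodule A M) with hX
  have hKL : K ≤ L ^ k := by
    rw [hK, ← Finset.mul_prod_erase _ _ (Finset.mem_univ o), hL, ← Finset.prod_pow]
    refine Ideal.mul_le_right.trans (Finset.prod_le_prod' fun i _ => ?_)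
    rw [hN, hadd i N₀ le_rfl]
    exact Ideal.mul_le_left
  have hprod : ∀ a : ι → ℕ, ∏ i, G i ((a + fun _ => N : ι → ℕ) i) = powProd J a * K := fun a => by
    rw [hK, powProd, ← Finset.prod_mul_distrib]
    exact Finset.prod_congr rfl fun i _ => hadd i N (by omega) (a i)
  have hXT : X ⊓ satSubmodule A M I = ⊥ :=
    eq_bot_iff.mpr (hk ▸ inf_le_inf_right _ (smul_mono_left hKL))
  have hdim : ringKrullDim (A ⧸ Module.annihilator A X) ≤ q := by
    rw [hq]
    refine ringKrullDim_le_of_surjective (Ideal.Quotient.factor (S := Module.annihilator A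
      (M ⧸ satSubmodule A M I)) (T := Module.annihilator A X) fun a ha => ?_)
      (Ideal.Quotient.factor_surjective _)
    refine Module.mem_annihilator.mpr fun x => Subtype.ext ?_
    rw [coe_zero, ← mem_bot A, ← hXT]
    refine ⟨(a • x).2, ?_⟩
    refine (Quotient.mk_eq_zero _).mp ?_
    exact Module.mem_annihilator.mp ha (Submodule.Quotient.mk (x : M))
  obtain ⟨P, N', hP⟩ := eventuallyPoly_relLength_powProd (M := X) he
  have hdeg := totalDegree_le_of_relLength_powProd he hP hdim
  have hmap : ∀ H : Ideal A, Submodule.map X.subtype (H • ⊤) = (H * K) • ⊤ := fun H => by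
    rw [map_smul'', Submodule.map_top, range_subtype, hX, ← smul_assoc, smul_eq_mul]
  have hdeg' : q ≤ P.totalDegree + 1 := by
    have h1 := ringKrullDim_le_of_relLength_powProd he hom hP (n := fun _ => N') fun _ => le_rfl
    rw [← Nat.cast_le (α := WithBot ℕ∞), hq]
    set H := powProd J fun _ => N' with hH
    refine ringKrullDim_quotient_satSubmodule_le (K := H * K) (fun Q hQ hQm hle => ?_) ?_
    · have hcase : ∃ i, G i 1 ≤ Q := by
        rcases hQ.mul_le.mp hle with h | h
        · obtain ⟨i, -, hi⟩ := (hQ.prod_le).mp h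
          exact ⟨i, hQ.le_of_pow_le ((hGJ i).trans (hQ.le_of_pow_le hi))⟩
        · obtain ⟨i, -, hi⟩ := (hQ.prod_le).mp h
          exact ⟨i, hQ.le_of_pow_le ((hpow i N).trans hi)⟩
      obtain ⟨i, hi⟩ := hcase
      by_cases hio : i = o
      · subst hio
        refine absurd (le_antisymm (le_maximalIdeal hQ.ne_top) ?_) hQm
        rw [← ho]
        exact hQ.radical_le_iff.mpr hi
      · exact (Ideal.prod_le_inf.trans (Finset.inf_le (Finset.mem_erase.mpr
          ⟨hio, Finset.mem_univ i⟩))).trans hi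
    · rw [← hmap]
      rwa [← (equivMapOfInjective X.subtype X.injective_subtype (H • ⊤)).annihilator_eq]
  obtain ⟨P', hP'd, hP'⟩ := MvPolynomial.exists_eval_add_eq P fun _ => N
  refine ⟨P', by omega, N' + N, fun n hn => ?_⟩
  obtain ⟨a, rfl⟩ : ∃ a : ι → ℕ, n = a + fun _ => N :=
    ⟨fun i => n i - N, funext fun i => by have := hn i; simp; omega⟩
  have ha : ∀ i, N' ≤ a i := fun i => by simpa using hn i
  refine ⟨(relLength (powProd J a • (⊤ : Submodule A X)) (J o • powProd J a • ⊤)).toNat, ?_, ?_⟩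
  · rw [ENat.natCast_toNat (relLength_ne_top_of_pow_maximalIdeal_le he le_rfl), add_right_comm,
      hprod, hprod, powProd_smul_eq, ← relLength_map X.injective_subtype, hmap, hmap]
  · exact (hP a ha).trans (hP' a).symm

end

/-- The Bhattacharya function
`B(n₀, 𝐧) = ℓ_A((F)_{n₀}(F₁)_{n₁}⋯(F_s)_{n_s}M / (F)_{n₀+1}(F₁)_{n₁}⋯(F_s)_{n_s}M)`
of an `𝔪`-primary good filtration `F` and good filtrations `F₁, …, F_s` with
`I = (F₁)₁⋯(F_s)₁ ⊄ √(Ann M)` agrees, for all large `n₀, 𝐧`, with a polynomial of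
total degree `q - 1`, where `q = dim M/(0_M : I^∞)`. -/
theorem bhattacharya_polynomial {A : Type*} [CommRing A] [IsNoetherianRing A] [IsLocalRing A]
    {M : Type*} [AddCommGroup M] [Module A M] [Module.Finite A M]
    {s : ℕ} (F : ℕ → Ideal A) (Fs : Fin s → ℕ → Ideal A)
    (hF0 : F 0 = ⊤) (hanti : Antitone F) (hmul : ∀ m n : ℕ, F m * F n ≤ F (m + n))
    (hgood : ∃ J : Ideal A, (∀ n : ℕ, J * F n ≤ F (n + 1)) ∧
      ∃ N : ℕ, ∀ n ≥ N, F (n + 1) = J * F n)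
    (hprim : (F 1).radical = IsLocalRing.maximalIdeal A ∧ F 1 ≠ ⊤)
    (hFs0 : ∀ i, Fs i 0 = ⊤) (hFsanti : ∀ i, Antitone (Fs i))
    (hFsmul : ∀ i, ∀ m n : ℕ, Fs i m * Fs i n ≤ Fs i (m + n))
    (hFsgood : ∀ i, ∃ J : Ideal A, (∀ n : ℕ, J * Fs i n ≤ Fs i (n + 1)) ∧
      ∃ N : ℕ, ∀ n ≥ N, Fs i (n + 1) = J * Fs i n)
    (hI : ¬ (∏ i, Fs i 1) ≤ (Module.annihilator A M).radical)
    (q : ℕ) (hq : (q : WithBot ℕ∞) = ringKrullDim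
      (A ⧸ Module.annihilator A (M ⧸ satSubmodule A M (∏ i, Fs i 1)))) :
    ∃ P : MvPolynomial (Fin (s + 1)) ℚ, P.totalDegree = q - 1 ∧
      ∃ N : ℕ, ∀ n : Fin (s + 1) → ℕ, (∀ i, N ≤ n i) →
        ∃ l : ℕ,
          ModuleLengthIs A
            (↥((F (n 0) * ∏ i : Fin s, Fs i (n i.succ)) • (⊤ : Submodule A M)) ⧸
              Submodule.comap
                ((F (n 0) * ∏ i : Fin s, Fs i (n i.succ)) • (⊤ : Submodule A M)).subtype
                ((F (n 0 + 1) * ∏ i : Fin s, Fs i (n i.succ)) • (⊤ : Submodule A M))) l ∧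
          (l : ℚ) = MvPolynomial.eval (fun i => (n i : ℚ)) P := by
  classical
  set G : Fin (s + 1) → ℕ → Ideal A := Fin.cons F Fs with hG
  have hG0 : ∀ i, G i 0 = ⊤ := Fin.cases hF0 hFs0
  have hGmul : ∀ i, ∀ m n : ℕ, G i m * G i n ≤ G i (m + n) := Fin.cases hmul hFsmul
  have hGgood : ∀ i, ∃ J : Ideal A, (∀ n : ℕ, J * G i n ≤ G i (n + 1)) ∧
      ∃ N : ℕ, ∀ n ≥ N, G i (n + 1) = J * G i n := Fin.cases hgood hFsgood
  choose J hJ N hN using hGgood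
  have hpow : ∀ i n, G i 1 ^ n ≤ G i n := fun i n => by
    induction n with
    | zero => simp [hG0]
    | succ n ih => exact (Ideal.mul_mono_left ih).trans (hGmul i n 1)
  have hJ1 : ∀ i, J i ≤ G i 1 := fun i => by simpa [hG0] using hJ i 0
  have herase : ∏ i ∈ Finset.univ.erase 0, G i 1 = ∏ i, Fs i 1 := by
    simp [Fin.univ_succ, hG]
  have hprod : ∀ n : Fin (s + 1) → ℕ, ∏ i, G i (n i) = F (n 0) * ∏ i : Fin s, Fs i (n i.succ) :=
    fun n => by simp [Fin.prod_univ_succ, hG]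
  obtain ⟨P, hPd, N', hP⟩ := exists_polynomial_of_filtrations (M := M) G J 0
    (Finset.univ.sup N) hpow hJ1
    (fun i n hn => hN i n ((Finset.le_sup (Finset.mem_univ i)).trans hn)) hprim.1 q
    (by rw [herase]; exact hq)
  refine ⟨P, hPd, N', fun n hn => ?_⟩
  obtain ⟨l, hl, hlP⟩ := hP n hn
  refine ⟨l, moduleLengthIs_of_length_eq ?_, hlP⟩
  have h0 : (n + Pi.single 0 1 : Fin (s + 1) → ℕ) 0 = n 0 + 1 := by simp
  have hsucc : ∀ i : Fin s, (n + Pi.single 0 1 : Fin (s + 1) → ℕ) i.succ = n i.succ := fun i => by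
    simp [Fin.succ_ne_zero]
  rw [hprod, hprod, h0] at hl
  simp only [hsucc] at hl
  exact hl
end

section
/- Let $(A,\mathfrak m)$ be a Noetherian local ring, $M$ a finitely generated $A$-module, $F$ an $\mathfrak m$-primary good filtration and $F_1,\dots,F_s$ good filtrations such that $I = (F_1)_1\cdots(F_s)_1 \not\subseteq \sqrt{\mathrm{Ann}\,M}$. Let $J, I_1, \dots, I_s$ be reductions of $F, F_1, \dots, F_s$ respectively. Then for all $(k_0, \mathbf k)$ with $k_0 + |\mathbf k| = \dim M/(0_M:I^\infty) - 1$, the mixed multiplicities agree: $e(F^{[k_0+1]}, F_1^{[k_1]},\dots,F_s^{[k_s]}; M) = e(J^{[k_0+1]}, I_1^{[k_1]},\dots,I_s^{[k_s]}; M)$. -/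
/-- `IsBhattacharyaPoly A M G Gs P` : the polynomial `P` agrees, for all large `n₀, 𝐧`,
with the Bhattacharya function
`(n₀, 𝐧) ↦ ℓ_A(G_{n₀}(G₁)_{n₁}⋯(G_s)_{n_s}M / G_{n₀+1}(G₁)_{n₁}⋯(G_s)_{n_s}M)`
of the families of ideals `G, G₁, …, G_s`. -/
def IsBhattacharyaPoly (A : Type*) [CommRing A] (M : Type*) [AddCommGroup M] [Module A M]
    {s : ℕ} (G : ℕ → Ideal A) (Gs : Fin s → ℕ → Ideal A)
    (P : MvPolynomial (Fin (s + 1)) ℚ) : Prop :=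
  ∃ N : ℕ, ∀ n : Fin (s + 1) → ℕ, (∀ i, N ≤ n i) →
    ∃ l : ℕ,
      ModuleLengthIs A
        (↥((G (n 0) * ∏ i : Fin s, Gs i (n i.succ)) • (⊤ : Submodule A M)) ⧸
          Submodule.comap
            ((G (n 0) * ∏ i : Fin s, Gs i (n i.succ)) • (⊤ : Submodule A M)).subtype
            ((G (n 0 + 1) * ∏ i : Fin s, Gs i (n i.succ)) • (⊤ : Submodule A M))) l ∧
      (l : ℚ) = MvPolynomial.eval (fun i => (n i : ℚ)) P

/-- The Artin–Rees lemma for a pair of submodules, the larger of which is finitely generated. -/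
theorem exists_pow_smul_inf_le {R E : Type*} [CommRing R] [IsNoetherianRing R] [AddCommGroup E]
    [Module R E] (I : Ideal R) {X Y : Submodule R E} (hX : X.FG) (hYX : Y ≤ X) :
    ∃ k : ℕ, ∀ n, (I ^ (n + k) • X) ⊓ Y ≤ I ^ n • Y := by
  have : Module.Finite R X := Module.Finite.iff_fg.2 hX
  obtain ⟨k, hk⟩ := I.exists_pow_inf_eq_pow_smul (Y.comap X.subtype)
  refine ⟨k, fun n => ?_⟩
  have h1 := hk (n + k) (Nat.le_add_left _ _)
  rw [Nat.add_sub_cancel] at h1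
  have h2 : I ^ (n + k) • (⊤ : Submodule R X) ⊓ Y.comap X.subtype
      ≤ I ^ n • (Y.comap X.subtype) :=
    h1.le.trans (Submodule.smul_mono le_rfl inf_le_right)
  have h3 := Submodule.map_mono (f := X.subtype) h2
  rw [Submodule.map_smul'', Submodule.map_inf _ X.injective_subtype, Submodule.map_smul'',
    Submodule.map_top, Submodule.range_subtype, Submodule.map_comap_subtype,
    inf_eq_right.2 hYX] at h3
  exact h3

namespace Ideal

variable {A M : Type*} [CommRing A] [AddCommGroup M] [Module A M]

theorem single_mem_map_smul (J K : Ideal A) (X : Submodule A M) (n : ℕ) {y : M}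
    (hy : y ∈ J • (K ^ n • X)) :
    PolynomialModule.single A n y ∈
      J.map (algebraMap A (reesAlgebra K)) • (K.stableFiltration X).submodule := by
  induction hy using Submodule.smul_induction_on' with
  | smul r hr z hz =>
    have : PolynomialModule.single A n (r • z) =
        algebraMap A (reesAlgebra K) r • PolynomialModule.single A n z := by
      rw [algebraMap_smul]
      exact PolynomialModule.single_smul ..
    rw [this]
    refine Submodule.smul_mem_smul (Ideal.mem_map_of_mem _ hr) fun i => ?_
    rw [PolynomialModule.coeff_single, Finsupp.single_apply]
    split_ifs with h
    · subst h; exact hz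
    · exact zero_mem _
  | add x hx y hy h1 h2 =>
    rw [PolynomialModule.single_add]
    exact add_mem h1 h2

theorem map_smul_submodule_le (J K : Ideal A) (Y : Submodule A M) :
    J.map (algebraMap A (reesAlgebra K)) • (K.stableFiltration Y).submodule ≤
      (K.stableFiltration (J • Y)).submodule := by
  rw [Submodule.smul_le]
  intro r hr p hp
  refine Submodule.span_induction (p := fun r _ => r • p ∈ (K.stableFiltration (J • Y)).submodule)
    ?_ (by simp) (fun a b _ _ ha hb => by rw [add_smul]; exact add_mem ha hb)
    (fun a b _ hb => by rw [smul_eq_mul, mul_smul]; exact Submodule.smul_mem _ _ hb) hr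
  rintro _ ⟨a, ha, rfl⟩ i
  rw [algebraMap_smul]
  change a • p.coeff i ∈ K ^ i • J • Y
  rw [← mul_smul, mul_comm, mul_smul]
  exact Submodule.smul_mem_smul ha (hp i)

/-- Artin–Rees, uniformly along the powers of a second ideal `K`. -/
theorem exists_pow_smul_inf_le_uniform [IsNoetherianRing A] [Module.Finite A M] (J K : Ideal A)
    {X Y : Submodule A M} (hYX : Y ≤ X) :
    ∃ k : ℕ, ∀ b n, (J ^ (b + k) • (K ^ n • X)) ⊓ (K ^ n • Y) ≤ J ^ b • (K ^ n • Y) := by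
  have hfg : (K.stableFiltration X).submodule.FG :=
    ((K.stableFiltration X).submodule_fg_iff_stable fun i => IsNoetherian.noetherian _).2
      (K.stableFiltration_stable X)
  obtain ⟨k, hk⟩ := exists_pow_smul_inf_le (J.map (algebraMap A (reesAlgebra K))) hfg
    (Y := (K.stableFiltration Y).submodule) fun p hp i => Submodule.smul_mono le_rfl hYX (hp i)
  refine ⟨k, fun b n y hy => ?_⟩
  have h1 := hk b (x := PolynomialModule.single A n y) ⟨?_, ?_⟩
  · rw [← Ideal.map_pow] at h1
    have h2 := map_smul_submodule_le _ _ _ h1 n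
    rw [PolynomialModule.coeff_single, Finsupp.single_eq_same] at h2
    change y ∈ K ^ n • J ^ b • Y at h2
    rwa [← mul_smul, mul_comm, mul_smul] at h2
  · rw [← Ideal.map_pow]
    exact single_mem_map_smul _ _ _ _ hy.1
  · intro i
    rw [PolynomialModule.coeff_single, Finsupp.single_apply]
    split_ifs with h
    · subst h; exact hy.2
    · exact zero_mem _

end Ideal

/-- The length of `X / (X ∩ Y)`. -/
noncomputable def relLength {A M : Type*} [CommRing A] [AddCommGroup M] [Module A M]
    (X Y : Submodule A M) : ℕ∞ :=
  Module.length A (X ⧸ Y.comap X.subtype)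

section relLength

variable {A M : Type*} [CommRing A] [AddCommGroup M] [Module A M] {X Y Z : Submodule A M}

theorem relLength_anti (X : Submodule A M) (h : Y ≤ Z) : relLength X Z ≤ relLength X Y :=
  Module.length_le_of_surjective (Submodule.factor (Submodule.comap_mono h))
    (Submodule.factor_surjective _)

theorem comap_subtype_eq_comap_inclusion (Z : Submodule A M) (h : Y ≤ X) :
    Z.comap Y.subtype = (Z.comap X.subtype).comap (Submodule.inclusion h) :=
  rfl

theorem mapQ_inclusion_injective (Z : Submodule A M) (h : Y ≤ X) :
    Function.Injective (Submodule.mapQ (Z.comap Y.subtype) (Z.comap X.subtype)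
      (Submodule.inclusion h) (comap_subtype_eq_comap_inclusion Z h).le) := by
  rw [← LinearMap.ker_eq_bot, Submodule.ker_mapQ, ← comap_subtype_eq_comap_inclusion]
  exact Submodule.mkQ_map_self _

theorem relLength_mono_left (Z : Submodule A M) (h : Y ≤ X) : relLength Y Z ≤ relLength X Z :=
  Module.length_le_of_injective _ (mapQ_inclusion_injective Z h)

theorem relLength_inf (X Y : Submodule A M) : relLength X (X ⊓ Y) = relLength X Y := by
  unfold relLength
  rw [Submodule.comap_inf, Submodule.comap_subtype_self, top_inf_eq]

theorem relLength_add (hZY : Z ≤ Y) (hYX : Y ≤ X) :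
    relLength X Z = relLength X Y + relLength Y Z := by
  rw [add_comm]
  refine Module.length_eq_add_of_exact _ (Submodule.factor (Submodule.comap_mono hZY))
    (mapQ_inclusion_injective Z hYX) (Submodule.factor_surjective _) ?_
  rw [LinearMap.exact_iff, Submodule.range_mapQ, Submodule.range_inclusion]
  exact Submodule.ker_mapQ ..

theorem relLength_map {N : Type*} [AddCommGroup N] [Module A N] (f : M →ₗ[A] N)
    (hf : Set.InjOn f X) (hYX : Y ≤ X) : relLength (X.map f) (Y.map f) = relLength X Y := by
  have hinj : Function.Injective (f.domRestrict X) := by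
    intro a b h; exact Subtype.ext (hf a.2 b.2 h)
  let e : X ≃ₗ[A] X.map f :=
    (LinearEquiv.ofInjective _ hinj).trans (LinearEquiv.ofEq _ _ (by simp [LinearMap.range_domRestrict]))
  refine (LinearEquiv.length_eq (Submodule.Quotient.equiv _ _ e ?_)).symm
  ext ⟨z, hz⟩
  constructor
  · rintro ⟨a, ha, h⟩
    exact ⟨a, ha, congrArg Subtype.val h⟩
  · rintro ⟨a, ha, h⟩
    exact ⟨⟨a, hYX ha⟩, ha, Subtype.ext h⟩

end relLength

theorem exists_relLength_le {A M : Type*} [CommRing A] [AddCommGroup M] [Module A M]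
    [IsNoetherianRing A] [Module.Finite A M] (J K : Ideal A)
    {X Y : Submodule A M} (hYX : Y ≤ X) :
    ∃ k : ℕ, ∀ b n, relLength (K ^ n • Y) (J ^ b • (K ^ n • Y)) ≤
      relLength (K ^ n • X) (J ^ (b + k) • (K ^ n • X)) := by
  obtain ⟨k, hk⟩ := Ideal.exists_pow_smul_inf_le_uniform J K hYX
  refine ⟨k, fun b n => ?_⟩
  calc _ ≤ relLength (K ^ n • Y) ((K ^ n • Y) ⊓ (J ^ (b + k) • (K ^ n • X))) :=
        relLength_anti _ (by rw [inf_comm]; exact hk b n)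
    _ = relLength (K ^ n • Y) (J ^ (b + k) • (K ^ n • X)) := relLength_inf _ _
    _ ≤ _ := relLength_mono_left _ (Submodule.smul_mono le_rfl hYX)

/-- If `x X ⊆ Y ⊆ X` with `x` regular on `X`, then `X` and `Y` have the same asymptotic lengths,
up to a bounded shift. -/
theorem exists_relLength_le_of_regular {A M : Type*} [CommRing A] [AddCommGroup M] [Module A M]
    [IsNoetherianRing A] [Module.Finite A M] (J K : Ideal A)
    {X Y : Submodule A M} {x : A} (hx : ∀ m ∈ X, x • m = 0 → m = 0) (hxY : ∀ m ∈ X, x • m ∈ Y) :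
    ∃ k : ℕ, ∀ b n, relLength (K ^ n • X) (J ^ b • (K ^ n • X)) ≤
      relLength (K ^ n • Y) (J ^ (b + k) • (K ^ n • Y)) := by
  have hle : X.map (LinearMap.lsmul A M x) ≤ Y := by
    rintro _ ⟨m, hm, rfl⟩; exact hxY m hm
  obtain ⟨k, hk⟩ := exists_relLength_le J K hle
  refine ⟨k, fun b n => ?_⟩
  refine le_trans (le_of_eq ?_) (hk b n)
  rw [← Submodule.map_smul'', ← Submodule.map_smul'', relLength_map _ _ Submodule.smul_le_right]
  intro a ha b hb h
  have hs : K ^ n • X ≤ X := Submodule.smul_le_right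
  refine sub_eq_zero.1 (hx _ (sub_mem (hs ha) (hs hb)) ?_)
  rw [smul_sub]; exact sub_eq_zero.2 h

namespace MvPolynomial

open Filter

variable {σ : Type*}

/-- All monomials of `P` have degree `< d`; in particular `DegreeBelow P 0` means `P = 0`. -/
def DegreeBelow (P : MvPolynomial σ ℚ) (d : ℕ) : Prop :=
  ∀ k : σ →₀ ℕ, d ≤ k.degree → coeff k P = 0

namespace DegreeBelow

variable {P Q : MvPolynomial σ ℚ} {d e : ℕ}

theorem mono (h : DegreeBelow P d) (hde : d ≤ e) : DegreeBelow P e :=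
  fun k hk => h k (hde.trans hk)

theorem add (hP : DegreeBelow P d) (hQ : DegreeBelow Q d) : DegreeBelow (P + Q) d := by
  intro k hk; rw [coeff_add, hP k hk, hQ k hk, add_zero]

theorem sub (hP : DegreeBelow P d) (hQ : DegreeBelow Q d) : DegreeBelow (P - Q) d := by
  intro k hk; rw [coeff_sub, hP k hk, hQ k hk, sub_zero]

theorem C_mul (c : ℚ) (hP : DegreeBelow P d) : DegreeBelow (C c * P) d := by
  intro k hk; rw [coeff_C_mul, hP k hk, mul_zero]

theorem sum {ι : Type*} (s : Finset ι) {f : ι → MvPolynomial σ ℚ}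
    (h : ∀ i ∈ s, DegreeBelow (f i) d) : DegreeBelow (∑ i ∈ s, f i) d := by
  intro k hk
  rw [coeff_sum]
  exact Finset.sum_eq_zero fun i hi => h i hi k hk

theorem X_mul (i : σ) (hP : DegreeBelow P d) : DegreeBelow (X i * P) (d + 1) := by
  classical
  intro k hk
  rw [coeff_X_mul']
  split_ifs with h
  · refine hP _ ?_
    have h1 : (k - Finsupp.single i 1) + Finsupp.single i 1 = k := by
      refine tsub_add_cancel_of_le (Finsupp.single_le_iff.2 ?_)
      exact Nat.one_le_iff_ne_zero.2 (Finsupp.mem_support_iff.1 h)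
    rw [← h1, map_add, Finsupp.degree_single] at hk
    omega
  · rfl

theorem monomial_one (k : σ →₀ ℕ) : DegreeBelow (monomial k (1 : ℚ)) (k.degree + 1) := by
  classical
  intro l hl
  rw [coeff_monomial, if_neg]
  rintro rfl
  omega

end DegreeBelow


theorem eval_aeval {τ : Type*} (x : τ → ℚ) (f : σ → MvPolynomial τ ℚ) (P : MvPolynomial σ ℚ) :
    eval x (aeval f P) = eval (fun i => eval x (f i)) P := by
  induction P using MvPolynomial.induction_on with
  | C a => simp only [aeval_C, algebraMap_eq, eval_C]
  | add p q hp hq => simp only [map_add, hp, hq]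
  | mul_X p i hp => simp only [map_mul, aeval_X, eval_X, hp]

/-- Translation of the variables of a polynomial. -/
noncomputable def translate (c : σ → ℚ) : MvPolynomial σ ℚ →ₐ[ℚ] MvPolynomial σ ℚ :=
  aeval (fun i => X i + C (c i))

theorem eval_translate (c x : σ → ℚ) (P : MvPolynomial σ ℚ) :
    eval x (translate c P) = eval (fun i => x i + c i) P := by
  rw [translate, eval_aeval]; simp

theorem degreeBelow_translate_monomial_sub (c : σ → ℚ) (k : σ →₀ ℕ) :
    DegreeBelow (translate c (monomial k 1) - monomial k 1) k.degree := by
  classical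
  obtain ⟨n, hn⟩ : ∃ n, k.degree = n := ⟨_, rfl⟩
  induction n generalizing k with
  | zero =>
    obtain rfl : k = 0 := (Finsupp.degree_eq_zero_iff k).1 hn
    intro l _
    simp [translate]
  | succ n ih =>
    obtain ⟨i, hi⟩ : ∃ i, k i ≠ 0 := by
      by_contra! h
      have : k = 0 := Finsupp.ext h
      simp [this] at hn
    have h1 : Finsupp.single i 1 + (k - Finsupp.single i 1) = k :=
      add_tsub_cancel_of_le (Finsupp.single_le_iff.2 (Nat.one_le_iff_ne_zero.2 hi))
    set l := k - Finsupp.single i 1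
    have hl : l.degree = n := by
      rw [← h1, map_add, Finsupp.degree_single] at hn
      omega
    have h2 : monomial k (1 : ℚ) = X i * monomial l 1 := by
      rw [X, monomial_mul, one_mul, h1]
    have h3 : translate c (X i) = X i + C (c i) := by rw [translate, aeval_X]
    have h4 : translate c (monomial k 1) - monomial k 1 =
        X i * (translate c (monomial l 1) - monomial l 1) + C (c i) * monomial l 1 +
          C (c i) * (translate c (monomial l 1) - monomial l 1) := by
      rw [h2, map_mul, h3]; ring
    have h5 := ih l hl
    rw [h4, hn]
    rw [hl] at h5
    have h6 := DegreeBelow.monomial_one l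
    rw [hl] at h6
    exact ((h5.X_mul i).add (h6.C_mul _)).add ((h5.mono n.le_succ).C_mul _)

theorem DegreeBelow.translate_sub {P : MvPolynomial σ ℚ} {d : ℕ} (c : σ → ℚ)
    (h : DegreeBelow P (d + 1)) : DegreeBelow (translate c P - P) d := by
  have hP : translate c P - P =
      ∑ k ∈ P.support, C (coeff k P) * (translate c (monomial k 1) - monomial k 1) := by
    conv_lhs => rw [P.as_sum]
    rw [map_sum, ← Finset.sum_sub_distrib]
    refine Finset.sum_congr rfl fun k _ => ?_
    have : monomial k (coeff k P) = C (coeff k P) * monomial k (1 : ℚ) := by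
      rw [C_mul_monomial, mul_one]
    rw [this, map_mul, mul_sub, ← algebraMap_eq, AlgHom.commutes]
  rw [hP]
  refine DegreeBelow.sum _ fun k hk => ((degreeBelow_translate_monomial_sub c k).mono ?_).C_mul _
  by_contra hlt
  exact (mem_support_iff.1 hk) (h k (by omega))

theorem exists_antidifference [DecidableEq σ] (i : σ) (P : MvPolynomial σ ℚ) :
    ∃ G : MvPolynomial σ ℚ, translate (Pi.single i 1) G - G = P := by
  induction P using MvPolynomial.induction_on' with
  | add p q hp hq =>
    obtain ⟨G, hG⟩ := hp
    obtain ⟨H, hH⟩ := hq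
    exact ⟨G + H, by rw [map_add, ← hG, ← hH]; ring⟩
  | monomial k a =>
    refine ⟨C (1 / ((k i : ℚ) + 1)) * Polynomial.aeval (X i) (Polynomial.bernoulli (k i + 1)) *
      monomial (k.erase i) a, MvPolynomial.funext fun x => ?_⟩
    have hb := Polynomial.bernoulli_eval_one_add (k i + 1) (x i)
    have h1 : ∀ y : σ → ℚ, eval y (Polynomial.aeval (X i) (Polynomial.bernoulli (k i + 1))) =
        (Polynomial.bernoulli (k i + 1)).eval (y i) := by
      intro y
      rw [← coe_aeval_eq_eval, RingHom.coe_coe, ← Polynomial.aeval_algHom_apply, aeval_X,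
        Polynomial.coe_aeval_eq_eval]
    have h2 : eval (fun j => x j + Pi.single (M := fun _ => ℚ) i 1 j) (monomial (k.erase i) a) =
        eval x (monomial (k.erase i) a) := by
      rw [eval_monomial, eval_monomial]
      congr 1
      refine Finsupp.prod_congr fun j hj => ?_
      rw [Finsupp.support_erase, Finset.mem_erase] at hj
      rw [Pi.single_eq_of_ne hj.1, add_zero]
    have h3 : monomial k a = X i ^ k i * monomial (k.erase i) a := by
      rw [X_pow_eq_monomial, monomial_mul, one_mul, Finsupp.single_add_erase]
    have h4 : (k i : ℚ) + 1 ≠ 0 := by positivity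
    rw [map_sub, eval_translate, map_mul, map_mul, map_mul, map_mul, h1, h1, h2, eval_C, eval_C,
      Pi.single_eq_same, add_comm (x i), hb, h3, map_mul, map_pow, eval_X]
    push_cast
    field_simp
    ring

theorem natDegree_le_of_forall_abs_eval_le {p : Polynomial ℚ} {d T : ℕ} {c : ℚ}
    (h : ∀ t : ℕ, T ≤ t → |p.eval (t : ℚ)| ≤ c * (t : ℚ) ^ d) : p.natDegree ≤ d := by
  by_contra! hlt
  have hdeg : (Polynomial.X ^ d : Polynomial ℚ).degree < p.degree := by
    rw [Polynomial.degree_X_pow, Polynomial.degree_eq_natDegree (by rintro rfl; simp at hlt)]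
    exact_mod_cast hlt
  have := (Polynomial.abs_div_tendsto_atTop_atTop_of_degree_gt p _ hdeg (by simp)).comp
    (tendsto_natCast_atTop_atTop (R := ℚ))
  obtain ⟨t, h1, h2⟩ := ((this.eventually (eventually_gt_atTop c)).and
    (eventually_ge_atTop (max T 1))).exists
  have ht : (0 : ℚ) < (t : ℚ) ^ d := by
    have : 0 < t := by omega
    positivity
  simp only [Function.comp, Polynomial.eval_pow, Polynomial.eval_X, abs_div, abs_of_pos ht] at h1
  rw [lt_div_iff₀ ht] at h1
  exact absurd (h t (by omega)) (not_le.2 h1)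

theorem IsHomogeneous.eval_mul [Fintype σ] {P : MvPolynomial σ ℚ} {d : ℕ} (h : P.IsHomogeneous d)
    (t : ℚ) (v : σ → ℚ) : eval (fun i => t * v i) P = t ^ d * eval v P := by
  rw [eval_eq', eval_eq', Finset.mul_sum]
  refine Finset.sum_congr rfl fun k hk => ?_
  have : ∑ i, k i = d := by
    have := h (mem_support_iff.1 hk)
    rw [Finsupp.weight_apply, Finsupp.sum_fintype _ _ (by simp)] at this
    simpa using this
  simp_rw [mul_pow, Finset.prod_mul_distrib, Finset.prod_pow_eq_pow_sum, this]
  ring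

/-- The restriction of `P` to the ray through `v`. -/
theorem degreeBelow_of_rays [Fintype σ] {P : MvPolynomial σ ℚ} {d : ℕ}
    (h : ∀ v : σ → ℕ, (∀ i, 0 < v i) → ∃ (c : ℚ) (T : ℕ), ∀ t : ℕ, T ≤ t →
      |eval (fun i => (t : ℚ) * v i) P| ≤ c * (t : ℚ) ^ d) : DegreeBelow P (d + 1) := by
  suffices hz : ∀ j, d + 1 ≤ j → homogeneousComponent j P = 0 by
    intro k hk
    have := congrArg (coeff k) (hz _ hk)
    rwa [coeff_homogeneousComponent, if_pos rfl, coeff_zero] at this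
  intro j hj
  refine funext_set (fun _ => {x : ℚ | ∃ n : ℕ, 0 < n ∧ x = n}) (fun _ => ?_) fun x hx => ?_
  · refine Set.infinite_of_injective_forall_mem (f := fun n : ℕ => ((n + 1 : ℕ) : ℚ))
      (fun a b hab => by simpa using hab) fun n => ⟨n + 1, by omega, rfl⟩
  · choose v hv hxv using fun i => hx i (Set.mem_univ i)
    obtain rfl : x = fun i => (v i : ℚ) := _root_.funext hxv
    obtain ⟨c, T, hcT⟩ := h v hv
    let p : Polynomial ℚ := ∑ j ∈ Finset.range (P.totalDegree + 1),
      Polynomial.C (eval (fun i => (v i : ℚ)) (homogeneousComponent j P)) * Polynomial.X ^ j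
    have hp : ∀ t : ℚ, p.eval t = eval (fun i => t * v i) P := by
      intro t
      conv_rhs => rw [← sum_homogeneousComponent P]
      rw [map_sum, Polynomial.eval_finsetSum]
      refine Finset.sum_congr rfl fun j _ => ?_
      rw [(homogeneousComponent_isHomogeneous j P).eval_mul]
      simp only [Polynomial.eval_mul, Polynomial.eval_C, Polynomial.eval_pow, Polynomial.eval_X]
      ring
    have hdeg := natDegree_le_of_forall_abs_eval_le (p := p) (d := d) (T := T) (c := c)
      fun t ht => by rw [hp]; exact hcT t ht
    have hc := Polynomial.coeff_eq_zero_of_natDegree_lt (p := p) (n := j) (by omega)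
    rw [map_zero]
    by_cases hjP : j ≤ P.totalDegree
    · simpa [p, Polynomial.finsetSum_coeff, Polynomial.coeff_C_mul, Polynomial.coeff_X_pow,
        Nat.lt_succ_iff, hjP] using hc
    · rw [homogeneousComponent_eq_zero _ _ (by omega), map_zero]

theorem DegreeBelow.exists_abs_eval_le [Fintype σ] {P : MvPolynomial σ ℚ} {d : ℕ}
    (h : DegreeBelow P (d + 1)) : ∃ c : ℚ, 0 ≤ c ∧ ∀ (t : ℚ) (x : σ → ℚ), 1 ≤ t → (∀ i, |x i| ≤ t) →
      |eval x P| ≤ c * t ^ d := by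
  refine ⟨∑ k ∈ P.support, |coeff k P|, Finset.sum_nonneg fun _ _ => abs_nonneg _,
    fun t x ht hx => ?_⟩
  rw [eval_eq', Finset.sum_mul]
  refine (Finset.abs_sum_le_sum_abs _ _).trans (Finset.sum_le_sum fun k hk => ?_)
  rw [abs_mul, Finset.abs_prod]
  refine mul_le_mul_of_nonneg_left ?_ (abs_nonneg _)
  have hdeg : k.degree ≤ d := by
    by_contra hlt
    exact (mem_support_iff.1 hk) (h k (by omega))
  calc ∏ i, |x i ^ k i| ≤ ∏ i, t ^ k i := by
        refine Finset.prod_le_prod (fun _ _ => abs_nonneg _) fun i _ => ?_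
        rw [abs_pow]
        exact pow_le_pow_left₀ (abs_nonneg _) (hx i) _
    _ = t ^ k.degree := by rw [Finset.prod_pow_eq_pow_sum, Finsupp.degree_eq_sum]
    _ ≤ t ^ d := pow_le_pow_right₀ ht hdeg

/-- Summation of a polynomial in the variable `i`, starting at `N`. -/
theorem exists_sum_polynomial [DecidableEq σ] (i : σ) (N : ℕ) (P : MvPolynomial σ ℚ) :
    ∃ H : MvPolynomial σ ℚ, translate (Pi.single i 1) H - H = P ∧
      ∀ (f : ℕ → ℚ) (x : σ → ℚ), (∀ b : ℕ, N ≤ b →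
        f (b + 1) - f b = eval (Function.update x i b) P) →
        ∀ b : ℕ, N ≤ b → eval (Function.update x i b) H = f b - f N := by
  obtain ⟨G, rfl⟩ := exists_antidifference i P
  refine ⟨G - aeval (Function.update X i (C (N : ℚ))) G, MvPolynomial.funext fun x => ?_,
    fun f x hf b hb => ?_⟩
  · simp only [map_sub, eval_translate, eval_aeval]
    have : ∀ y : σ → ℚ, (fun j => eval y (Function.update X i (C (N : ℚ)) j)) =
        Function.update y i N := by
      intro y; funext j
      by_cases hj : j = i
      · subst hj; simp
      · simp [hj]
    rw [this, this]
    have h2 : Function.update (fun j => x j + Pi.single (M := fun _ => ℚ) i 1 j) i (N : ℚ) =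
        Function.update x i N := by
      funext j
      by_cases hj : j = i
      · subst hj; simp
      · simp [hj]
    rw [h2]; ring
  · have h3 : eval (Function.update x i b) (aeval (Function.update X i (C (N : ℚ))) G) =
        eval (Function.update x i N) G := by
      rw [eval_aeval]
      congr 2
      funext j
      by_cases hj : j = i
      · subst hj; simp
      · simp [hj]
    rw [map_sub, h3]
    induction b, hb using Nat.le_induction with
    | base => simp
    | succ b hb ih =>
      have h4 := hf b hb
      rw [map_sub, eval_translate] at h4
      have h5 : (fun j => Function.update x i (b : ℚ) j + Pi.single (M := fun _ => ℚ) i 1 j) =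
          Function.update x i ((b + 1 : ℕ) : ℚ) := by
        funext j
        by_cases hj : j = i
        · subst hj; simp
        · simp [hj]
      rw [h5] at h4
      have h6 := ih (by
        rw [eval_aeval]
        congr 2
        funext j
        by_cases hj : j = i
        · subst hj; simp
        · simp [hj])
      linarith

end MvPolynomial

open Polynomial in
theorem ringKrullDim_le_of_surjective_polynomial {C D : Type*} [CommRing C] [IsDomain C]
    [IsNoetherianRing C] [CommRing D] (φ : C[X] →+* D) (hφ : Function.Surjective φ) {p : C[X]}
    (hp : p ≠ 0) (hpφ : φ p = 0) : ringKrullDim D ≤ ringKrullDim C := by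
  have h1 := ringKrullDim_quotient_succ_le_of_nonZeroDivisor (mem_nonZeroDivisors_of_ne_zero hp)
  rw [Polynomial.ringKrullDim_of_isNoetherianRing] at h1
  have h2 : ringKrullDim D ≤ ringKrullDim (C[X] ⧸ Ideal.span {p}) :=
    ringKrullDim_le_of_surjective (Ideal.Quotient.lift _ φ fun a ha => by
      obtain ⟨b, rfl⟩ := Ideal.mem_span_singleton'.1 ha
      rw [map_mul, hpφ, mul_zero]) (Ideal.Quotient.lift_surjective_of_surjective _ _ hφ)
  have h3 := (add_le_add_left h2 1).trans h1
  have h4 : ringKrullDim C ≠ ⊥ := by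
    intro h
    have := ringKrullDim_nonneg_of_nontrivial (R := C)
    rw [h] at this
    exact absurd this (by decide)
  generalize ringKrullDim C = c at *
  generalize ringKrullDim D = d at *
  induction c with
  | bot => exact absurd rfl h4
  | coe c =>
    induction d with
    | bot => exact bot_le
    | coe d =>
      norm_cast at h3 ⊢
      exact (ENat.add_le_add_iff_right (by simp)).1 h3

/-- Evaluation at `z`, as a map onto `C[z]`. -/
noncomputable def Algebra.evalAdjoinSingleton (C : Type*) {E : Type*} [CommRing C] [CommRing E]
    [Algebra C E] (z : E) : Polynomial C →+* Algebra.adjoin C {z} :=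
  (Polynomial.aeval (R := C)
    (⟨z, Algebra.self_mem_adjoin_singleton C z⟩ : Algebra.adjoin C {z})).toRingHom

theorem Algebra.coe_evalAdjoinSingleton (C : Type*) {E : Type*} [CommRing C] [CommRing E]
    [Algebra C E] (z : E) (p : Polynomial C) :
    (Algebra.evalAdjoinSingleton C z p : E) = Polynomial.aeval z p :=
  (Polynomial.aeval_algHom_apply (Algebra.adjoin C {z}).val _ p).symm

theorem Algebra.evalAdjoinSingleton_surjective (C : Type*) {E : Type*} [CommRing C] [CommRing E]
    [Algebra C E] (z : E) : Function.Surjective (Algebra.evalAdjoinSingleton C z) := by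
  intro x
  obtain ⟨p, hp⟩ := Algebra.adjoin_mem_exists_aeval C z x.2
  exact ⟨p, Subtype.ext ((Algebra.coe_evalAdjoinSingleton C z p).trans hp)⟩

theorem ringKrullDim_le_of_adjoin_eq_top_of_isAlgebraic.{u} {E : Type u} [CommRing E] [IsDomain E]
    (S : Finset E) : ∀ (C : Type u) [CommRing C] [IsNoetherianRing C] [Algebra C E]
    [FaithfulSMul C E], Algebra.adjoin C (S : Set E) = ⊤ → (∀ z ∈ S, IsAlgebraic C z) →
    ringKrullDim E ≤ ringKrullDim C := by
  classical
  induction S using Finset.induction_on with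
  | empty =>
    intro C _ _ _ _ h _
    refine ringKrullDim_le_of_surjective (algebraMap C E) fun x => ?_
    have : x ∈ Algebra.adjoin C ((∅ : Finset E) : Set E) := h ▸ Algebra.mem_top
    simpa [Algebra.mem_bot] using this
  | insert z S _ ih =>
    intro C _ _ _ _ h halg
    have hz : z ∈ Algebra.adjoin C {z} := Algebra.self_mem_adjoin_singleton C z
    have : IsDomain C := (FaithfulSMul.algebraMap_injective C E).isDomain _
    obtain ⟨p, hp, hpz⟩ := halg z (Finset.mem_insert_self z S)
    have : IsNoetherianRing (Algebra.adjoin C {z}) :=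
      isNoetherianRing_of_surjective _ _ _ (Algebra.evalAdjoinSingleton_surjective C z)
    have hle : ringKrullDim (Algebra.adjoin C {z}) ≤ ringKrullDim C :=
      ringKrullDim_le_of_surjective_polynomial _
        (Algebra.evalAdjoinSingleton_surjective C z) hp
        (Subtype.ext ((Algebra.coe_evalAdjoinSingleton C z p).trans hpz))
    refine (ih (Algebra.adjoin C {z}) ?_ fun y hy => ?_).trans hle
    · rw [eq_top_iff]
      rintro x -
      have hx : x ∈ Algebra.adjoin C ((insert z S : Finset E) : Set E) := h ▸ Algebra.mem_top
      set D := Algebra.adjoin (Algebra.adjoin C {z}) (S : Set E)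
      have hD : ∀ y ∈ Algebra.adjoin C {z}, y ∈ D := fun y hy => D.algebraMap_mem ⟨y, hy⟩
      induction hx using Algebra.adjoin_induction with
      | mem y hy =>
        rw [Finset.coe_insert, Set.mem_insert_iff] at hy
        rcases hy with rfl | hy
        · exact hD _ hz
        · exact Algebra.subset_adjoin hy
      | algebraMap r => exact hD _ (Subalgebra.algebraMap_mem _ r)
      | add a b _ _ ha hb => exact add_mem ha hb
      | mul a b _ _ ha hb => exact mul_mem ha hb
    · exact (halg y (Finset.mem_insert_of_mem hy)).extendScalars
        (FaithfulSMul.algebraMap_injective C (Algebra.adjoin C {z}))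

theorem ringKrullDim_le_of_forall_minimalPrimes {R : Type*} [CommRing R] {d : WithBot ℕ∞}
    (h : ∀ p ∈ minimalPrimes R, ringKrullDim (R ⧸ p) ≤ d) : ringKrullDim R ≤ d := by
  refine iSup_le fun s => ?_
  obtain ⟨p, hp, hps⟩ := Ideal.exists_minimalPrimes_le (I := ⊥) (J := s.head.asIdeal) bot_le
  refine le_trans ?_ (h p hp)
  rw [ringKrullDim_quotient]
  let t : LTSeries (PrimeSpectrum.zeroLocus (p : Set R)) :=
    ⟨s.length, fun i => ⟨s i, fun x hx => (s.head_le i) (hps hx)⟩, s.step⟩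
  exact le_iSup (fun t : LTSeries (PrimeSpectrum.zeroLocus (p : Set R)) =>
    (t.length : WithBot ℕ∞)) t

open Polynomial in
theorem ringKrullDim_le_add_one_of_proportional {B E : Type*} [CommRing B] [IsNoetherianRing B]
    [CommRing E] [IsDomain E] [Algebra B E] (s : Finset B) (g : B → E)
    (hrel : ∀ a ∈ s, ∀ b ∈ s, algebraMap B E a * g b = algebraMap B E b * g a)
    (hzero : ∀ a ∈ s, algebraMap B E a = 0 → g a = 0)
    (hgen : Algebra.adjoin B (g '' (s : Set B)) = ⊤) :
    ringKrullDim E ≤ ringKrullDim B + 1 := by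
  classical
  let C₀ := (algebraMap B E).range
  have hC₀ : ringKrullDim C₀ ≤ ringKrullDim B :=
    ringKrullDim_le_of_surjective (algebraMap B E).rangeRestrict
      (RingHom.rangeRestrict_surjective _)
  have hgen' : ∀ D : Subring E, (∀ b : B, algebraMap B _ b ∈ D) →
      (∀ a ∈ s, g a ∈ D) → ∀ x, x ∈ D := by
    intro D hB hS x
    have : x ∈ Algebra.adjoin B (g '' (s : Set B)) := hgen ▸ Algebra.mem_top
    induction this using Algebra.adjoin_induction with
    | mem x hx => obtain ⟨a, ha, rfl⟩ := hx; exact hS a ha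
    | algebraMap r => exact hB r
    | add x y _ _ hx hy => exact D.add_mem hx hy
    | mul x y _ _ hx hy => exact D.mul_mem hx hy
  have hC₀B : ∀ (D : Subalgebra C₀ E) (b : B), algebraMap B _ b ∈ D :=
    fun D b => D.algebraMap_mem ⟨algebraMap B _ b, b, rfl⟩
  have hfaith : FaithfulSMul C₀ E :=
    (faithfulSMul_iff_algebraMap_injective C₀ E).2 Subtype.val_injective
  by_cases hall : ∀ a ∈ s, g a = 0
  · have h1 := ringKrullDim_le_of_adjoin_eq_top_of_isAlgebraic (s.image g) C₀
      (eq_top_iff.2 fun x _ => hgen' (Algebra.adjoin C₀ _).toSubring (hC₀B _)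
        (fun a ha => Algebra.subset_adjoin (Finset.mem_image_of_mem g ha)) x)
      fun z hz => by
        obtain ⟨a, ha, rfl⟩ := Finset.mem_image.1 hz
        rw [hall a ha]; exact isAlgebraic_zero
    exact h1.trans (hC₀.trans (le_add_of_nonneg_right zero_le_one))
  · push Not at hall
    obtain ⟨a, ha, hz0⟩ := hall
    let C₁ := Algebra.adjoin C₀ {g a}
    have hzC : g a ∈ C₁ := Algebra.self_mem_adjoin_singleton _ _
    have : IsNoetherianRing C₁ :=
      isNoetherianRing_of_surjective _ _ _ (Algebra.evalAdjoinSingleton_surjective C₀ (g a))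
    have h2 : ringKrullDim C₁ ≤ ringKrullDim C₀ + 1 := by
      rw [← Polynomial.ringKrullDim_of_isNoetherianRing]
      exact ringKrullDim_le_of_surjective _ (Algebra.evalAdjoinSingleton_surjective C₀ (g a))
    have hfaith₁ : FaithfulSMul C₁ E :=
      (faithfulSMul_iff_algebraMap_injective C₁ E).2 Subtype.val_injective
    refine (ringKrullDim_le_of_adjoin_eq_top_of_isAlgebraic (s.image g) C₁
      (eq_top_iff.2 fun x _ => hgen' (Algebra.adjoin C₁ _).toSubring
        (fun b => Subalgebra.algebraMap_mem _ (⟨_, hC₀B C₁ b⟩ : C₁))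
        (fun a ha => Algebra.subset_adjoin (Finset.mem_image_of_mem g ha)) x) ?_).trans
      (h2.trans (add_le_add_left hC₀ 1))
    intro y hy
    obtain ⟨b, hb, rfl⟩ := Finset.mem_image.1 hy
    have ha0 : algebraMap B E a ≠ 0 := fun h => hz0 (hzero a ha h)
    refine ⟨C (⟨_, hC₀B C₁ a⟩ : C₁) * X -
      C ((⟨_, hC₀B C₁ b⟩ : C₁) * (⟨g a, hzC⟩ : C₁)), fun h => ha0 ?_, ?_⟩
    · have := congrArg (coeff · 1) h
      simpa using congrArg Subtype.val this
    · simp only [map_sub, map_mul, aeval_C, aeval_X]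
      exact sub_eq_zero.2 (hrel a ha b hb)

open Polynomial in
theorem ringKrullDim_reesAlgebra_le {B : Type*} [CommRing B] [IsNoetherianRing B] (K : Ideal B) :
    ringKrullDim (reesAlgebra K) ≤ ringKrullDim B + 1 := by
  classical
  refine ringKrullDim_le_of_forall_minimalPrimes fun p hp => ?_
  obtain ⟨P', hP', hPp⟩ := Ideal.exists_comap_eq_of_mem_minimalPrimes_of_injective
    (f := (reesAlgebra K).val.toRingHom) Subtype.val_injective p hp
  have : p.IsPrime := hp.1.1
  let π : reesAlgebra K →ₐ[B] reesAlgebra K ⧸ p := Ideal.Quotient.mkₐ B p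
  have hπ : Function.Surjective π := Ideal.Quotient.mkₐ_surjective B p
  obtain ⟨s, hs⟩ := IsNoetherian.noetherian K
  have hsK : ∀ a ∈ s, a ∈ K := fun a ha => hs ▸ Ideal.subset_span ha
  let g₀ : B → reesAlgebra K := fun a => if ha : a ∈ K then
    ⟨monomial 1 a, reesAlgebra.monomial_mem.2 (by rwa [pow_one])⟩ else 0
  have hg₀ : ∀ a ∈ K, (g₀ a : B[X]) = monomial 1 a := fun a ha => by
    simp only [g₀]; rw [dif_pos ha]
  refine ringKrullDim_le_add_one_of_proportional s (fun a => π (g₀ a)) ?_ ?_ ?_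
  · intro a ha b hb
    simp only [← AlgHom.commutes π, ← map_mul]
    congr 1
    refine Subtype.ext ?_
    change C a * (g₀ b : B[X]) = C b * (g₀ a : B[X])
    rw [hg₀ a (hsK a ha), hg₀ b (hsK b hb), C_mul_monomial, C_mul_monomial, mul_comm]
  · intro a ha h0
    rw [← AlgHom.commutes π] at h0
    have h1 := Ideal.Quotient.eq_zero_iff_mem.1 h0
    refine Ideal.Quotient.eq_zero_iff_mem.2 ?_
    rw [← hPp, Ideal.mem_comap] at h1 ⊢
    have h2 := P'.mul_mem_right X h1
    convert h2 using 1
    change (g₀ a : B[X]) = C a * X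
    rw [C_mul_X_eq_monomial, hg₀ a (hsK a ha)]
  · have h1 : Algebra.adjoin B (g₀ '' (s : Set B)) = ⊤ := by
      rw [← (Subalgebra.map_injective (f := (reesAlgebra K).val) Subtype.val_injective).eq_iff,
        ← Algebra.adjoin_image, Algebra.map_top, Subalgebra.range_val, Set.image_image,
        Set.image_congr (f := fun a => (reesAlgebra K).val (g₀ a))
          (fun a ha => hg₀ a (hsK a ha)), ← adjoin_monomial_eq_reesAlgebra]
      rw [← Algebra.adjoin_span]
      congr 2
      rw [← hs, Submodule.map_span]
    rw [← Set.image_image (fun a => π a) g₀, Algebra.adjoin_image, h1, Algebra.map_top]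
    exact (AlgHom.range_eq_top π).2 hπ

theorem Ideal.exists_mul_pow_le_of_mem_minimalPrimes {R : Type*} [CommRing R] [IsNoetherianRing R] {𝔐 Z : Ideal R}
    (h : 𝔐 ∈ Z.minimalPrimes) : ∃ g ∉ 𝔐, ∃ k, ∀ x ∈ 𝔐 ^ k, g * x ∈ Z := by
  classical
  have h𝔐 : 𝔐.IsPrime := h.1.1
  let Z' : Ideal R :=
    { carrier := {x | ∃ g ∉ 𝔐, g * x ∈ Z}
      zero_mem' := ⟨1, 𝔐.ne_top_iff_one.1 h𝔐.ne_top, by simp⟩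
      add_mem' := by
        rintro a b ⟨g, hg, ha⟩ ⟨g', hg', hb⟩
        refine ⟨g * g', fun hmem => (h𝔐.mem_or_mem hmem).elim hg hg', ?_⟩
        have : g * g' * (a + b) = g' * (g * a) + g * (g' * b) := by ring
        rw [this]
        exact add_mem (Z.mul_mem_left _ ha) (Z.mul_mem_left _ hb)
      smul_mem' := by
        rintro c a ⟨g, hg, ha⟩
        refine ⟨g, hg, ?_⟩
        have : g * c • a = c * (g * a) := by rw [smul_eq_mul]; ring
        rw [this]
        exact Z.mul_mem_left _ ha }
  have hZ' : 𝔐 ≤ Z'.radical := by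
    intro m hm
    by_contra hmr
    let S : Submonoid R := 𝔐.primeCompl ⊔ Submonoid.powers m
    have hS : Disjoint (Z : Set R) S := by
      rw [Set.disjoint_left]
      intro z hz hzS
      obtain ⟨g, hg, x, ⟨n, rfl⟩, rfl⟩ := Submonoid.mem_sup.1 hzS
      exact hmr ⟨n, g, hg, hz⟩
    obtain ⟨p, hp, hZp, hpS⟩ := Ideal.exists_le_prime_disjoint Z S hS
    have hp𝔐 : p ≤ 𝔐 := by
      intro x hx
      by_contra hx𝔐
      exact Set.disjoint_left.1 hpS hx ((le_sup_left : 𝔐.primeCompl ≤ S) hx𝔐)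
    exact Set.disjoint_left.1 hpS (h.2 ⟨hp, hZp⟩ hp𝔐 hm)
      ((le_sup_right : Submonoid.powers m ≤ S) (Submonoid.mem_powers m))
  obtain ⟨k, hk⟩ := Ideal.exists_pow_le_of_le_radical_of_fg hZ' (IsNoetherian.noetherian _)
  obtain ⟨s, hs⟩ := IsNoetherian.noetherian (𝔐 ^ k)
  have key : ∀ t : Finset R, (∀ x ∈ t, x ∈ Z') → ∃ g ∉ 𝔐, ∀ x ∈ t, g * x ∈ Z := by
    intro t
    induction t using Finset.induction_on with
    | empty => exact fun _ => ⟨1, 𝔐.ne_top_iff_one.1 h𝔐.ne_top, by simp⟩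
    | insert x t _ ih =>
      intro ht
      obtain ⟨g, hg, hgt⟩ := ih fun y hy => ht y (Finset.mem_insert_of_mem hy)
      obtain ⟨g', hg', hx⟩ := ht x (Finset.mem_insert_self _ _)
      refine ⟨g * g', fun hmem => (h𝔐.mem_or_mem hmem).elim hg hg', fun y hy => ?_⟩
      rcases Finset.mem_insert.1 hy with rfl | hy
      · rw [mul_assoc]; exact Z.mul_mem_left _ hx
      · rw [mul_right_comm]; exact Z.mul_mem_right _ (hgt y hy)
  obtain ⟨g, hg, hgs⟩ := key s fun x hx => hk (hs ▸ Submodule.subset_span hx)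
  refine ⟨g, hg, k, fun x hx => ?_⟩
  rw [← hs] at hx
  have : Submodule.span R (s : Set R) ≤ Submodule.comap (LinearMap.mulLeft R g) Z :=
    Submodule.span_le.2 fun x hx => hgs x hx
  exact this hx

section HilbertSamuel

variable (B : Type*) {R : Type*} [CommRing B] [CommRing R] [Algebra B R]

theorem Ideal.length_quotient_anti {I I' : Ideal R} (h : I ≤ I') :
    Module.length B (R ⧸ I') ≤ Module.length B (R ⧸ I) :=
  Module.length_le_of_surjective ((Submodule.factor h).restrictScalars B)
    (Submodule.factor_surjective h)

theorem Ideal.length_quotient_top : Module.length B (R ⧸ (⊤ : Ideal R)) = 0 :=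
  have : Subsingleton (R ⧸ (⊤ : Ideal R)) := Ideal.Quotient.subsingleton_iff.2 rfl
  Module.length_eq_zero

theorem Ideal.length_quotient_le_of_mul_mem {I I' : Ideal R} {g : R}
    (h : ∀ x ∈ I', g * x ∈ I) :
    Module.length B (R ⧸ I) ≤
      Module.length B (R ⧸ I') + Module.length B (R ⧸ (I ⊔ Ideal.span {g})) := by
  let π : (R ⧸ I) →ₗ[B] (R ⧸ (I ⊔ Ideal.span {g})) :=
    (Ideal.Quotient.factorₐ B le_sup_left).toLinearMap
  have hπ : Function.Surjective π := Ideal.Quotient.factor_surjective le_sup_left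
  let f : (R ⧸ I') →ₗ[B] (R ⧸ I) :=
    (Submodule.mapQ I' I (LinearMap.mulLeft R g) fun x hx => h x hx).restrictScalars B
  have hker : LinearMap.ker π ≤ LinearMap.range f := by
    intro x hx
    obtain ⟨x, rfl⟩ := Submodule.mkQ_surjective I x
    have hx' : x ∈ I ⊔ Ideal.span {g} := (Submodule.Quotient.mk_eq_zero _).1 hx
    obtain ⟨a, ha, b, hb, rfl⟩ := Submodule.mem_sup.1 hx'
    obtain ⟨c, rfl⟩ := Ideal.mem_span_singleton.1 hb
    refine ⟨Submodule.Quotient.mk c, ?_⟩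
    refine (Submodule.Quotient.eq I).2 ?_
    change g * c - (a + g * c) ∈ I
    simpa using I.neg_mem ha
  rw [Module.length_eq_add_of_exact (LinearMap.ker π).subtype π
    (Submodule.subtype_injective _) hπ (LinearMap.exact_subtype_ker_map π)]
  refine add_le_add_left ?_ _
  exact (Module.length_le_of_injective (Submodule.inclusion hker)
    (Submodule.inclusion_injective hker)).trans
    (Module.length_le_of_surjective f.rangeRestrict f.surjective_rangeRestrict)

theorem Ideal.length_quotient_sup_span_pow_le (I : Ideal R) (y : R) (p : ℕ) :
    Module.length B (R ⧸ (I ⊔ Ideal.span {y ^ p})) ≤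
      p * Module.length B (R ⧸ (I ⊔ Ideal.span {y})) := by
  induction p with
  | zero => simp
  | succ p ih =>
    have h1 := Ideal.length_quotient_le_of_mul_mem B (I := I ⊔ Ideal.span {y ^ (p + 1)})
      (I' := I ⊔ Ideal.span {y ^ p}) (g := y) fun x hx => by
        obtain ⟨a, ha, b, hb, rfl⟩ := Submodule.mem_sup.1 hx
        obtain ⟨c, rfl⟩ := Ideal.mem_span_singleton.1 hb
        rw [mul_add]
        refine add_mem (Ideal.mem_sup_left (I.mul_mem_left _ ha)) (Ideal.mem_sup_right ?_)
        exact Ideal.mem_span_singleton.2 ⟨c, by ring⟩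
    have h2 : I ⊔ Ideal.span {y} ≤ I ⊔ Ideal.span {y ^ (p + 1)} ⊔ Ideal.span {y} :=
      sup_le (le_sup_left.trans le_sup_left) le_sup_right
    refine h1.trans ((add_le_add ih (Ideal.length_quotient_anti B h2)).trans ?_)
    push_cast
    rw [add_mul, one_mul]

theorem Ideal.length_quotient_sup_span_image_pow_le [DecidableEq R] (s : Finset R) (p : ℕ) :
    ∀ I : Ideal R, Module.length B (R ⧸ (I ⊔ Ideal.span ((fun y => y ^ p) '' (s : Set R)))) ≤
      (p ^ s.card : ℕ) * Module.length B (R ⧸ (I ⊔ Ideal.span (s : Set R))) := by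
  induction s using Finset.induction_on with
  | empty => intro I; rw [Finset.coe_empty, Set.image_empty]; simp
  | insert y s hy ih =>
    intro I
    have h1 : I ⊔ Ideal.span ((fun y => y ^ p) '' ((insert y s : Finset R) : Set R)) =
        (I ⊔ Ideal.span {y ^ p}) ⊔ Ideal.span ((fun y => y ^ p) '' (s : Set R)) := by
      rw [Finset.coe_insert, Set.image_insert_eq, Ideal.span_insert, sup_assoc]
    have h2 : I ⊔ Ideal.span ((insert y s : Finset R) : Set R) =
        (I ⊔ Ideal.span (s : Set R)) ⊔ Ideal.span {y} := by
      rw [Finset.coe_insert, Ideal.span_insert, sup_assoc, sup_comm (Ideal.span {y})]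
    rw [h1, h2, Finset.card_insert_of_notMem hy, pow_succ]
    refine (ih _).trans ?_
    rw [sup_right_comm]
    push_cast
    rw [mul_assoc]
    exact mul_le_mul_right (Ideal.length_quotient_sup_span_pow_le B _ _ _) _

theorem Ideal.length_quotient_mul_ne_top [IsNoetherianRing R] {𝔐 I : Ideal R}
    (h𝔐 : Module.length B (R ⧸ 𝔐) ≠ ⊤) (hI : Module.length B (R ⧸ I) ≠ ⊤) :
    Module.length B (R ⧸ (𝔐 * I)) ≠ ⊤ := by
  classical
  obtain ⟨s, hs⟩ := IsNoetherian.noetherian I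
  have key : ∀ t : Finset R, (∀ g ∈ t, g ∈ I) →
      Module.length B (R ⧸ (𝔐 * I)) ≤
        t.card * Module.length B (R ⧸ 𝔐) + Module.length B (R ⧸ (𝔐 * I ⊔ Ideal.span (t : Set R))) := by
    intro t
    induction t using Finset.induction_on with
    | empty =>
      intro _
      rw [Finset.coe_empty, Ideal.span_empty, sup_bot_eq]
      simp
    | insert g t hg ih =>
      intro ht
      have h1 := Ideal.length_quotient_le_of_mul_mem B (I := 𝔐 * I ⊔ Ideal.span (t : Set R))
        (I' := 𝔐) (g := g) fun x hx => Ideal.mem_sup_left (by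
          rw [mul_comm g]; exact Ideal.mul_mem_mul hx (ht g (Finset.mem_insert_self _ _)))
      refine (ih fun g hg => ht g (Finset.mem_insert_of_mem hg)).trans
        ((add_le_add_right h1 _).trans (le_of_eq ?_))
      rw [Finset.card_insert_of_notMem hg, Finset.coe_insert, Ideal.span_insert, sup_assoc,
        sup_comm (Ideal.span {g})]
      push_cast
      ring
  refine ne_top_of_le_ne_top ?_ (key s fun g hg => hs ▸ Ideal.subset_span hg)
  have : I ≤ 𝔐 * I ⊔ Ideal.span (s : Set R) := by
    conv_lhs => rw [← hs]
    exact le_sup_right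
  exact WithTop.add_ne_top.2 ⟨WithTop.mul_ne_top (ENat.natCast_ne_top _) h𝔐,
    ne_top_of_le_ne_top hI (Ideal.length_quotient_anti B this)⟩

theorem Ideal.length_quotient_pow_ne_top [IsNoetherianRing R] {𝔐 : Ideal R}
    (h𝔐 : Module.length B (R ⧸ 𝔐) ≠ ⊤) (n : ℕ) : Module.length B (R ⧸ 𝔐 ^ n) ≠ ⊤ := by
  induction n with
  | zero => rw [pow_zero, Ideal.one_eq_top, Ideal.length_quotient_top]; simp
  | succ n ih => rw [pow_succ']; exact Ideal.length_quotient_mul_ne_top B h𝔐 ih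

theorem Ideal.exists_length_quotient_pow_le [IsNoetherianRing R] (𝔐 : Ideal R) [h𝔐 : 𝔐.IsMaximal]
    (hB : Module.length B (R ⧸ 𝔐) ≠ ⊤) {h : ℕ} (hh : 𝔐.height ≤ h) :
    ∃ C : ℕ, ∀ L : ℕ, Module.length B (R ⧸ 𝔐 ^ L) ≤ (C * L ^ h : ℕ) := by
  classical
  obtain ⟨s, hs, hcard⟩ := 𝔐.exists_finset_card_eq_height_of_isNoetherianRing
  have hsh : s.card ≤ h := by rw [← hcard] at hh; exact_mod_cast hh
  obtain ⟨g, hg, k, hgk⟩ := Ideal.exists_mul_pow_le_of_mem_minimalPrimes hs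
  obtain ⟨C, hC⟩ := ENat.ne_top_iff_exists.1 (Ideal.length_quotient_pow_ne_top B hB k)
  refine ⟨C, fun L => ?_⟩
  rcases Nat.eq_zero_or_pos L with rfl | hL
  · rw [pow_zero, Ideal.one_eq_top, Ideal.length_quotient_top]; exact zero_le
  have h1 : 𝔐 ^ L ⊔ Ideal.span ((fun y => y ^ L) '' (s : Set R)) = 𝔐 ^ L := by
    refine sup_eq_left.2 (Ideal.span_le.2 ?_)
    rintro _ ⟨y, hy, rfl⟩
    exact Ideal.pow_mem_pow (hs.1.2 (Ideal.subset_span hy)) L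
  have h2 := Ideal.length_quotient_sup_span_image_pow_le B s L (𝔐 ^ L)
  rw [h1] at h2
  have h3 := Ideal.length_quotient_le_of_mul_mem B (I := 𝔐 ^ L ⊔ Ideal.span (s : Set R))
    (I' := 𝔐 ^ k) (g := g) fun x hx => Ideal.mem_sup_right (hgk x hx)
  have h4 : 𝔐 ^ L ⊔ Ideal.span (s : Set R) ⊔ Ideal.span {g} = ⊤ := by
    have : IsCoprime 𝔐 (Ideal.span {g}) := by
      rw [Ideal.isCoprime_iff_sup_eq]
      refine h𝔐.1.2 _ (lt_of_le_of_ne le_sup_left fun h => hg ?_)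
      rw [h]
      exact Ideal.mem_sup_right (Ideal.mem_span_singleton_self g)
    have := Ideal.isCoprime_iff_sup_eq.1 (this.pow_left (m := L))
    rw [eq_top_iff, ← this]
    exact sup_le (le_sup_left.trans le_sup_left) le_sup_right
  rw [h4, Ideal.length_quotient_top, add_zero, ← hC] at h3
  refine h2.trans ((mul_le_mul_right h3 _).trans ?_)
  norm_cast
  rw [mul_comm]
  exact Nat.mul_le_mul_left _ (Nat.pow_le_pow_right hL hsh)

end HilbertSamuel

section Rees

open Polynomial IsLocalRing

variable {B : Type*} [CommRing B]

/-- The ideal of the Rees algebra of `K` whose degree `n` part is `m ^ (L - n) * K ^ n`. -/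
def reesAlgebra.powIdeal (m K : Ideal B) (L : ℕ) : Ideal (reesAlgebra K) where
  carrier := {f | ∀ n, (f : B[X]).coeff n ∈ m ^ (L - n) * K ^ n}
  zero_mem' n := by simp
  add_mem' hf hg n := by
    rw [Subalgebra.coe_add, coeff_add]
    exact add_mem (hf n) (hg n)
  smul_mem' r f hf n := by
    rw [smul_eq_mul, Subalgebra.coe_mul, coeff_mul]
    refine sum_mem fun ij hij => ?_
    have hij' := Finset.HasAntidiagonal.mem_antidiagonal.1 hij
    have h1 : K ^ ij.1 * (m ^ (L - ij.2) * K ^ ij.2) ≤ m ^ (L - n) * K ^ n := by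
      rw [mul_left_comm, ← pow_add, hij']
      exact Ideal.mul_mono_left (Ideal.pow_le_pow_right (by omega))
    exact h1 (Ideal.mul_mem_mul (r.2 _) (hf _))

theorem reesAlgebra.pow_le_powIdeal {m K : Ideal B} {𝔐 : Ideal (reesAlgebra K)}
    (h : ∀ f ∈ 𝔐, (f : B[X]).coeff 0 ∈ m) (L : ℕ) : 𝔐 ^ L ≤ reesAlgebra.powIdeal m K L := by
  induction L with
  | zero =>
    intro f _ n
    rw [Nat.zero_sub, pow_zero, one_mul]
    exact f.2 n
  | succ L ih =>
    rw [pow_succ', Ideal.mul_le]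
    intro r hr f hf n
    rw [Subalgebra.coe_mul, coeff_mul]
    refine sum_mem fun ij hij => ?_
    have hij' := Finset.HasAntidiagonal.mem_antidiagonal.1 hij
    obtain ⟨i, j⟩ := ij
    simp only at hij' ⊢
    rcases Nat.eq_zero_or_pos i with rfl | hi
    · obtain rfl : j = n := by omega
      have h1 : m * (m ^ (L - j) * K ^ j) ≤ m ^ (L + 1 - j) * K ^ j := by
        rw [← mul_assoc, ← pow_succ']
        exact Ideal.mul_mono_left (Ideal.pow_le_pow_right (by omega))
      exact h1 (Ideal.mul_mem_mul (h r hr) (ih hf _))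
    · have h1 : K ^ i * (m ^ (L - j) * K ^ j) ≤ m ^ (L + 1 - n) * K ^ n := by
        rw [mul_left_comm, ← pow_add, hij']
        exact Ideal.mul_mono_left (Ideal.pow_le_pow_right (by omega))
      exact h1 (Ideal.mul_mem_mul (r.2 _) (ih hf _))

theorem Ideal.length_quotient_ne_top_of_surjective {A R : Type*} [CommRing A] [CommRing R]
    [Algebra A R] (𝔐 : Ideal R) [h𝔐 : 𝔐.IsMaximal]
    (h : Function.Surjective (algebraMap A (R ⧸ 𝔐))) : Module.length A (R ⧸ 𝔐) ≠ ⊤ := by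
  rw [Module.length_eq_of_surjective (R := R ⧸ 𝔐) h]
  let := Ideal.Quotient.field 𝔐
  rw [Module.length_eq_one]
  exact ENat.one_ne_top

theorem sum_relLength_le_of_surjective {A R M ι : Type*} [CommRing A] [CommRing R] [Algebra A R]
    [AddCommGroup M] [Module A M] [Fintype ι] (X Y : ι → Submodule A M)
    (g : ∀ n, R →ₗ[A] X n) (hg : ∀ y : ∀ n, X n, ∃ f, ∀ n, g n f = y n) (N : Ideal R)
    (hN : ∀ f ∈ N, ∀ n, (g n f : M) ∈ Y n) :
    ∑ n, relLength (X n) (Y n) ≤ Module.length A (R ⧸ N) := by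
  let Φ : R →ₗ[A] (∀ n, X n ⧸ (Y n).comap (X n).subtype) :=
    LinearMap.pi fun n => (Submodule.mkQ _).comp (g n)
  have hΦ : Function.Surjective Φ := by
    intro y
    choose x hx using fun n => Submodule.mkQ_surjective _ (y n)
    obtain ⟨f, hf⟩ := hg x
    refine ⟨f, funext fun n => ?_⟩
    rw [← hx n, ← hf n]
    rfl
  have hker : N.restrictScalars A ≤ LinearMap.ker Φ := fun f hf =>
    funext fun n => (Submodule.Quotient.mk_eq_zero _).2 (hN f hf n)
  have hle := Module.length_le_of_surjective (Submodule.liftQ (N.restrictScalars A) Φ hker) (by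
      intro y
      obtain ⟨f, hf⟩ := hΦ y
      exact ⟨Submodule.Quotient.mk f, hf⟩)
  rw [Module.length_pi_of_fintype] at hle
  exact hle.trans_eq (Submodule.Quotient.restrictScalarsEquiv A N).length_eq

theorem exists_sum_relLength_pow_le {A : Type*} [CommRing A] [Algebra A B]
    (hsurj : Function.Surjective (algebraMap A B)) [IsNoetherianRing B] [IsLocalRing B]
    {q : ℕ} (hq : ringKrullDim B ≤ q) (J K : Ideal B) {u : ℕ} (hu : maximalIdeal B ^ u ≤ J) :
    ∃ C : ℕ, ∀ t : ℕ, ∑ n ∈ Finset.range t, relLength (A := A) ((K ^ n).restrictScalars A)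
      ((J ^ t * K ^ n).restrictScalars A) ≤ (C * t ^ (q + 1) : ℕ) := by
  let ε : reesAlgebra K →+* ResidueField B :=
    (residue B).comp (constantCoeff.comp (reesAlgebra K).val.toRingHom)
  have hεC : ∀ b : B, ε (algebraMap B (reesAlgebra K) b) = residue B b := fun b => by
    change residue B ((C b : B[X]).coeff 0) = _
    rw [coeff_C_zero]
  have hε : Function.Surjective ε := fun x => by
    obtain ⟨b, rfl⟩ := residue_surjective x
    exact ⟨_, hεC b⟩
  let 𝔐 : Ideal (reesAlgebra K) := RingHom.ker ε
  have h𝔐 : 𝔐.IsMaximal := RingHom.ker_isMaximal_of_surjective ε hε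
  have hB𝔐 : Function.Surjective (algebraMap A (reesAlgebra K ⧸ 𝔐)) := by
    intro x
    obtain ⟨f, rfl⟩ := Ideal.Quotient.mk_surjective x
    obtain ⟨b, hb⟩ := residue_surjective (ε f)
    obtain ⟨a, rfl⟩ := hsurj b
    refine ⟨a, ?_⟩
    change Ideal.Quotient.mk 𝔐 (algebraMap B (reesAlgebra K) (algebraMap A B a)) = _
    rw [Ideal.Quotient.eq, RingHom.mem_ker, map_sub, hεC, hb, sub_self]
  have hlen : Module.length A (reesAlgebra K ⧸ 𝔐) ≠ ⊤ :=
    Ideal.length_quotient_ne_top_of_surjective 𝔐 hB𝔐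
  have hheight : 𝔐.height ≤ (q + 1 : ℕ) := by
    have h1 := (Ideal.height_le_ringKrullDim_of_isPrime (I := 𝔐)).trans
      ((ringKrullDim_reesAlgebra_le K).trans (add_le_add_left hq 1))
    exact_mod_cast h1
  obtain ⟨C, hC⟩ := Ideal.exists_length_quotient_pow_le A 𝔐 hlen hheight
  refine ⟨C * (u + 1) ^ (q + 1), fun t => ?_⟩
  let X : Fin t → Submodule A B := fun n => (K ^ (n : ℕ)).restrictScalars A
  let Y : Fin t → Submodule A B := fun n => (J ^ t * K ^ (n : ℕ)).restrictScalars A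
  let g : ∀ n : Fin t, reesAlgebra K →ₗ[A] X n := fun n =>
    { toFun := fun f => ⟨(f : B[X]).coeff n, f.2 n⟩
      map_add' := fun f g => Subtype.ext (coeff_add _ _ _)
      map_smul' := fun a f => Subtype.ext (coeff_smul _ _ _) }
  have hg : ∀ y : ∀ n, X n, ∃ f, ∀ n, g n f = y n := by
    intro x
    refine ⟨⟨∑ n : Fin t, monomial (n : ℕ) (x n : B), sum_mem fun n _ =>
      reesAlgebra.monomial_mem.2 (x n).2⟩, fun n => Subtype.ext ?_⟩
    change (∑ n : Fin t, monomial (n : ℕ) (x n : B)).coeff n = x n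
    rw [finsetSum_coeff, Finset.sum_eq_single n]
    · rw [coeff_monomial_same]
    · intro m _ hmn
      exact coeff_monomial_of_ne _ (fun h => hmn (Fin.ext h.symm))
    · simp
  have hker : ∀ f ∈ 𝔐 ^ ((u + 1) * t), ∀ n, (g n f : B) ∈ Y n := by
    intro f hf n
    have h1 := reesAlgebra.pow_le_powIdeal (m := maximalIdeal B)
      (fun f hf => (residue_eq_zero_iff _).1 hf) _ hf (n : ℕ)
    refine Ideal.mul_mono_left ?_ h1
    calc maximalIdeal B ^ ((u + 1) * t - n) ≤ maximalIdeal B ^ (u * t) :=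
          Ideal.pow_le_pow_right (by have := n.2; rw [add_mul]; omega)
      _ ≤ J ^ t := by rw [pow_mul]; exact Ideal.pow_right_mono hu t
  have hle := sum_relLength_le_of_surjective X Y g hg (𝔐 ^ ((u + 1) * t)) hker
  rw [← Fin.sum_univ_eq_sum_range (fun n => relLength (A := A) ((K ^ n).restrictScalars A)
      ((J ^ t * K ^ n).restrictScalars A))]
  refine hle.trans ((hC _).trans (le_of_eq ?_))
  rw [mul_pow, mul_assoc]

end Rees

section ModuleGrowth

open IsLocalRing

variable {A M : Type*} [CommRing A] [AddCommGroup M] [Module A M]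

theorem relLength_map_le {N : Type*} [AddCommGroup N] [Module A N] (f : N →ₗ[A] M)
    (U V : Submodule A N) : relLength (U.map f) (V.map f) ≤ relLength U V := by
  refine Module.length_le_of_surjective
    (Submodule.mapQ (V.comap U.subtype) ((V.map f).comap (U.map f).subtype) (f.submoduleMap U)
      fun x hx => Submodule.mem_map_of_mem hx) ?_
  intro y
  obtain ⟨y, rfl⟩ := Submodule.mkQ_surjective _ y
  obtain ⟨x, rfl⟩ := f.submoduleMap_surjective U y
  exact ⟨Submodule.mkQ _ x, rfl⟩

theorem relLength_iSup_le {ι : Type*} [Fintype ι] (X : ι → Submodule A M) (Y : Submodule A M) :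
    relLength (⨆ i, X i) Y ≤ ∑ i, relLength (X i) Y := by
  unfold relLength
  rw [← Module.length_pi_of_fintype]
  let Φ : (∀ i, X i ⧸ Y.comap (X i).subtype) →ₗ[A] (↥(⨆ i, X i) ⧸ Y.comap (⨆ i, X i).subtype) :=
    ∑ i, (Submodule.mapQ _ _ (Submodule.inclusion (le_iSup X i)) fun _ hx => hx).comp
      (LinearMap.proj i)
  refine Module.length_le_of_surjective Φ ?_
  intro y
  obtain ⟨⟨y, hy⟩, rfl⟩ := Submodule.mkQ_surjective _ y
  obtain ⟨x, hx⟩ := (Submodule.mem_iSup_iff_exists_finsupp _ _).1 hy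
  refine ⟨fun i => Submodule.mkQ _ ⟨x i, hx.1 i⟩, ?_⟩
  rw [LinearMap.sum_apply]
  change ∑ i, Submodule.mkQ (Y.comap (⨆ i, X i).subtype)
    (Submodule.inclusion (le_iSup X i) ⟨x i, hx.1 i⟩) = _
  rw [← map_sum]
  refine congrArg _ (Subtype.ext ?_)
  rw [Submodule.coe_sum]
  simp only [Submodule.coe_inclusion]
  rw [← hx.2, Finsupp.sum_fintype _ _ fun _ => rfl]

theorem exists_sum_relLength_smul_le [IsNoetherianRing A] [IsLocalRing A] [Module.Finite A M]
    (X : Submodule A M) {q : ℕ} (hq : ringKrullDim (A ⧸ X.annihilator) ≤ q) (J K : Ideal A)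
    {u : ℕ} (hu : maximalIdeal A ^ u ≤ J) :
    ∃ C : ℕ, ∀ t : ℕ, ∑ n ∈ Finset.range t, relLength (K ^ n • X) (J ^ t • (K ^ n • X)) ≤
      (C * t ^ (q + 1) : ℕ) := by
  by_cases hX : X.annihilator = ⊤
  · rw [Submodule.annihilator_eq_top_iff] at hX
    refine ⟨0, fun t => ?_⟩
    rw [Finset.sum_eq_zero]
    · exact zero_le
    · intro n _
      rw [hX, Submodule.smul_bot, Submodule.smul_bot]
      exact Module.length_eq_zero
  set 𝔞 := X.annihilator
  have : Nontrivial (A ⧸ 𝔞) := Ideal.Quotient.nontrivial_iff.2 hX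
  have hsurj : Function.Surjective (algebraMap A (A ⧸ 𝔞)) := Ideal.Quotient.mk_surjective
  have : IsLocalRing (A ⧸ 𝔞) := IsLocalRing.of_surjective' _ hsurj
  have hu' : maximalIdeal (A ⧸ 𝔞) ^ u ≤ J.map (algebraMap A (A ⧸ 𝔞)) := by
    refine le_trans (Ideal.pow_right_mono ?_ u)
      ((Ideal.map_pow (algebraMap A (A ⧸ 𝔞)) (maximalIdeal A) u).symm.trans_le (Ideal.map_mono hu))
    intro x hx
    obtain ⟨a, rfl⟩ := hsurj x
    refine Ideal.mem_map_of_mem _ fun ha => hx ?_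
    exact ha.map _
  obtain ⟨C, hC⟩ := exists_sum_relLength_pow_le (A := A) hsurj hq
    (J.map (algebraMap A (A ⧸ 𝔞))) (K.map (algebraMap A (A ⧸ 𝔞))) hu'
  obtain ⟨S, hS⟩ := (IsNoetherian.noetherian X : X.FG)
  have hmem : ∀ m ∈ S, m ∈ X := fun m hm => hS ▸ Submodule.subset_span hm
  let φ : S → (A ⧸ 𝔞) →ₗ[A] M := fun m => Submodule.liftQ 𝔞 (LinearMap.toSpanSingleton A M m)
    fun a ha => Submodule.mem_annihilator.1 ha _ (hmem m m.2)
  have hφ : X = ⨆ m, (⊤ : Submodule A (A ⧸ 𝔞)).map (φ m) := by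
    rw [← hS, Submodule.span_eq_iSup_of_singleton_spans, iSup_subtype']
    refine iSup_congr fun m => ?_
    rw [← LinearMap.range_toSpanSingleton, Submodule.map_top]
    exact (Submodule.range_liftQ _ _ _).symm
  have hsmul : ∀ L : Ideal A, L • X =
      ⨆ m, ((L.map (algebraMap A (A ⧸ 𝔞))).restrictScalars A).map (φ m) := by
    intro L
    conv_lhs => rw [hφ, Submodule.smul_iSup]
    refine iSup_congr fun m => ?_
    rw [← Submodule.map_smul'', Ideal.smul_top_eq_map]
  refine ⟨S.card * C, fun t => ?_⟩
  calc ∑ n ∈ Finset.range t, relLength (K ^ n • X) (J ^ t • (K ^ n • X))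
      ≤ ∑ n ∈ Finset.range t, ∑ m : S, relLength
          (((K.map (algebraMap A (A ⧸ 𝔞))) ^ n).restrictScalars A)
          (((J.map (algebraMap A (A ⧸ 𝔞))) ^ t * (K.map (algebraMap A (A ⧸ 𝔞))) ^ n).restrictScalars
            A) := by
        refine Finset.sum_le_sum fun n _ => ?_
        rw [smul_smul, hsmul, hsmul]
        refine (relLength_iSup_le _ _).trans (Finset.sum_le_sum fun m _ => ?_)
        rw [Ideal.map_mul, Ideal.map_pow, Ideal.map_pow]
        refine le_trans (relLength_anti _ ?_) (relLength_map_le (φ m) _ _)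
        exact le_iSup (fun m => Submodule.map (φ m) (Submodule.restrictScalars A _)) m
    _ = S.card • ∑ n ∈ Finset.range t, relLength
          (((K.map (algebraMap A (A ⧸ 𝔞))) ^ n).restrictScalars A)
          (((J.map (algebraMap A (A ⧸ 𝔞))) ^ t * (K.map (algebraMap A (A ⧸ 𝔞))) ^ n).restrictScalars
            A) := by
        simp [Finset.mul_sum]
    _ ≤ S.card • ((C * t ^ (q + 1) : ℕ) : ℕ∞) := nsmul_le_nsmul_right (hC t) _
    _ = (S.card * C * t ^ (q + 1) : ℕ) := by
        rw [nsmul_eq_mul, mul_assoc]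
        push_cast
        rfl

end ModuleGrowth

namespace MvPolynomial

open Filter

theorem abs_sub_le_of_forall_abs_sub_le {g : ℕ → ℚ} {K : ℚ} (b c : ℕ)
    (h : ∀ a < c, |g (b + a + 1) - g (b + a)| ≤ K) : |g (b + c) - g b| ≤ c * K := by
  induction c with
  | zero => simp
  | succ c ih =>
    have h1 := ih fun a ha => h a (by omega)
    have h2 := h c (by omega)
    have h3 := abs_sub_le (g (b + (c + 1))) (g (b + c)) (g b)
    push_cast
    rw [← add_assoc] at *
    linarith

theorem degreeBelow_of_sum_le {s N q : ℕ} {Q : MvPolynomial (Fin (s + 1)) ℚ}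
    {L : (Fin s → ℕ) → ℕ → ℕ → ℚ}
    (hdiff : ∀ w : Fin s → ℕ, (∀ i, 0 < w i) → ∀ b n : ℕ, N ≤ b → N ≤ n →
      L w (b + 1) n - L w b n = eval (Fin.cons (b : ℚ) fun i => (n : ℚ) * w i) Q)
    (hnonneg : ∀ w b n, 0 ≤ L w b n) (hmono : ∀ w n, Monotone fun b => L w b n)
    (hsum : ∀ w : Fin s → ℕ, (∀ i, 0 < w i) → ∃ C : ℕ, ∀ t : ℕ,
      ∑ n ∈ Finset.range t, L w t n ≤ C * (t : ℚ) ^ (q + 1)) :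
    DegreeBelow Q q := by
  obtain ⟨H, hH, hHf⟩ := exists_sum_polynomial 0 N Q
  have hHL : ∀ w : Fin s → ℕ, (∀ i, 0 < w i) → ∀ b n : ℕ, N ≤ b → N ≤ n →
      eval (Fin.cons (b : ℚ) fun i => (n : ℚ) * w i) H = L w b n - L w N n := by
    intro w hw b n hb hn
    have h1 := hHf (fun b => L w b n) (Fin.cons (b : ℚ) fun i => (n : ℚ) * w i) ?_ b hb
    · rwa [Fin.update_cons_zero] at h1
    · intro b hb
      rw [Fin.update_cons_zero]
      exact hdiff w hw b n hb hn
  suffices DegreeBelow H (q + 1) by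
    rw [← hH]
    exact this.translate_sub _
  refine degreeBelow_of_rays fun v hv => ?_
  have hw : ∀ i, 0 < Fin.tail v i := fun i => hv i.succ
  set w := Fin.tail v
  let h : MvPolynomial (Fin 2) ℚ :=
    aeval (Fin.cons (X 0) fun i => C (w i : ℚ) * X 1 : Fin (s + 1) → MvPolynomial (Fin 2) ℚ) H
  have hh : ∀ b n : ℚ, eval ![b, n] h = eval (Fin.cons b fun i => n * w i) H := by
    intro b n
    rw [eval_aeval]
    congr 1
    congr 1
    funext i
    refine Fin.cases ?_ (fun i => ?_) i
    · simp
    · simp [mul_comm]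
  obtain ⟨G, hG, hGf⟩ := exists_sum_polynomial 1 N h
  have hGL : ∀ b m : ℕ, N ≤ b → N ≤ m → eval ![(b : ℚ), (m : ℚ)] G =
      ∑ n ∈ Finset.Ico N m, (L w b n - L w N n) := by
    intro b m hb hm
    have hu : ∀ n : ℚ, Function.update ![(b : ℚ), m] 1 n = ![(b : ℚ), n] := by
      intro n
      funext i
      fin_cases i <;> simp
    have h1 := hGf (fun m => ∑ n ∈ Finset.Ico N m, (L w b n - L w N n)) ![(b : ℚ), m] ?_ m hm
    · rw [hu] at h1
      rw [h1]
      simp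
    · intro n hn
      rw [hu, hh, hHL w hw b n hb hn, Finset.sum_Ico_succ_top hn]
      ring
  obtain ⟨C, hC⟩ := hsum w hw
  have hGdeg : DegreeBelow G (q + 1 + 1) := by
    refine degreeBelow_of_rays fun v hv => ⟨C * ((v 0 + v 1 : ℕ) : ℚ) ^ (q + 1), N, fun t ht => ?_⟩
    have h0 : N ≤ t * v 0 := ht.trans (Nat.le_mul_of_pos_right t (hv 0))
    have h1 : N ≤ t * v 1 := ht.trans (Nat.le_mul_of_pos_right t (hv 1))
    have hx : (fun i => (t : ℚ) * v i) = ![((t * v 0 : ℕ) : ℚ), ((t * v 1 : ℕ) : ℚ)] := by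
      funext i
      fin_cases i <;> simp
    rw [hx, hGL _ _ h0 h1, abs_of_nonneg
      (Finset.sum_nonneg fun n _ => sub_nonneg.2 (hmono w n h0))]
    calc ∑ n ∈ Finset.Ico N (t * v 1), (L w (t * v 0) n - L w N n)
        ≤ ∑ n ∈ Finset.Ico N (t * v 1), L w (t * (v 0 + v 1)) n := by
          refine Finset.sum_le_sum fun n _ => ?_
          have h2 := hmono w n (show t * v 0 ≤ t * (v 0 + v 1) by gcongr; omega)
          have h3 := hnonneg w N n
          simp only at h2
          linarith
      _ ≤ ∑ n ∈ Finset.range (t * (v 0 + v 1)), L w (t * (v 0 + v 1)) n := by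
          refine Finset.sum_le_sum_of_subset_of_nonneg ?_ fun n _ _ => hnonneg _ _ _
          intro n hn
          rw [Finset.mem_Ico] at hn
          rw [Finset.mem_range]
          exact hn.2.trans_le (by gcongr; omega)
      _ ≤ C * ((t * (v 0 + v 1) : ℕ) : ℚ) ^ (q + 1) := hC _
      _ = _ := by rw [Nat.cast_mul, mul_pow]; ring
  have hhdeg : DegreeBelow h (q + 1) := by
    rw [← hG]
    exact hGdeg.translate_sub _
  obtain ⟨c, hc, hcb⟩ := hhdeg.exists_abs_eval_le
  refine ⟨c * ((v 0 + 1 : ℕ) : ℚ) ^ q, 1, fun t ht => ?_⟩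
  have hx : (fun i => (t : ℚ) * v i) = Fin.cons ((t * v 0 : ℕ) : ℚ) fun i => (t : ℚ) * w i := by
    funext i
    refine Fin.cases ?_ (fun i => ?_) i
    · simp
    · simp [w, Fin.tail]
  have ht' : (1 : ℚ) ≤ t := by exact_mod_cast ht
  have hv0 : (0 : ℚ) ≤ v 0 := Nat.cast_nonneg _
  rw [hx, ← hh]
  refine (hcb (t * (v 0 + 1 : ℕ)) _ ?_ ?_).trans (le_of_eq (by ring))
  · push_cast
    nlinarith
  · intro i
    fin_cases i
    · simp only [Fin.zero_eta, Matrix.cons_val_zero, Nat.abs_cast]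
      push_cast
      nlinarith
    · simp only [Fin.mk_one, Matrix.cons_val_one, Matrix.cons_val_fin_one, Nat.abs_cast]
      push_cast
      nlinarith

theorem degreeBelow_sub_of_interlace {s N e : ℕ} {P Q : MvPolynomial (Fin (s + 1)) ℚ}
    (hP : DegreeBelow P (e + 1)) (hQ : DegreeBelow Q (e + 1))
    {L L' : (Fin s → ℕ) → ℕ → ℕ → ℚ}
    (hL : ∀ w : Fin s → ℕ, (∀ i, 0 < w i) → ∀ b n : ℕ, N ≤ b → N ≤ n →
      L w (b + 1) n - L w b n = eval (Fin.cons (b : ℚ) fun i => (n : ℚ) * w i) Q)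
    (hL' : ∀ w : Fin s → ℕ, (∀ i, 0 < w i) → ∀ b n : ℕ, N ≤ b → N ≤ n →
      L' w (b + 1) n - L' w b n = eval (Fin.cons (b : ℚ) fun i => (n : ℚ) * w i) P)
    (hLL' : ∀ w : Fin s → ℕ, (∀ i, 0 < w i) → ∃ c : ℕ, ∀ b n,
      L' w b n ≤ L w (b + c) n ∧ L w b n ≤ L' w (b + c) n) :
    DegreeBelow (P - Q) e := by
  obtain ⟨H, hH, hHf⟩ := exists_sum_polynomial 0 N (P - Q)
  suffices DegreeBelow H (e + 1) by
    rw [← hH]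
    exact this.translate_sub _
  obtain ⟨cQ, hcQ, hQb⟩ := hQ.exists_abs_eval_le
  obtain ⟨cD, hcD, hDb⟩ := (hP.sub hQ).exists_abs_eval_le
  refine degreeBelow_of_rays fun v hv => ?_
  have hw : ∀ i, 0 < Fin.tail v i := fun i => hv i.succ
  set w := Fin.tail v
  obtain ⟨c, hc⟩ := hLL' w hw
  set V := v 0 + N + 2 * c + ∑ i, w i + 1
  refine ⟨3 * c * (cQ + cD) * (V : ℚ) ^ e, N + c + 1, fun t ht => ?_⟩
  have hx : (fun i => (t : ℚ) * v i) = Fin.cons ((t * v 0 : ℕ) : ℚ) fun i => (t : ℚ) * w i := by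
    funext i
    refine Fin.cases ?_ (fun i => ?_) i
    · simp
    · simp [w, Fin.tail]
  have htv : t ≤ t * v 0 := Nat.le_mul_of_pos_right t (hv 0)
  have hHL : eval (fun i => (t : ℚ) * v i) H =
      (L' w (t * v 0) t - L w (t * v 0) t) - (L' w N t - L w N t) := by
    have h1 := hHf (fun b => L' w b t - L w b t)
      (Fin.cons ((t * v 0 : ℕ) : ℚ) fun i => (t : ℚ) * w i) ?_ (t * v 0) (by omega)
    · rwa [Fin.update_cons_zero, ← hx] at h1
    · intro b hb
      rw [Fin.update_cons_zero, map_sub, ← hL w hw b t hb (by omega),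
        ← hL' w hw b t hb (by omega)]
      ring
  have htV : 1 ≤ ((t * V : ℕ) : ℚ) := by
    have : 1 ≤ t * V := Nat.mul_pos (by omega) (by omega)
    exact_mod_cast this
  have hbox : ∀ b : ℕ, b ≤ t * v 0 + N + 2 * c →
      ∀ i, |(Fin.cons (b : ℚ) fun i => (t : ℚ) * w i : Fin (s + 1) → ℚ) i| ≤ ((t * V : ℕ) : ℚ) := by
    intro b hb i
    refine Fin.cases ?_ (fun i => ?_) i
    · rw [Fin.cons_zero, Nat.abs_cast]
      refine Nat.cast_le.2 (hb.trans ?_)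
      simp only [V]
      have : N + 2 * c ≤ t * (N + 2 * c) := Nat.le_mul_of_pos_left _ (by omega)
      nlinarith [Nat.zero_le (t * ∑ i, w i)]
    · rw [Fin.cons_succ, ← Nat.cast_mul, Nat.abs_cast]
      refine Nat.cast_le.2 (Nat.mul_le_mul_left t ?_)
      have := Finset.single_le_sum (fun i _ => Nat.zero_le (w i)) (Finset.mem_univ i)
      omega
  set K := ((t * V : ℕ) : ℚ) ^ e
  have hLstep : ∀ b, N ≤ b → b + c ≤ t * v 0 + N + 2 * c →
      |L w (b + c) t - L w b t| ≤ c * (cQ * K) := by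
    intro b hb hb'
    refine abs_sub_le_of_forall_abs_sub_le (g := fun b => L w b t) b c fun a ha => ?_
    rw [hL w hw (b + a) t (by omega) (by omega)]
    exact hQb _ _ htV (hbox _ (by omega))
  have hDstep : |(L' w (N + c) t - L w (N + c) t) - (L' w N t - L w N t)| ≤ c * (cD * K) := by
    refine abs_sub_le_of_forall_abs_sub_le (g := fun b => L' w b t - L w b t) N c fun a ha => ?_
    have h1 := hL w hw (N + a) t (by omega) (by omega)
    have h2 := hL' w hw (N + a) t (by omega) (by omega)
    have h3 := hDb _ _ htV (hbox (N + a) (by omega))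
    rw [map_sub, ← h1, ← h2] at h3
    refine le_trans (le_of_eq ?_) h3
    congr 1
    ring
  have hf : ∀ b, N + c ≤ b → b ≤ t * v 0 + N + c →
      |L' w b t - L w b t| ≤ c * (cQ * K) := by
    intro b hb hb'
    obtain ⟨a, rfl⟩ := Nat.exists_eq_add_of_le' (show c ≤ b by omega)
    have h1 := abs_le.1 (hLstep a (by omega) (by omega))
    have h2 := abs_le.1 (hLstep (a + c) (by omega) (by omega))
    have h3 := (hc (a + c) t).1
    have h4 := (hc a t).2
    rw [abs_le]
    constructor <;> linarith
  have h1 := abs_le.1 (hf (t * v 0) (by omega) (by omega))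
  have h2 := abs_le.1 (hf (N + c) le_rfl (by omega))
  have h3 := abs_le.1 hDstep
  have hK : 0 ≤ K := by positivity
  have h4 : 0 ≤ c * (cD * K) := by positivity
  have h5 : 0 ≤ c * (cQ * K) := by positivity
  have h6 : 3 * c * (cQ + cD) * (V : ℚ) ^ e * (t : ℚ) ^ e = 3 * (c * (cQ * K)) + 3 * (c * (cD * K)) := by
    simp only [K]
    push_cast
    ring
  rw [h6, hHL, abs_le]
  constructor <;> linarith

end MvPolynomial

section Filtration

variable {A : Type*} [CommRing A] {F : ℕ → Ideal A} {J : Ideal A} {N : ℕ}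

theorem Ideal.filtration_add_eq (h : ∀ n ≥ N, F (n + 1) = J * F n) {n : ℕ} (hn : N ≤ n) (k : ℕ) :
    F (n + k) = J ^ k * F n := by
  induction k with
  | zero => rw [add_zero, pow_zero, one_mul]
  | succ k ih => rw [← add_assoc, h _ (by omega), ih, pow_succ', mul_assoc]

theorem Ideal.filtration_add_le_pow (h : ∀ n ≥ N, F (n + 1) = J * F n) (k : ℕ) :
    F (k + N) ≤ J ^ k := by
  rw [add_comm, filtration_add_eq h le_rfl]
  exact Ideal.mul_le_left

theorem Ideal.pow_le_filtration (h0 : F 0 = ⊤) (h : ∀ n, J * F n ≤ F (n + 1)) (k : ℕ) :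
    J ^ k ≤ F k := by
  induction k with
  | zero => rw [h0]; exact le_top
  | succ k ih => exact (pow_succ' J k).trans_le ((Ideal.mul_mono_right ih).trans (h k))

theorem Ideal.filtration_one_pow_le (h0 : F 0 = ⊤) (hmul : ∀ m n : ℕ, F m * F n ≤ F (m + n))
    (k : ℕ) : F 1 ^ k ≤ F k :=
  Ideal.pow_le_filtration h0 (fun n => (hmul 1 n).trans_eq (by rw [add_comm])) k

end Filtration

section Saturation

variable {A M : Type*} [CommRing A] [AddCommGroup M] [Module A M]

theorem mem_satSubmodule_of_forall_smul_eq_zero {I : Ideal A} {n : ℕ} {m : M}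
    (h : ∀ a ∈ I ^ n, a • m = 0) : m ∈ satSubmodule A M I :=
  Submodule.mem_iSup_of_mem n ((Submodule.mem_torsionBySet_iff _ _).2 fun a => h a a.2)

theorem exists_pow_smul_satSubmodule_eq_bot [IsNoetherianRing A] [Module.Finite A M]
    (I : Ideal A) : ∃ n, I ^ n • satSubmodule A M I = ⊥ := by
  let f : ℕ →o Submodule A M :=
    ⟨fun n => Submodule.torsionBySet A M ((I ^ n : Ideal A) : Set A), fun m n hmn =>
      Submodule.torsionBySet_le_torsionBySet_of_subset (Ideal.pow_le_pow_right hmn)⟩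
  obtain ⟨n, hn⟩ := monotone_stabilizes_iff_noetherian.2 (inferInstance : IsNoetherian A M) f
  refine ⟨n, ?_⟩
  have h : satSubmodule A M I ≤ f n := iSup_le fun m => by
    rcases le_total m n with hmn | hmn
    · exact f.monotone hmn
    · exact (hn m hmn).ge
  rw [eq_bot_iff, Submodule.smul_le]
  intro a ha m hm
  exact (Submodule.mem_torsionBySet_iff _ _).1 (h hm) ⟨a, ha⟩

theorem exists_pow_smul_top_inf_satSubmodule_eq_bot [IsNoetherianRing A] [Module.Finite A M]
    (I : Ideal A) : ∃ c, I ^ c • (⊤ : Submodule A M) ⊓ satSubmodule A M I = ⊥ := by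
  obtain ⟨n, hn⟩ := exists_pow_smul_satSubmodule_eq_bot (M := M) I
  obtain ⟨k, hk⟩ := exists_pow_smul_inf_le I (Module.Finite.fg_top (R := A) (M := M))
    (le_top (a := satSubmodule A M I))
  exact ⟨n + k, eq_bot_iff.2 ((hk n).trans hn.le)⟩

theorem exists_mem_forall_smul_eq_zero_imp [IsNoetherianRing A] [Module.Finite A M] (I : Ideal A)
    (X : Submodule A M) (h : ∀ m ∈ X, (∀ a ∈ I, a • m = 0) → m = 0) :
    ∃ x ∈ I, ∀ m ∈ X, x • m = 0 → m = 0 := by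
  have : Subsingleton ((A ⧸ I) →ₗ[A] X) := by
    refine ⟨fun f g => ?_⟩
    have hz : ∀ f : (A ⧸ I) →ₗ[A] X, f 1 = 0 := by
      intro f
      refine Subtype.ext (h _ (f 1).2 fun a ha => ?_)
      rw [← Submodule.coe_smul, ← map_smul, Algebra.smul_def, mul_one,
        Ideal.Quotient.algebraMap_eq, Ideal.Quotient.eq_zero_iff_mem.2 ha, map_zero,
        Submodule.coe_zero]
    refine Submodule.linearMap_qext _ (LinearMap.ext_ring ?_)
    change f 1 = g 1
    rw [hz, hz]
  obtain ⟨x, hx, hreg⟩ := IsSMulRegular.subsingleton_linearMap_iff.1 this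
  rw [Ideal.annihilator_quotient] at hx
  refine ⟨x, hx, fun m hm hxm => ?_⟩
  exact congrArg Subtype.val
    (hreg (a₁ := (⟨m, hm⟩ : X)) (a₂ := 0) ((Subtype.ext hxm : x • (⟨m, hm⟩ : X) = 0).trans (smul_zero x).symm))

theorem annihilator_quotient_satSubmodule_le (I : Ideal A) {X : Submodule A M}
    (hX : X ⊓ satSubmodule A M I = ⊥) :
    Module.annihilator A (M ⧸ satSubmodule A M I) ≤ X.annihilator := by
  intro a ha
  rw [Submodule.mem_annihilator]
  intro m hm
  rw [← Submodule.mem_bot A, ← hX]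
  refine ⟨X.smul_mem a hm, (Submodule.Quotient.mk_eq_zero _).1 ?_⟩
  exact Module.mem_annihilator.1 ha (Submodule.Quotient.mk m)

end Saturation

section Length

open IsLocalRing

variable {A M : Type*} [CommRing A] [AddCommGroup M] [Module A M]

theorem ModuleLengthIs.length_eq {N : Type*} [AddCommGroup N] [Module A N] {l : ℕ}
    (h : ModuleLengthIs A N l) : Module.length A N = l := by
  obtain ⟨s, h1, h2, rfl⟩ := h
  exact (Module.length_compositionSeries s h1 h2).symm

theorem exists_sum_relLength_toNat_le [IsNoetherianRing A] [IsLocalRing A] [Module.Finite A M]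
    (X : Submodule A M) {q : ℕ} (hq : ringKrullDim (A ⧸ X.annihilator) ≤ q) (J K : Ideal A)
    {u : ℕ} (hu : maximalIdeal A ^ u ≤ J) :
    (∀ b n, relLength (K ^ n • X) (J ^ b • (K ^ n • X)) ≠ ⊤) ∧
      ∃ C : ℕ, ∀ t : ℕ, ∑ n ∈ Finset.range t,
        ((relLength (K ^ n • X) (J ^ t • (K ^ n • X))).toNat : ℚ) ≤ C * (t : ℚ) ^ (q + 1) := by
  obtain ⟨C, hC⟩ := exists_sum_relLength_smul_le X hq J K hu
  have hfin : ∀ b n, relLength (K ^ n • X) (J ^ b • (K ^ n • X)) ≠ ⊤ := by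
    intro b n
    refine ne_top_of_le_ne_top (ENat.natCast_ne_top (C * (b + n + 1) ^ (q + 1))) ?_
    calc relLength (K ^ n • X) (J ^ b • (K ^ n • X))
        ≤ relLength (K ^ n • X) (J ^ (b + n + 1) • (K ^ n • X)) :=
          relLength_anti _ (Submodule.smul_mono (Ideal.pow_le_pow_right (by omega)) le_rfl)
      _ ≤ ∑ m ∈ Finset.range (b + n + 1),
            relLength (K ^ m • X) (J ^ (b + n + 1) • (K ^ m • X)) :=
          Finset.single_le_sum
            (f := fun m => relLength (K ^ m • X) (J ^ (b + n + 1) • (K ^ m • X)))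
            (fun _ _ => zero_le) (Finset.mem_range.2 (by omega))
      _ ≤ _ := hC _
  refine ⟨hfin, C, fun t => ?_⟩
  have h1 : ((∑ n ∈ Finset.range t, (relLength (K ^ n • X) (J ^ t • (K ^ n • X))).toNat : ℕ) : ℕ∞)
      ≤ (C * t ^ (q + 1) : ℕ) := by
    rw [Nat.cast_sum]
    simp_rw [ENat.natCast_toNat (hfin _ _)]
    exact hC t
  exact_mod_cast h1

theorem relLength_toNat_sub {X Y Z : Submodule A M} (hZY : Z ≤ Y) (hYX : Y ≤ X) {l : ℕ}
    (hXY : relLength X Y ≠ ⊤) (h : ModuleLengthIs A (Y ⧸ Z.comap Y.subtype) l) :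
    ((relLength X Z).toNat : ℚ) - (relLength X Y).toNat = l := by
  have h1 : relLength Y Z = l := h.length_eq
  rw [relLength_add hZY hYX, h1, ENat.toNat_add hXY (ENat.natCast_ne_top l), ENat.toNat_natCast]
  push_cast
  ring

end Length

theorem MvPolynomial.DegreeBelow.of_translate_sub {σ : Type*} {P : MvPolynomial σ ℚ} {d : ℕ}
    {c : σ → ℚ} (h : DegreeBelow (translate c P) (d + 1)) : DegreeBelow (translate c P - P) d := by
  have h1 : translate (-c) (translate c P) = P := MvPolynomial.funext fun x => by
    simp [eval_translate]
  have h2 := h.translate_sub (-c)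
  rw [h1] at h2
  intro k hk
  rw [← neg_sub, coeff_neg, h2 k hk, neg_zero]

/-- Mixed multiplicities of a module with respect to good filtrations coincide with the
mixed multiplicities with respect to (the adic filtrations of) their reductions: the
coefficients of total degree `q - 1` of the respective Bhattacharya polynomials agree,
where `q = dim M/(0_M : I^∞)`, `I = (F₁)₁⋯(F_s)₁`. -/
theorem mixed_multiplicities_eq_of_reductions {A : Type*} [CommRing A] [IsNoetherianRing A]
    [IsLocalRing A] {M : Type*} [AddCommGroup M] [Module A M] [Module.Finite A M]
    {s : ℕ} (F : ℕ → Ideal A) (Fs : Fin s → ℕ → Ideal A)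
    (J : Ideal A) (I : Fin s → Ideal A)
    (hF0 : F 0 = ⊤) (hanti : Antitone F) (hmul : ∀ m n : ℕ, F m * F n ≤ F (m + n))
    (hgood1 : ∀ n : ℕ, J * F n ≤ F (n + 1))
    (hgood2 : ∃ N : ℕ, ∀ n ≥ N, F (n + 1) = J * F n)
    (hprim : (F 1).radical = IsLocalRing.maximalIdeal A ∧ F 1 ≠ ⊤)
    (hFs0 : ∀ i, Fs i 0 = ⊤) (hFsanti : ∀ i, Antitone (Fs i))
    (hFsmul : ∀ i, ∀ m n : ℕ, Fs i m * Fs i n ≤ Fs i (m + n))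
    (hFsgood1 : ∀ i, ∀ n : ℕ, I i * Fs i n ≤ Fs i (n + 1))
    (hFsgood2 : ∀ i, ∃ N : ℕ, ∀ n ≥ N, Fs i (n + 1) = I i * Fs i n)
    (hI : ¬ (∏ i, Fs i 1) ≤ (Module.annihilator A M).radical)
    (q : ℕ) (hq : (q : WithBot ℕ∞) = ringKrullDim
      (A ⧸ Module.annihilator A (M ⧸ satSubmodule A M (∏ i, Fs i 1))))
    (P Q : MvPolynomial (Fin (s + 1)) ℚ)
    (hP : IsBhattacharyaPoly A M F Fs P)
    (hQ : IsBhattacharyaPoly A M (fun n => J ^ n) (fun i n => I i ^ n) Q) :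
    ∀ k : Fin (s + 1) →₀ ℕ, (∑ i, k i) = q - 1 →
      MvPolynomial.coeff k P = MvPolynomial.coeff k Q := by
  obtain ⟨NF, hNF⟩ := hgood2
  choose NI hNI using hFsgood2
  set N₀ := NF + ∑ i, NI i
  have hNI' : ∀ i, ∀ n ≥ N₀, Fs i (n + 1) = I i * Fs i n := fun i n hn => hNI i n (by
    have := Finset.single_le_sum (fun i _ => Nat.zero_le (NI i)) (Finset.mem_univ i)
    omega)
  have hNF' : ∀ n ≥ N₀, F (n + 1) = J * F n := fun n hn => hNF n (by omega)
  set 𝔣 := ∏ i, Fs i 1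
  obtain ⟨u, hu⟩ : ∃ u, IsLocalRing.maximalIdeal A ^ u ≤ J := by
    obtain ⟨r, hr⟩ := Ideal.exists_radical_pow_le_of_fg (F 1) (IsNoetherian.noetherian _)
    rw [hprim.1] at hr
    refine ⟨r * (1 + N₀), ?_⟩
    rw [pow_mul]
    exact (Ideal.pow_right_mono hr _).trans ((Ideal.filtration_one_pow_le hF0 hmul _).trans
      ((Ideal.filtration_add_le_pow hNF' 1).trans_eq (pow_one J)))
  have hfI : ∀ k, 𝔣 ^ (k + N₀) ≤ ∏ i, I i ^ k := fun k => by
    rw [← Finset.prod_pow]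
    exact Finset.prod_le_prod' fun i _ =>
      (Ideal.filtration_one_pow_le (hFs0 i) (hFsmul i) _).trans
        (Ideal.filtration_add_le_pow (hNI' i) k)
  have hIF : ∀ k, ∏ i, I i ^ k ≤ ∏ i, Fs i k := fun k =>
    Finset.prod_le_prod' fun i _ => Ideal.pow_le_filtration (hFs0 i) (hFsgood1 i) k
  obtain ⟨c, hc⟩ := exists_pow_smul_top_inf_satSubmodule_eq_bot (M := M) 𝔣
  set X : Submodule A M := (∏ i, I i ^ c) • ⊤
  set Y : Submodule A M := (∏ i, Fs i (c + N₀)) • ⊤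
  have hYX : Y ≤ X := Submodule.smul_mono (Finset.prod_le_prod' fun i _ =>
    Ideal.filtration_add_le_pow (hNI' i) c) le_rfl
  have hXsat : X ⊓ satSubmodule A M 𝔣 = ⊥ := by
    refine eq_bot_iff.2 (le_trans (inf_le_inf_right _ (Submodule.smul_mono ?_ le_rfl)) hc.le)
    rw [← Finset.prod_pow]
    refine Finset.prod_le_prod' fun i _ => Ideal.pow_right_mono ?_ c
    simpa using Ideal.pow_le_filtration (hFs0 i) (hFsgood1 i) 1
  obtain ⟨x, hxI, hx⟩ := exists_mem_forall_smul_eq_zero_imp (∏ i, I i ^ (c + N₀)) X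
    fun m hm h => by
      rw [← Submodule.mem_bot A, ← hXsat]
      exact ⟨hm, mem_satSubmodule_of_forall_smul_eq_zero (n := c + N₀ + N₀)
        fun a ha => h a (hfI _ ha)⟩
  have hxY : ∀ m ∈ X, x • m ∈ Y := fun m _ => Submodule.smul_mem_smul (hIF _ hxI) trivial
  have hdim : ringKrullDim (A ⧸ X.annihilator) ≤ q := by
    rw [hq]
    exact ringKrullDim_le_of_surjective
      (Ideal.Quotient.factor (annihilator_quotient_satSubmodule_le 𝔣 hXsat))
      (Ideal.Quotient.factor_surjective _)
  let K : (Fin s → ℕ) → Ideal A := fun w => ∏ i, I i ^ w i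
  have hKX : ∀ w n, K w ^ n • X = (∏ i, I i ^ (n * w i + c)) • (⊤ : Submodule A M) := by
    intro w n
    simp only [X, K]
    rw [smul_smul, ← Finset.prod_pow, ← Finset.prod_mul_distrib]
    congr 1
    refine Finset.prod_congr rfl fun i _ => ?_
    rw [← pow_mul, ← pow_add, mul_comm (w i)]
  have hKY : ∀ w n, K w ^ n • Y = (∏ i, Fs i (n * w i + (c + N₀))) • (⊤ : Submodule A M) := by
    intro w n
    simp only [Y, K]
    rw [smul_smul, ← Finset.prod_pow, ← Finset.prod_mul_distrib]
    congr 1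
    refine Finset.prod_congr rfl fun i _ => ?_
    rw [← pow_mul, add_comm (n * w i), Ideal.filtration_add_eq (hNI' i) (Nat.le_add_left _ _),
      mul_comm (w i)]
  have hLX := fun w => exists_sum_relLength_toNat_le X hdim J (K w) hu
  set L : (Fin s → ℕ) → ℕ → ℕ → ℕ∞ := fun w b n =>
    relLength (K w ^ n • X) (J ^ b • (K w ^ n • X))
  set L' : (Fin s → ℕ) → ℕ → ℕ → ℕ∞ := fun w b n =>
    relLength (K w ^ n • Y) (F b • (K w ^ n • Y))
  have hLtop : ∀ w b n, L w b n ≠ ⊤ := fun w => (hLX w).1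
  have hLmono : ∀ w n, Monotone fun b => L w b n := fun w n b b' hb =>
    relLength_anti _ (Submodule.smul_mono (Ideal.pow_le_pow_right hb) le_rfl)
  have hL'mono : ∀ w n, Monotone fun b => L' w b n := fun w n b b' hb =>
    relLength_anti _ (Submodule.smul_mono (hanti hb) le_rfl)
  have hLL' : ∀ w, ∃ k, ∀ b n, L' w b n ≤ L w (b + k) n ∧ L w b n ≤ L' w (b + k) n := by
    intro w
    obtain ⟨k₁, hk₁⟩ := exists_relLength_le J (K w) hYX
    obtain ⟨k₂, hk₂⟩ := exists_relLength_le_of_regular J (K w) hx hxY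
    refine ⟨k₁ + (k₂ + N₀), fun b n => ⟨?_, ?_⟩⟩
    · calc L' w b n ≤ relLength (K w ^ n • Y) (J ^ b • (K w ^ n • Y)) :=
            relLength_anti _ (Submodule.smul_mono (Ideal.pow_le_filtration hF0 hgood1 b) le_rfl)
        _ ≤ L w (b + k₁) n := hk₁ b n
        _ ≤ _ := hLmono w n (by omega)
    · calc L w b n ≤ relLength (K w ^ n • Y) (J ^ (b + k₂) • (K w ^ n • Y)) := hk₂ b n
        _ ≤ L' w (b + k₂ + N₀) n := relLength_anti _
            (Submodule.smul_mono (Ideal.filtration_add_le_pow hNF' _) le_rfl)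
        _ ≤ _ := hL'mono w n (by omega)
  have hL'top : ∀ w b n, L' w b n ≠ ⊤ := fun w b n => by
    obtain ⟨k, hk⟩ := hLL' w
    exact ne_top_of_le_ne_top (hLtop _ _ _) (hk b n).1
  have hcast : ∀ {a b : ℕ∞}, b ≠ ⊤ → a ≤ b → (a.toNat : ℚ) ≤ b.toNat := fun hb hab =>
    Nat.cast_le.2 (ENat.toNat_le_toNat hab hb)
  obtain ⟨NP, hP⟩ := hP
  obtain ⟨NQ, hQ⟩ := hQ
  let Q' := MvPolynomial.translate (Fin.cons 0 fun _ => (c : ℚ)) Q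
  let P' := MvPolynomial.translate (Fin.cons 0 fun _ => ((c + N₀ : ℕ) : ℚ)) P
  have hdiffQ : ∀ w : Fin s → ℕ, (∀ i, 0 < w i) → ∀ b n : ℕ, NP + NQ ≤ b → NP + NQ ≤ n →
      ((L w (b + 1) n).toNat : ℚ) - (L w b n).toNat =
        MvPolynomial.eval (Fin.cons (b : ℚ) fun i => (n : ℚ) * w i) Q' := by
    intro w hw b n hb hn
    obtain ⟨l, hl, hlQ⟩ := hQ (Fin.cons b fun i => n * w i + c) (by
      refine Fin.cases (by simp; omega) fun i => ?_
      have := Nat.le_mul_of_pos_right n (hw i)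
      simp only [Fin.cons_succ]
      omega)
    have hl' : ModuleLengthIs A (↥(J ^ b • (K w ^ n • X)) ⧸ Submodule.comap
        (J ^ b • (K w ^ n • X)).subtype (J ^ (b + 1) • (K w ^ n • X))) l := by
      rw [hKX, smul_smul, smul_smul]
      exact hl
    rw [relLength_toNat_sub (Submodule.smul_mono (Ideal.pow_le_pow_right b.le_succ) le_rfl)
      Submodule.smul_le_right (hLtop w b n) hl', hlQ, MvPolynomial.eval_translate]
    congr 2
    funext i
    refine Fin.cases (by simp) (fun i => by simp) i
  have hdiffP : ∀ w : Fin s → ℕ, (∀ i, 0 < w i) → ∀ b n : ℕ, NP + NQ ≤ b → NP + NQ ≤ n →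
      ((L' w (b + 1) n).toNat : ℚ) - (L' w b n).toNat =
        MvPolynomial.eval (Fin.cons (b : ℚ) fun i => (n : ℚ) * w i) P' := by
    intro w hw b n hb hn
    obtain ⟨l, hl, hlP⟩ := hP (Fin.cons b fun i => n * w i + (c + N₀)) (by
      refine Fin.cases (by simp; omega) fun i => ?_
      have := Nat.le_mul_of_pos_right n (hw i)
      simp only [Fin.cons_succ]
      omega)
    have hl' : ModuleLengthIs A (↥(F b • (K w ^ n • Y)) ⧸ Submodule.comap
        (F b • (K w ^ n • Y)).subtype (F (b + 1) • (K w ^ n • Y))) l := by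
      rw [hKY, smul_smul, smul_smul]
      exact hl
    rw [relLength_toNat_sub (Submodule.smul_mono (hanti b.le_succ) le_rfl)
      Submodule.smul_le_right (hL'top w b n) hl', hlP, MvPolynomial.eval_translate]
    congr 2
    funext i
    refine Fin.cases (by simp) (fun i => by simp) i
  have hQ'deg : MvPolynomial.DegreeBelow Q' q :=
    MvPolynomial.degreeBelow_of_sum_le (L := fun w b n => ((L w b n).toNat : ℚ)) hdiffQ
      (fun _ _ _ => Nat.cast_nonneg _) (fun w n b b' hb => hcast (hLtop w b' n) (hLmono w n hb))
      fun w _ => (hLX w).2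
  have hP'deg : MvPolynomial.DegreeBelow P' q := by
    refine MvPolynomial.degreeBelow_of_sum_le (L := fun w b n => ((L' w b n).toNat : ℚ)) hdiffP
      (fun _ _ _ => Nat.cast_nonneg _) (fun w n b b' hb => hcast (hL'top w b' n) (hL'mono w n hb))
      fun w _ => ?_
    obtain ⟨k, hk⟩ := hLL' w
    obtain ⟨C, hC⟩ := (hLX w).2
    refine ⟨C * (1 + k) ^ (q + 1), fun t => ?_⟩
    rcases Nat.eq_zero_or_pos t with rfl | ht
    · simp
    calc ∑ n ∈ Finset.range t, ((L' w t n).toNat : ℚ)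
        ≤ ∑ n ∈ Finset.range t, ((L w (t + k) n).toNat : ℚ) :=
          Finset.sum_le_sum fun n _ => hcast (hLtop _ _ _) (hk t n).1
      _ ≤ ∑ n ∈ Finset.range (t + k), ((L w (t + k) n).toNat : ℚ) :=
          Finset.sum_le_sum_of_subset_of_nonneg (Finset.range_mono (Nat.le_add_right _ _))
            fun _ _ _ => Nat.cast_nonneg _
      _ ≤ C * ((t + k : ℕ) : ℚ) ^ (q + 1) := hC _
      _ ≤ C * (((1 + k) * t : ℕ) : ℚ) ^ (q + 1) := by
          gcongr
          nlinarith
      _ = _ := by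
          push_cast
          rw [mul_pow]
          ring
  have hq' : q ≤ q - 1 + 1 := by omega
  have hdeg := MvPolynomial.degreeBelow_sub_of_interlace (hP'deg.mono hq') (hQ'deg.mono hq')
    (L := fun w b n => ((L w b n).toNat : ℚ)) (L' := fun w b n => ((L' w b n).toNat : ℚ)) hdiffQ hdiffP fun w _ => by
      obtain ⟨k, hk⟩ := hLL' w
      exact ⟨k, fun b n => ⟨hcast (hLtop _ _ _) (hk b n).1, hcast (hL'top _ _ _) (hk b n).2⟩⟩
  intro k hk
  have hk' : q - 1 ≤ k.degree := by rw [Finsupp.degree_eq_sum, hk]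
  have h1 := ((hP'deg.mono hq').of_translate_sub) k hk'
  have h2 := ((hQ'deg.mono hq').of_translate_sub) k hk'
  have h3 := hdeg k hk'
  rw [MvPolynomial.coeff_sub] at h1 h2 h3
  linarith
end
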